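/- Fix a real constant C > 0. For an integral binary quartic form f define its height h_C(f) = max(|I(f)|, |J(f)|/C). Let N_C(V^{(2+)};X) (respectively N_C(V^{(2−)};X)) be the number of GL_2(ℤ)-equivalence classes of irreducible integral binary quartic forms f with no real roots in P^1(ℂ) that are positive definite (f(x,y) > 0 for all real (x,y) ≠ (0,0)) (respectively negative definite, f(x,y) < 0 for all real (x,y) ≠ (0,0)) and h_C(f) < X. Then N_C(V^{(2+)};X) = (C·ζ(2)/27)·X^2 + o(X^2) and N_C(V^{(2−)};X) = (C·ζ(2)/27)·X^2 + o(X^2) as X → ∞. -/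

import Mathlib

open Filter

/-- An integral binary quartic form `a x⁴ + b x³y + c x²y² + d xy³ + e y⁴`. -/
structure BQF where
  a : ℤ
  b : ℤ
  c : ℤ
  d : ℤ
  e : ℤ

namespace BQF

/-- The invariant `I` of a binary quartic form. -/
def I (f : BQF) : ℤ := 12 * f.a * f.e - 3 * f.b * f.d + f.c ^ 2

/-- The invariant `J` of a binary quartic form. -/
def J (f : BQF) : ℤ :=
  72 * f.a * f.c * f.e + 9 * f.b * f.c * f.d - 27 * f.a * f.d ^ 2 -
    27 * f.e * f.b ^ 2 - 2 * f.c ^ 3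

/-- Evaluation of the form at a pair of integers. -/
def evalZ (f : BQF) (x y : ℤ) : ℤ :=
  f.a * x ^ 4 + f.b * x ^ 3 * y + f.c * x ^ 2 * y ^ 2 + f.d * x * y ^ 3 + f.e * y ^ 4

/-- Evaluation of the form at a pair of reals. -/
noncomputable def evalR (f : BQF) (x y : ℝ) : ℝ :=
  (f.a : ℝ) * x ^ 4 + (f.b : ℝ) * x ^ 3 * y + (f.c : ℝ) * x ^ 2 * y ^ 2 +
    (f.d : ℝ) * x * y ^ 3 + (f.e : ℝ) * y ^ 4

/-- `GL₂(ℤ)`-equivalence: `g = γ · f` where `(γ · f)(x,y) = f((x,y)γ)` for some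
integer matrix `γ` with unit (i.e. `±1`) determinant. -/
def Equivalent (f g : BQF) : Prop :=
  ∃ γ : Matrix (Fin 2) (Fin 2) ℤ, IsUnit γ.det ∧
    ∀ x y : ℤ, g.evalZ x y = f.evalZ (x * γ 0 0 + y * γ 1 0) (x * γ 0 1 + y * γ 1 1)

/-- Irreducibility of the form over `ℚ`: it has no factor of positive degree with
rational coefficients.  Equivalently, `a ≠ 0` (no root at infinity, i.e. no factor `y`)
and the dehomogenized quartic polynomial is irreducible over `ℚ`. -/
def Irred (f : BQF) : Prop :=
  f.a ≠ 0 ∧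
    Irreducible (Polynomial.C (f.a : ℚ) * Polynomial.X ^ 4 +
      Polynomial.C (f.b : ℚ) * Polynomial.X ^ 3 +
      Polynomial.C (f.c : ℚ) * Polynomial.X ^ 2 +
      Polynomial.C (f.d : ℚ) * Polynomial.X + Polynomial.C (f.e : ℚ))

/-- The set of real roots of `f`; for a form with `a ≠ 0` all roots of `f` in `ℙ¹(ℝ)`
have the shape `(z : 1)` with `z` real. -/
def realRoots (f : BQF) : Set ℝ := {z : ℝ | f.evalR z 1 = 0}

end BQF

/-- The number of `GL₂(ℤ)`-equivalence classes of integral binary quartic forms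
satisfying the predicate `P`. -/
noncomputable def classCount (P : BQF → Prop) : ℕ :=
  Nat.card (Quot fun f g : {h : BQF // P h} => BQF.Equivalent f.1 g.1)



/-! ## Real forms and reduction theory -/

/-- evaluation of a real quartic -/
noncomputable def ev (a b c d e x y : ℝ) : ℝ :=
  a * x ^ 4 + b * x ^ 3 * y + c * x ^ 2 * y ^ 2 + d * x * y ^ 3 + e * y ^ 4

def PD (a b c d e : ℝ) : Prop := ∀ x y : ℝ, ¬(x = 0 ∧ y = 0) → 0 < ev a b c d e x y

lemma ev_coeffs {a b c d e a' b' c' d' e' : ℝ}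
    (h : ∀ x y, ev a b c d e x y = ev a' b' c' d' e' x y) :
    a = a' ∧ b = b' ∧ c = c' ∧ d = d' ∧ e = e' := by
  have h1 := h 1 0
  have h2 := h 0 1
  have h3 := h 1 1
  have h4 := h 1 (-1)
  have h5 := h 2 1
  simp only [ev] at h1 h2 h3 h4 h5
  norm_num at h1 h2 h3 h4 h5
  subst h1; subst h2
  refine ⟨rfl, ?_, ?_, ?_, rfl⟩ <;> linarith

lemma qr_form (A B C p1 q1 p2 q2 : ℝ) (hd : p1 * q2 - p2 * q1 ≠ 0) :
    ∃ A' B' C' : ℝ, ∀ X Y : ℝ, ev A B C (-B) A (p1 * X + q1 * Y) (p2 * X + q2 * Y) =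
      ev A' B' C' (-B') A' (X + (p1 * q1 + p2 * q2) / (p1 ^ 2 + p2 ^ 2) * Y)
        (|p1 * q2 - p2 * q1| / (p1 ^ 2 + p2 ^ 2) * Y) := by
  have hn : p1 ^ 2 + p2 ^ 2 ≠ 0 := by
    intro h
    have h1 : p1 = 0 := by nlinarith [sq_nonneg p1, sq_nonneg p2]
    have h2 : p2 = 0 := by nlinarith [sq_nonneg p1, sq_nonneg p2]
    subst h1; subst h2; simp at hd
  have key : ∀ σ : ℝ, σ ^ 2 = 1 → |p1 * q2 - p2 * q1| = σ * (p1 * q2 - p2 * q1) →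
    ∃ A' B' C' : ℝ, ∀ X Y : ℝ, ev A B C (-B) A (p1 * X + q1 * Y) (p2 * X + q2 * Y) =
      ev A' B' C' (-B') A' (X + (p1 * q1 + p2 * q2) / (p1 ^ 2 + p2 ^ 2) * Y)
        (|p1 * q2 - p2 * q1| / (p1 ^ 2 + p2 ^ 2) * Y) := by
    intro σ hσ hab
    refine ⟨ev A B C (-B) A p1 p2, σ * (-4 * A * p1 ^ 3 * p2 + 4 * A * p1 * p2 ^ 3
      + B * (p1 ^ 4 - 6 * p1 ^ 2 * p2 ^ 2 + p2 ^ 4) + C * (2 * p1 ^ 3 * p2 - 2 * p1 * p2 ^ 3)),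
      12 * A * p1 ^ 2 * p2 ^ 2 + 6 * B * (p1 * p2 ^ 3 - p1 ^ 3 * p2)
        + C * (p1 ^ 4 + p2 ^ 4 - 4 * p1 ^ 2 * p2 ^ 2), fun X Y => ?_⟩
    rw [hab]
    set U := X + (p1 * q1 + p2 * q2) / (p1 ^ 2 + p2 ^ 2) * Y with hU
    set W := (p1 * q2 - p2 * q1) / (p1 ^ 2 + p2 ^ 2) * Y with hW
    have e1 : p1 * X + q1 * Y = p1 * U - p2 * W := by rw [hU, hW]; field_simp; ring
    have e2 : p2 * X + q2 * Y = p2 * U + p1 * W := by rw [hU, hW]; field_simp; ring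
    have e3 : σ * (p1 * q2 - p2 * q1) / (p1 ^ 2 + p2 ^ 2) * Y = σ * W := by rw [hW]; ring
    rw [e1, e2, e3]
    simp only [ev]

    rcases (show σ = 1 ∨ σ = -1 by simpa using hσ) with rfl | rfl <;> ring
  rcases abs_choice (p1 * q2 - p2 * q1) with h | h
  · exact key 1 (by norm_num) (by rw [h]; ring)
  · exact key (-1) (by norm_num) (by rw [h]; ring)


lemma gauss_red (x y : ℝ) (hy : 0 < y) : ∃ p q r s : ℤ, (p * s - q * r = 1 ∨ p * s - q * r = -1) ∧
    0 ≤ (p + x * q) * (r + x * s) + y ^ 2 * q * s ∧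
    2 * ((p + x * q) * (r + x * s) + y ^ 2 * q * s) ≤ (p + x * q) ^ 2 + y ^ 2 * q ^ 2 ∧
    (p + x * q) ^ 2 + y ^ 2 * q ^ 2 ≤ (r + x * s) ^ 2 + y ^ 2 * (s : ℝ) ^ 2 := by
  let F : ℤ × ℤ × ℤ × ℤ → ℝ := fun v => (v.1 + x * v.2.1) ^ 2 + y ^ 2 * v.2.1 ^ 2 +
    ((v.2.2.1 + x * v.2.2.2) ^ 2 + y ^ 2 * v.2.2.2 ^ 2)
  let S : Set (ℤ × ℤ × ℤ × ℤ) := {v | (v.1 * v.2.2.2 - v.2.1 * v.2.2.1 = 1 ∨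
    v.1 * v.2.2.2 - v.2.1 * v.2.2.1 = -1) ∧ F v ≤ F (1, 0, 0, 1)}
  have hbd : ∀ F0 : ℝ, ∃ K : ℤ, ∀ p q : ℤ, (p + x * q) ^ 2 + y ^ 2 * (q : ℝ) ^ 2 ≤ F0 →
      -K ≤ p ∧ p ≤ K ∧ -K ≤ q ∧ q ≤ K := by
    intro F0
    have hF : 0 ≤ |F0| := abs_nonneg _
    have hF' := le_abs_self F0
    refine ⟨⌈√|F0| / y⌉ + ⌈√|F0| + |x| * (√|F0| / y)⌉, fun p q h => ?_⟩
    have hs := Real.sqrt_nonneg |F0|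
    have h1 : |(q : ℝ)| ≤ √|F0| / y := by
      rw [le_div_iff₀ hy]
      apply Real.le_sqrt_of_sq_le
      rw [mul_pow, sq_abs]
      nlinarith [sq_nonneg (p + x * q : ℝ)]
    have h2 : |(p + x * q : ℝ)| ≤ √|F0| := by
      apply Real.le_sqrt_of_sq_le
      rw [sq_abs]
      nlinarith [sq_nonneg (y * q : ℝ)]
    have h3 : |(p : ℝ)| ≤ √|F0| + |x| * (√|F0| / y) := by
      have : (p : ℝ) = (p + x * q) - x * q := by ring
      rw [this]
      refine (abs_sub _ _).trans ?_
      rw [abs_mul]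
      gcongr
    have h4 := h1.trans (Int.le_ceil _)
    have h5 := h3.trans (Int.le_ceil _)
    have e1 : 0 ≤ ⌈√|F0| / y⌉ := Int.ceil_nonneg (by positivity)
    have e2 : 0 ≤ ⌈√|F0| + |x| * (√|F0| / y)⌉ := Int.ceil_nonneg (by positivity)
    have h6 : |q| ≤ ⌈√|F0| / y⌉ := by exact_mod_cast h4
    have h7 : |p| ≤ ⌈√|F0| + |x| * (√|F0| / y)⌉ := by exact_mod_cast h5
    rw [abs_le] at h6 h7
    omega
  have hfin : S.Finite := by
    obtain ⟨K, hK⟩ := hbd (F (1, 0, 0, 1))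
    refine (Set.finite_Icc ((-K, -K, -K, -K) : ℤ × ℤ × ℤ × ℤ) (K, K, K, K)).subset ?_
    rintro ⟨p, q, r, s⟩ ⟨_, h⟩
    have h1 := hK p q (le_trans (by simp only [F]; nlinarith [sq_nonneg (r + x * s), sq_nonneg (y * s)]) h)
    have h2 := hK r s (le_trans (by simp only [F]; nlinarith [sq_nonneg (p + x * q), sq_nonneg (y * q)]) h)
    simp only [Set.mem_Icc, Prod.mk_le_mk]
    tauto
  obtain ⟨⟨p, q, r, s⟩, ⟨hdet, hle⟩, hmin⟩ := Set.exists_min_image S F hfin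
    ⟨(1, 0, 0, 1), by simp [S]⟩
  have hmin' : ∀ p' q' r' s' : ℤ, (p' * s' - q' * r' = 1 ∨ p' * s' - q' * r' = -1) →
      F (p, q, r, s) ≤ F (p', q', r', s') := by
    intro p' q' r' s' h
    by_contra hlt
    push Not at hlt
    exact absurd (hmin (p', q', r', s') ⟨h, (hlt.le.trans hle)⟩) (not_le.mpr hlt)
  have m1 := hmin' p q (r + p) (s + q) (by convert hdet using 2 <;> ring)
  have m2 := hmin' p q (r - p) (s - q) (by convert hdet using 2 <;> ring)
  have m3 := hmin' (p + r) (q + s) r s (by convert hdet using 2 <;> ring)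
  have m4 := hmin' (p - r) (q - s) r s (by convert hdet using 2 <;> ring)
  simp only [F] at m1 m2 m3 m4
  push_cast at m1 m2 m3 m4
  rcases le_total ((p + x * q) ^ 2 + y ^ 2 * (q : ℝ) ^ 2) ((r + x * s) ^ 2 + y ^ 2 * (s : ℝ) ^ 2) with h | h <;>
  rcases le_total 0 ((p + x * q) * (r + x * s) + y ^ 2 * q * (s : ℝ)) with h' | h'
  · exact ⟨p, q, r, s, hdet, h', by linarith, h⟩
  · refine ⟨p, q, -r, -s, by rcases hdet with h | h <;> [right; left] <;> linarith, ?_⟩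
    push_cast
    refine ⟨?_, ?_, ?_⟩ <;> linarith
  · refine ⟨r, s, p, q, by rcases hdet with h | h <;> [right; left] <;> linarith, ?_⟩
    refine ⟨?_, ?_, ?_⟩ <;> linarith
  · refine ⟨r, s, -p, -q, by rcases hdet with h | h <;> [left; right] <;> linarith, ?_⟩
    push_cast
    refine ⟨?_, ?_, ?_⟩ <;> linarith

lemma pd_factor {a b c d e : ℝ} (h : PD a b c d e) : ∃ x1 y1 x2 y2 : ℝ, 0 < y1 ∧ 0 < y2 ∧
    ∀ x y, ev a b c d e x y = a * ((x + x1 * y) ^ 2 + y1 ^ 2 * y ^ 2) *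
      ((x + x2 * y) ^ 2 + y2 ^ 2 * y ^ 2) := by
  open Polynomial in
  have ha : 0 < a := by simpa [ev] using h 1 0 (by simp)
  let P : ℝ[X] := C a * X ^ 4 + C b * X ^ 3 + C c * X ^ 2 + C d * X + C e
  have hPe : ∀ t, P.eval t = ev a b c d e t 1 := by intro t; simp [P, ev]
  have hP4 : P.natDegree = 4 := by
    have : P = C a * X ^ 4 + (C b * X ^ 3 + (C c * X ^ 2 + C d * X + C e)) := by simp only [P]; ring
    simp only [P]
    compute_degree!
    exact ha.ne'
  have hP0 : P ≠ 0 := by intro h0; rw [h0] at hP4; simp at hP4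
  have hPu : ¬ IsUnit P := by
    intro hu; have := natDegree_eq_zero_of_isUnit hu; omega
  have hroot : ∀ t, P.eval t ≠ 0 := fun t => by
    rw [hPe]; exact (h t 1 (by simp)).ne'
  obtain ⟨q, hq, r, hqr⟩ := WfDvdMonoid.exists_irreducible_factor hPu hP0
  have hq0 : q ≠ 0 := hq.ne_zero
  have hr0 : r ≠ 0 := by rintro rfl; simp at hqr; exact hP0 hqr
  have hq2 := hq.natDegree_le_two
  have hq1 : 0 < q.natDegree := hq.natDegree_pos
  have hdeg : q.natDegree + r.natDegree = 4 := by rw [← natDegree_mul hq0 hr0, ← hqr, hP4]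
  have hqdeg : q.natDegree = 2 := by
    by_contra hne
    have h1 : q.natDegree = 1 := by omega
    have h1' : q.degree = 1 := by rw [degree_eq_natDegree hq0, h1]; rfl
    obtain ⟨t, ht⟩ := exists_root_of_degree_eq_one h1'
    apply hroot t
    rw [hqr, eval_mul, ht.eq_zero, zero_mul]
  have hrdeg : r.natDegree = 2 := by omega
  have quad : ∀ s : ℝ[X], s.natDegree = 2 → (∀ t, s.eval t ≠ 0) → ∃ k x1 y1 : ℝ, 0 < y1 ∧
      ∀ t, s.eval t = k * ((t + x1) ^ 2 + y1 ^ 2) := by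
    intro s hs hns
    have hev : ∀ t, s.eval t = s.coeff 0 + s.coeff 1 * t + s.coeff 2 * t ^ 2 := by
      intro t; rw [eval_eq_sum_range, hs]; simp [Finset.sum_range_succ]
    have hk : s.coeff 2 ≠ 0 := by
      rw [← hs]; intro h0
      have := leadingCoeff_eq_zero.mp h0
      rw [this] at hs; simp at hs
    set k := s.coeff 2
    set l := s.coeff 1
    set m := s.coeff 0
    have hpos : 0 < m / k - (l / (2 * k)) ^ 2 := by
      by_contra hle
      push Not at hle
      apply hns (-(l / (2 * k)) + √((l / (2 * k)) ^ 2 - m / k))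
      rw [hev]
      have hsq := Real.sq_sqrt (show 0 ≤ (l / (2 * k)) ^ 2 - m / k by linarith)
      set w := √((l / (2 * k)) ^ 2 - m / k)
      have : m + l * (-(l / (2 * k)) + w) + k * (-(l / (2 * k)) + w) ^ 2 =
        m - k * (l / (2 * k)) ^ 2 + k * w ^ 2 := by field_simp; ring
      rw [this, hsq]; field_simp; ring
    refine ⟨k, l / (2 * k), √(m / k - (l / (2 * k)) ^ 2), Real.sqrt_pos.mpr hpos, fun t => ?_⟩
    rw [hev, Real.sq_sqrt hpos.le]; field_simp; ring
  obtain ⟨k1, x1, y1, hy1, e1⟩ := quad q hqdeg (fun t ht => hroot t (by rw [hqr, eval_mul, ht, zero_mul]))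
  obtain ⟨k2, x2, y2, hy2, e2⟩ := quad r hrdeg (fun t ht => hroot t (by rw [hqr, eval_mul, ht, mul_zero]))
  have hall : ∀ t, ev a b c d e t 1 = k1 * ((t + x1) ^ 2 + y1 ^ 2) * (k2 * ((t + x2) ^ 2 + y2 ^ 2)) := by
    intro t; rw [← hPe, hqr, eval_mul, e1, e2]
  refine ⟨x1, y1, x2, y2, hy1, hy2, fun x y => ?_⟩
  have g0 := hall 0
  have g1 := hall 1
  have g2 := hall (-1)
  have g3 := hall 2
  have g4 := hall (-2)
  simp only [ev] at g0 g1 g2 g3 g4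
  have hc4 : a = k1 * k2 := by nlinarith
  have hc0 : e = a * (x1 ^ 2 + y1 ^ 2) * (x2 ^ 2 + y2 ^ 2) := by rw [hc4]; linarith
  have hc3 : b = a * (2 * x1 + 2 * x2) := by rw [hc4]; linarith
  have hc2 : c = a * (x1 ^ 2 + y1 ^ 2 + (x2 ^ 2 + y2 ^ 2) + 4 * x1 * x2) := by rw [hc4]; linarith
  have hc1 : d = a * (2 * x1 * (x2 ^ 2 + y2 ^ 2) + 2 * x2 * (x1 ^ 2 + y1 ^ 2)) := by rw [hc4]; linarith
  simp only [ev]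
  rw [hc0, hc3, hc2, hc1]; ring


/-- second..fifth coefficient of the form with parameters `A B C x y` -/
def pb (A B x y : ℝ) : ℝ := 4 * A * x + B * y
def pc (A B C x y : ℝ) : ℝ := 6 * A * x ^ 2 + 3 * B * x * y + C * y ^ 2
def pd (A B C x y : ℝ) : ℝ := 4 * A * x ^ 3 + 3 * B * x ^ 2 * y + 2 * C * x * y ^ 2 - B * y ^ 3
def pe (A B C x y : ℝ) : ℝ :=
  A * x ^ 4 + B * x ^ 3 * y + C * x ^ 2 * y ^ 2 - B * x * y ^ 3 + A * y ^ 4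

lemma ev_par (A B C x y X Y : ℝ) :
    ev A (pb A B x y) (pc A B C x y) (pd A B C x y) (pe A B C x y) X Y =
      ev A B C (-B) A (X + x * Y) (y * Y) := by
  simp only [ev, pb, pc, pd, pe]; ring

lemma pd_par {a b c d e : ℝ} (h : PD a b c d e) : ∃ B C x y : ℝ, 0 < y ∧
    ∀ X Y, ev a b c d e X Y = ev a B C (-B) a (X + x * Y) (y * Y) := by
  obtain ⟨x1, y1, x2, y2, hy1, hy2, hf⟩ := pd_factor h
  set w := y1 * y2 * ((x1 - x2) ^ 2 + (y1 + y2) ^ 2) with hw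
  have hwp : 0 < w := by positivity
  have hsq := Real.sq_sqrt hwp.le
  have hsp := Real.sqrt_pos.mpr hwp
  set v := √w
  have hs : 0 < y1 + y2 := by positivity
  set s := y1 + y2 with hs_def
  set y := v / s with hy
  have hyp : 0 < y := by positivity
  have hy2' : y ^ 2 = w / s ^ 2 := by rw [hy, div_pow, hsq]
  set x := (x1 * y2 + x2 * y1) / s with hx
  set s1 := (x1 - x2) * y1 / s with hs1
  set s2 := -(x1 - x2) * y2 / s with hs2
  have hx1 : x1 = x + s1 := by rw [hx, hs1, hs_def]; field_simp; ring
  have hx2 : x2 = x + s2 := by rw [hx, hs2, hs_def]; field_simp; ring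
  have k1 : 2 * s1 * (s2 ^ 2 + y2 ^ 2) + 2 * s2 * (s1 ^ 2 + y1 ^ 2) = -(2 * s1 + 2 * s2) * y ^ 2 := by
    rw [hy2', hs1, hs2, hw, hs_def]; field_simp; ring
  have k2 : (s1 ^ 2 + y1 ^ 2) * (s2 ^ 2 + y2 ^ 2) = (y ^ 2) ^ 2 := by
    rw [hy2', hs1, hs2, hw, hs_def]; field_simp
  refine ⟨a * (2 * s1 + 2 * s2) / y, a * (s1 ^ 2 + y1 ^ 2 + (s2 ^ 2 + y2 ^ 2) + 4 * s1 * s2) / y ^ 2,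
    x, y, hyp, fun X Y => ?_⟩
  rw [hf, hx1, hx2]
  have e1 : X + (x + s1) * Y = (X + x * Y) + s1 * Y := by ring
  have e2 : X + (x + s2) * Y = (X + x * Y) + s2 * Y := by ring
  rw [e1, e2]
  generalize X + x * Y = U
  have : ev a (a * (2 * s1 + 2 * s2) / y) (a * (s1 ^ 2 + y1 ^ 2 + (s2 ^ 2 + y2 ^ 2) + 4 * s1 * s2) / y ^ 2)
     (-(a * (2 * s1 + 2 * s2) / y)) a U (y * Y) = a * U ^ 4 + a * (2 * s1 + 2 * s2) * U ^ 3 * Y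
     + a * (s1 ^ 2 + y1 ^ 2 + (s2 ^ 2 + y2 ^ 2) + 4 * s1 * s2) * U ^ 2 * Y ^ 2
     + a * (-(2 * s1 + 2 * s2) * y ^ 2) * U * Y ^ 3 + a * (y ^ 2) ^ 2 * Y ^ 4 := by
    simp only [ev]; field_simp
  rw [this, ← k1, ← k2]; ring

/-- `f` has reduced parameters -/
def RedPar (a b c d e A B C x y : ℝ) : Prop :=
  0 < y ∧ a = A ∧ b = pb A B x y ∧ c = pc A B C x y ∧ d = pd A B C x y ∧ e = pe A B C x y

def BQF.PDf (f : BQF) : Prop := PD f.a f.b f.c f.d f.e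

lemma BQF.evalR_eq (f : BQF) (x y : ℝ) : f.evalR x y = ev f.a f.b f.c f.d f.e x y := rfl

/-- transformed form -/
def BQF.tr (f : BQF) (p q r s : ℤ) : BQF where
  a := f.evalZ p q
  b := 4 * f.a * p ^ 3 * r + f.b * (p ^ 3 * s + 3 * p ^ 2 * r * q) +
    f.c * (2 * p ^ 2 * q * s + 2 * p * r * q ^ 2) + f.d * (3 * p * q ^ 2 * s + r * q ^ 3) +
    4 * f.e * q ^ 3 * s
  c := 6 * f.a * p ^ 2 * r ^ 2 + f.b * (3 * p ^ 2 * r * s + 3 * p * r ^ 2 * q) +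
    f.c * (p ^ 2 * s ^ 2 + 4 * p * r * q * s + r ^ 2 * q ^ 2) +
    f.d * (3 * p * q * s ^ 2 + 3 * r * q ^ 2 * s) + 6 * f.e * q ^ 2 * s ^ 2
  d := 4 * f.a * p * r ^ 3 + f.b * (3 * p * r ^ 2 * s + r ^ 3 * q) +
    f.c * (2 * p * r * s ^ 2 + 2 * r ^ 2 * q * s) + f.d * (p * s ^ 3 + 3 * r * q * s ^ 2) +
    4 * f.e * q * s ^ 3
  e := f.evalZ r s

lemma BQF.tr_eval (f : BQF) (p q r s x y : ℤ) :
    (f.tr p q r s).evalZ x y = f.evalZ (x * p + y * r) (x * q + y * s) := by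
  simp only [BQF.tr, BQF.evalZ]; ring

lemma BQF.tr_evalR (f : BQF) (p q r s : ℤ) (x y : ℝ) :
    (f.tr p q r s).evalR x y = f.evalR (x * p + y * r) (x * q + y * s) := by
  simp only [BQF.tr, BQF.evalZ, BQF.evalR]; push_cast; ring

lemma BQF.tr_equiv (f : BQF) (p q r s : ℤ) (h : p * s - q * r = 1 ∨ p * s - q * r = -1) :
    BQF.Equivalent f (f.tr p q r s) := by
  refine ⟨!![p, q; r, s], ?_, fun x y => by simpa using f.tr_eval p q r s x y⟩
  rw [Matrix.det_fin_two_of, Int.isUnit_iff]; exact h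

lemma BQF.ext_eval {f g : BQF} (h : ∀ x y, f.evalZ x y = g.evalZ x y) : f = g := by
  have h1 := h 1 0
  have h2 := h 0 1
  have h3 := h 1 1
  have h4 := h 1 (-1)
  have h5 := h 2 1
  cases f; cases g
  simp only [BQF.evalZ] at h1 h2 h3 h4 h5
  norm_num at h1 h2 h3 h4 h5
  subst h1; subst h2
  simp only [BQF.mk.injEq, true_and, and_true]
  refine ⟨?_, ?_, ?_⟩ <;> linarith

lemma BQF.equiv_iff {f g : BQF} : BQF.Equivalent f g ↔ ∃ p q r s : ℤ,
    (p * s - q * r = 1 ∨ p * s - q * r = -1) ∧ g = f.tr p q r s := by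
  constructor
  · rintro ⟨γ, hu, h⟩
    refine ⟨γ 0 0, γ 0 1, γ 1 0, γ 1 1, ?_, BQF.ext_eval fun x y => ?_⟩
    · rw [Matrix.det_fin_two, Int.isUnit_iff] at hu; exact hu
    · rw [h, BQF.tr_eval]
  · rintro ⟨p, q, r, s, h, rfl⟩
    exact BQF.tr_equiv f p q r s h

lemma BQF.equiv_symm {f g : BQF} (h : BQF.Equivalent f g) : BQF.Equivalent g f := by
  obtain ⟨p, q, r, s, hd, rfl⟩ := BQF.equiv_iff.mp h
  rw [BQF.equiv_iff]
  rcases hd with hd | hd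
  · refine ⟨s, -q, -r, p, by left; linarith, BQF.ext_eval fun x y => ?_⟩
    rw [BQF.tr_eval, BQF.tr_eval]
    congr 1
    · linear_combination (-x) * hd
    · linear_combination (-y) * hd
  · refine ⟨-s, q, r, -p, by right; linarith, BQF.ext_eval fun x y => ?_⟩
    rw [BQF.tr_eval, BQF.tr_eval]
    congr 1
    · linear_combination x * hd
    · linear_combination y * hd

lemma BQF.equiv_trans {f g h : BQF} (h1 : BQF.Equivalent f g) (h2 : BQF.Equivalent g h) :
    BQF.Equivalent f h := by
  obtain ⟨p, q, r, s, hd, rfl⟩ := BQF.equiv_iff.mp h1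
  obtain ⟨p', q', r', s', hd', rfl⟩ := BQF.equiv_iff.mp h2
  rw [BQF.equiv_iff]
  refine ⟨p' * p + q' * r, p' * q + q' * s, r' * p + s' * r, r' * q + s' * s, ?_,
    BQF.ext_eval fun x y => ?_⟩
  · have : (p' * p + q' * r) * (r' * q + s' * s) - (p' * q + q' * s) * (r' * p + s' * r) =
      (p * s - q * r) * (p' * s' - q' * r') := by ring
    rw [this]
    rcases hd with h | h <;> rcases hd' with h' | h' <;> rw [h, h'] <;> simp
  · rw [BQF.tr_eval, BQF.tr_eval, BQF.tr_eval]; congr 1 <;> ring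

lemma BQF.equiv_refl (f : BQF) : BQF.Equivalent f f := by
  rw [BQF.equiv_iff]
  exact ⟨1, 0, 0, 1, by simp, BQF.ext_eval fun x y => by rw [BQF.tr_eval]; simp⟩

lemma BQF.tr_I (f : BQF) (p q r s : ℤ) : (f.tr p q r s).I = (p * s - q * r) ^ 4 * f.I := by
  simp only [BQF.tr, BQF.I, BQF.evalZ]; ring

lemma BQF.tr_J (f : BQF) (p q r s : ℤ) : (f.tr p q r s).J = (p * s - q * r) ^ 6 * f.J := by
  simp only [BQF.tr, BQF.J, BQF.evalZ]; ring

lemma BQF.equiv_I {f g : BQF} (h : BQF.Equivalent f g) : g.I = f.I := by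
  obtain ⟨p, q, r, s, hd, rfl⟩ := BQF.equiv_iff.mp h
  rw [BQF.tr_I]; rcases hd with h | h <;> rw [h] <;> norm_num

lemma BQF.equiv_J {f g : BQF} (h : BQF.Equivalent f g) : g.J = f.J := by
  obtain ⟨p, q, r, s, hd, rfl⟩ := BQF.equiv_iff.mp h
  rw [BQF.tr_J]; rcases hd with h | h <;> rw [h] <;> norm_num

lemma BQF.equiv_PD {f g : BQF} (h : BQF.Equivalent f g) (hf : f.PDf) : g.PDf := by
  obtain ⟨p, q, r, s, hd, rfl⟩ := BQF.equiv_iff.mp h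
  intro x y hxy
  rw [← BQF.evalR_eq, BQF.tr_evalR]
  apply hf
  rintro ⟨h1, h2⟩
  apply hxy
  have hd' : ((p : ℝ) * s - q * r) ^ 2 = 1 := by
    have : (p * s - q * r) ^ 2 = 1 := by rcases hd with h | h <;> rw [h] <;> norm_num
    exact_mod_cast this
  have h3 : ((p : ℝ) * s - q * r) * x = 0 := by linear_combination s * h1 - r * h2
  have h4 : ((p : ℝ) * s - q * r) * y = 0 := by linear_combination p * h2 - q * h1
  have hne : ((p : ℝ) * s - q * r) ≠ 0 := by rintro h0; rw [h0] at hd'; norm_num at hd'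
  exact ⟨(mul_eq_zero.mp h3).resolve_left hne, (mul_eq_zero.mp h4).resolve_left hne⟩

/-- Every positive definite form is equivalent to one with reduced parameters. -/
lemma BQF.exists_red (f : BQF) (hf : f.PDf) : ∃ g : BQF, BQF.Equivalent f g ∧ ∃ B C x y : ℝ,
    RedPar g.a g.b g.c g.d g.e g.a B C x y ∧ 0 ≤ x ∧ x ≤ 1 / 2 ∧ 1 ≤ x ^ 2 + y ^ 2 := by
  obtain ⟨B, C, x, y, hy, hev⟩ := pd_par hf
  obtain ⟨p, q, r, s, hd, h1, h2, h3⟩ := gauss_red x y hy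
  refine ⟨f.tr p q r s, f.tr_equiv p q r s hd, ?_⟩
  have hd' : ((p : ℝ) * s - q * r) ^ 2 = 1 := by
    have : (p * s - q * r) ^ 2 = 1 := by rcases hd with h | h <;> rw [h] <;> norm_num
    exact_mod_cast this
  have hdd : (p + x * q) * (y * s) - (y * q) * (r + x * s) = y * ((p : ℝ) * s - q * r) := by ring
  have hne : ((p : ℝ) * s - q * r) ≠ 0 := by rintro h0; rw [h0] at hd'; norm_num at hd'
  obtain ⟨A', B', C', hqr⟩ := qr_form f.a B C (p + x * q) (r + x * s) (y * q) (y * s)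
    (by rw [hdd]; positivity)
  set n := (p + x * q) ^ 2 + (y * q) ^ 2 with hn
  have hn0 : 0 ≤ n := by positivity
  have hnn : n ≠ 0 := by
    intro h0
    have z1 : (p + x * q : ℝ) = 0 := by nlinarith [sq_nonneg (p + x * q : ℝ), sq_nonneg (y * q : ℝ)]
    have z2 : (y * q : ℝ) = 0 := by nlinarith [sq_nonneg (p + x * q : ℝ), sq_nonneg (y * q : ℝ)]
    rw [z1, z2] at hdd
    have : y * ((p : ℝ) * s - q * r) = 0 := by rw [← hdd]; ring
    exact (mul_ne_zero hy.ne' hne) this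
  have hnp : 0 < n := lt_of_le_of_ne hn0 (Ne.symm hnn)
  have hD : 0 < |(p + x * q) * (y * s) - (y * q) * (r + x * s)| := by
    rw [hdd, abs_pos]; exact mul_ne_zero hy.ne' hne
  set x' := ((p + x * q) * (r + x * s) + (y * q) * (y * s)) / n with hx'
  set y' := |(p + x * q) * (y * s) - (y * q) * (r + x * s)| / n with hy'
  have hfin : ∀ X Y : ℝ, (f.tr p q r s).evalR X Y = ev A' B' C' (-B') A' (X + x' * Y) (y' * Y) := by
    intro X Y
    rw [BQF.tr_evalR, BQF.evalR_eq, hev, ← hqr]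
    congr 1 <;> ring
  simp only [BQF.evalR_eq, ← ev_par] at hfin
  obtain ⟨c1, c2, c3, c4, c5⟩ := ev_coeffs hfin
  have hxy : x' ^ 2 + y' ^ 2 = ((r + x * s) ^ 2 + y ^ 2 * (s : ℝ) ^ 2) / n := by
    rw [hx', hy', div_pow, div_pow, sq_abs, ← add_div, div_eq_div_iff (by positivity) hnn, hn]; ring
  refine ⟨B', C', x', y', ⟨div_pos hD hnp, rfl, ?_⟩, ?_, ?_, ?_⟩
  · rw [c1]; exact ⟨c2, c3, c4, c5⟩
  · apply div_nonneg _ hn0; linarith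
  · rw [hx', div_le_iff₀ hnp, hn]; linarith
  · rw [hxy, le_div_iff₀ hnp, hn]; linarith


/-! ## Counting lemmas and Weyl sums -/

lemma card_le_of_diam (s : Finset ℤ) (L : ℝ) (h0 : 0 ≤ L)
    (h : ∀ x ∈ s, ∀ y ∈ s, (x : ℝ) - y ≤ L) : (s.card : ℝ) ≤ L + 1 := by
  rcases s.eq_empty_or_nonempty with rfl | hs
  · simp; linarith
  · have h1 := h _ (s.max'_mem hs) _ (s.min'_mem hs)
    have h2 : s ⊆ Finset.Icc (s.min' hs) (s.max' hs) := fun x hx =>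
      Finset.mem_Icc.mpr ⟨s.min'_le x hx, s.le_max' x hx⟩
    have h3 := Finset.card_le_card h2
    rw [Int.card_Icc] at h3
    have h4 : s.min' hs ≤ s.max' hs := s.min'_le _ (s.max'_mem hs)
    have h5 : (s.card : ℤ) ≤ s.max' hs + 1 - s.min' hs := by omega
    have h6 : (s.card : ℝ) ≤ s.max' hs + 1 - s.min' hs := by exact_mod_cast h5
    linarith

lemma bad_count (A B η : ℝ) (hA : A ≠ 0) (hη : 0 < η) (N : ℕ) :
    (((Finset.range N).filter fun i : ℕ => |2 * A * i + B - round (2 * A * i + B)| < η).card : ℝ) ≤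
      (2 * |A| * N + 2) * (η / |A| + 1) := by
  set F := (Finset.range N).filter fun i : ℕ => |2 * A * i + B - round (2 * A * i + B)| < η with hF
  have hA' : 0 < |A| := abs_pos.mpr hA
  let φ : ℕ → ℤ := fun i => round (2 * A * i + B)
  have h1 : F.card = ∑ m ∈ F.image φ, (F.filter fun i => φ i = m).card :=
    Finset.card_eq_sum_card_image φ F
  have h2 : ∀ m ∈ F.image φ, ((F.filter fun i => φ i = m).card : ℝ) ≤ η / |A| + 1 := by
    intro m _
    have : (F.filter fun i => φ i = m).card = ((F.filter fun i => φ i = m).image (Nat.cast : ℕ → ℤ)).card :=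
      (Finset.card_image_of_injective _ Nat.cast_injective).symm
    rw [this]
    apply card_le_of_diam _ _ (by positivity)
    intro x hx y hy
    simp only [Finset.mem_image, Finset.mem_filter, hF] at hx hy
    obtain ⟨i, ⟨⟨-, hi⟩, hi'⟩, rfl⟩ := hx
    obtain ⟨j, ⟨⟨-, hj⟩, hj'⟩, rfl⟩ := hy
    simp only [φ] at hi' hj'
    rw [hi'] at hi; rw [hj'] at hj
    rw [le_div_iff₀ hA']
    push_cast
    have h3 : |2 * A * i - 2 * A * j| < 2 * η := by
      have := abs_sub (2 * A * i + B - m) (2 * A * j + B - m)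
      rw [show (2 * A * i + B - m) - (2 * A * j + B - m) = 2 * A * i - 2 * A * j by ring] at this
      linarith
    rw [show 2 * A * (i:ℝ) - 2 * A * j = 2 * (A * (i - j)) by ring, abs_mul, abs_mul, abs_two] at h3
    have h4 : ((i:ℝ) - j) * |A| ≤ |A| * |(i:ℝ) - j| := by
      rw [mul_comm]; exact mul_le_mul_of_nonneg_left (le_abs_self _) hA'.le
    linarith
  have h3 : ((F.image φ).card : ℝ) ≤ 2 * |A| * N + 2 := by
    have : (2 * |A| * N + 2 : ℝ) = (2 * |A| * N + 1) + 1 := by ring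
    rw [this]
    apply card_le_of_diam _ _ (by positivity)
    intro x hx y hy
    simp only [Finset.mem_image, Finset.mem_filter, hF, Finset.mem_range] at hx hy
    obtain ⟨i, ⟨hi, -⟩, rfl⟩ := hx
    obtain ⟨j, ⟨hj, -⟩, rfl⟩ := hy
    have e1 := abs_le.mp (abs_sub_round (2 * A * i + B))
    have e2 := abs_le.mp (abs_sub_round (2 * A * j + B))
    simp only [φ]
    have e3 : 2 * A * (i:ℝ) - 2 * A * j ≤ 2 * |A| * N := by
      have a1 : |(i:ℝ) - j| ≤ N := by
        have : (i:ℝ) ≤ N := by exact_mod_cast hi.le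
        have : (j:ℝ) ≤ N := by exact_mod_cast hj.le
        rw [abs_le]; constructor <;> linarith [Nat.cast_nonneg (α := ℝ) i, Nat.cast_nonneg (α := ℝ) j]
      calc 2 * A * (i:ℝ) - 2 * A * j = 2 * (A * (i - j)) := by ring
        _ ≤ 2 * (|A| * |(i:ℝ) - j|) := by rw [← abs_mul]; linarith [le_abs_self (A * ((i:ℝ) - j))]
        _ ≤ 2 * (|A| * N) := by gcongr
        _ = _ := by ring
    linarith
  rw [h1]; push_cast
  calc ∑ m ∈ F.image φ, ((F.filter fun i => φ i = m).card : ℝ) ≤ ∑ m ∈ F.image φ, (η / |A| + 1) :=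
        Finset.sum_le_sum h2
    _ = (F.image φ).card * (η / |A| + 1) := by rw [Finset.sum_const, nsmul_eq_mul]
    _ ≤ _ := by gcongr

/-- the additive character -/
noncomputable def ce (t : ℝ) : ℂ := Complex.exp (Complex.I * ((2 * Real.pi * t : ℝ) : ℂ))

lemma ce_norm (t : ℝ) : ‖ce t‖ = 1 := by
  rw [ce, mul_comm]; exact Complex.norm_exp_ofReal_mul_I _

lemma ce_add (s t : ℝ) : ce (s + t) = ce s * ce t := by
  rw [ce, ce, ce, ← Complex.exp_add]; congr 1; push_cast; ring

lemma ce_nat (h : ℕ) (t : ℝ) : ce (h * t) = ce t ^ h := by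
  rw [ce, ce, ← Complex.exp_nat_mul]; congr 1; push_cast; ring

lemma ce_sub_one_le (t : ℝ) : ‖ce t - 1‖ ≤ 2 * Real.pi * |t| := by
  have := Real.norm_exp_I_mul_ofReal_sub_one_le (x := 2 * Real.pi * t)
  rw [ce]
  refine this.trans ?_
  rw [Real.norm_eq_abs, abs_mul, abs_of_pos (by positivity : 0 < 2 * Real.pi)]

lemma ce_sub_one_ge (t : ℝ) : 4 * |t - round t| ≤ ‖ce t - 1‖ := by
  have h0 : ce t = ce (t - round t) := by
    rw [ce, ce, Complex.exp_eq_exp_iff_exists_int]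
    exact ⟨round t, by push_cast; ring⟩
  rw [h0]
  have hu := abs_sub_round t
  set u := t - round t
  rw [ce, Complex.norm_exp_I_mul_ofReal_sub_one, Real.norm_eq_abs, abs_mul, abs_two,
    show 2 * Real.pi * u / 2 = Real.pi * u by ring]
  have : 2 * |u| ≤ |Real.sin (Real.pi * u)| := by
    have h2 : |Real.sin (Real.pi * u)| = |Real.sin (Real.pi * |u|)| := by
      rcases abs_cases u with ⟨h, _⟩ | ⟨h, _⟩ <;> rw [h]
      rw [mul_neg, Real.sin_neg, abs_neg]
    rw [h2]
    have h3 := Real.mul_le_sin (x := Real.pi * |u|) (by positivity) (by nlinarith [Real.pi_pos])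
    refine le_trans ?_ (le_trans h3 (le_abs_self _))
    rw [show 2 / Real.pi * (Real.pi * |u|) = 2 * |u| by field_simp]
  linarith

lemma weyl_block (A B G η : ℝ) (hA : A ≠ 0) (hη : 0 < η) (N H : ℕ) (hH : 0 < H) :
    H * ‖∑ i ∈ Finset.range N, ce (A * i ^ 2 + B * i + G)‖ ≤
      2 * H ^ 2 + N * (2 * Real.pi * |A| * H ^ 3) + N * (1 / (2 * η)) +
        H * ((2 * |A| * N + 2) * (η / |A| + 1)) := by
  set z : ℕ → ℂ := fun i => ce (A * i ^ 2 + B * i + G) with hz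
  set w : ℕ → ℂ := fun i => ce (2 * A * i + B) with hw
  have hz1 : ∀ i, ‖z i‖ = 1 := fun i => ce_norm _
  have hshift : ∀ h : ℕ, ‖∑ i ∈ Finset.range N, z i - ∑ i ∈ Finset.range N, z (i + h)‖ ≤ 2 * h := by
    intro h
    have e1 : ∑ i ∈ Finset.range N, z i - ∑ i ∈ Finset.range N, z (i + h) =
        ∑ i ∈ Finset.range h, z i - ∑ i ∈ Finset.range h, z (N + i) := by
      have a1 := Finset.sum_range_add z N h
      have a2 := Finset.sum_range_add z h N
      rw [add_comm h N] at a2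
      simp only [add_comm h] at a2
      have := a1.symm.trans a2
      linear_combination this
    rw [e1]
    refine (norm_sub_le _ _).trans ?_
    have b1 : ‖∑ i ∈ Finset.range h, z i‖ ≤ h := by
      refine (norm_sum_le _ _).trans ?_; simp [hz1]
    have b2 : ‖∑ i ∈ Finset.range h, z (N + i)‖ ≤ h := by
      refine (norm_sum_le _ _).trans ?_; simp [hz1]
    linarith
  have hmain : ∀ i, ‖∑ h ∈ Finset.range H, z (i + h)‖ ≤
      2 * Real.pi * |A| * H ^ 3 + ‖∑ h ∈ Finset.range H, w i ^ h‖ := by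
    intro i
    have e1 : ∀ h : ℕ, z (i + h) = z i * (w i ^ h * (ce (A * h ^ 2) - 1)) + z i * w i ^ h := by
      intro h
      have : z (i + h) = z i * (w i ^ h * ce (A * h ^ 2)) := by
        simp only [hz, hw]
        rw [← ce_nat, ← ce_add, ← ce_add]; congr 1; push_cast; ring
      rw [this]; ring
    have e2 : ∑ h ∈ Finset.range H, z (i + h) =
        ∑ h ∈ Finset.range H, z i * (w i ^ h * (ce (A * h ^ 2) - 1)) + z i * ∑ h ∈ Finset.range H, w i ^ h := by
      rw [Finset.mul_sum, ← Finset.sum_add_distrib]; exact Finset.sum_congr rfl fun h _ => e1 h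
    rw [e2]
    refine (norm_add_le _ _).trans ?_
    rw [norm_mul, hz1, one_mul]
    gcongr
    refine (norm_sum_le _ _).trans ?_
    have : ∀ h ∈ Finset.range H, ‖z i * (w i ^ h * (ce (A * h ^ 2) - 1))‖ ≤ 2 * Real.pi * |A| * H ^ 2 := by
      intro h hh
      rw [norm_mul, norm_mul, norm_pow, hz1, ce_norm, one_pow, one_mul, one_mul]
      refine (ce_sub_one_le _).trans ?_
      rw [abs_mul, abs_of_nonneg (by positivity : (0:ℝ) ≤ (h:ℝ) ^ 2), ← mul_assoc]
      have : (h:ℝ) ≤ H := by exact_mod_cast (Finset.mem_range.mp hh).le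
      gcongr
    refine (Finset.sum_le_sum this).trans ?_
    rw [Finset.sum_const, Finset.card_range, nsmul_eq_mul]
    apply le_of_eq; ring
  set F := (Finset.range N).filter fun i : ℕ => |2 * A * i + B - round (2 * A * i + B)| < η with hF
  have hgeo : ∑ i ∈ Finset.range N, ‖∑ h ∈ Finset.range H, w i ^ h‖ ≤ N * (1 / (2 * η)) + H * F.card := by
    have hp : ∀ i ∈ Finset.range N, ‖∑ h ∈ Finset.range H, w i ^ h‖ ≤
        1 / (2 * η) + (if |2 * A * i + B - round (2 * A * i + B)| < η then (H : ℝ) else 0) := by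
      intro i _
      split_ifs with hi
      · have : ‖∑ h ∈ Finset.range H, w i ^ h‖ ≤ H := by
          refine (norm_sum_le _ _).trans ?_
          simp [hw, ce_norm]
        have : 0 ≤ 1 / (2 * η) := by positivity
        linarith
      · have h1 := ce_sub_one_ge (2 * A * i + B)
        have h2 : 4 * η ≤ ‖w i - 1‖ := by simp only [hw]; linarith
        have h3 : w i ≠ 1 := by
          intro h; rw [h] at h2; simp at h2; linarith
        rw [geom_sum_eq h3, norm_div, add_zero, div_le_div_iff₀ (by linarith) (by positivity)]
        have h4 : ‖w i ^ H - 1‖ ≤ 2 := by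
          refine (norm_sub_le _ _).trans ?_
          simp only [hw, norm_pow, ce_norm]; norm_num
        nlinarith
    refine (Finset.sum_le_sum hp).trans ?_
    rw [Finset.sum_add_distrib, Finset.sum_const, Finset.card_range, nsmul_eq_mul, ← Finset.sum_filter,
      Finset.sum_const, nsmul_eq_mul, mul_comm (F.card : ℝ)]
  have hbad := bad_count A B η hA hη N
  have hHS : (H : ℂ) * ∑ i ∈ Finset.range N, z i =
      ∑ h ∈ Finset.range H, (∑ i ∈ Finset.range N, z i - ∑ i ∈ Finset.range N, z (i + h)) +
        ∑ i ∈ Finset.range N, ∑ h ∈ Finset.range H, z (i + h) := by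
    rw [Finset.sum_sub_distrib, Finset.sum_comm (s := Finset.range N)]
    simp
  have : (H : ℝ) * ‖∑ i ∈ Finset.range N, z i‖ = ‖(H : ℂ) * ∑ i ∈ Finset.range N, z i‖ := by
    rw [norm_mul, Complex.norm_natCast]
  rw [this, hHS]
  have p1 : ‖∑ h ∈ Finset.range H, (∑ i ∈ Finset.range N, z i - ∑ i ∈ Finset.range N, z (i + h))‖ ≤ 2 * H ^ 2 := by
    refine (norm_sum_le _ _).trans ?_
    have : ∀ h ∈ Finset.range H, ‖∑ i ∈ Finset.range N, z i - ∑ i ∈ Finset.range N, z (i + h)‖ ≤ 2 * (H:ℝ) := by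
      intro h hh
      have : (h:ℝ) ≤ H := by exact_mod_cast (Finset.mem_range.mp hh).le
      linarith [hshift h]
    refine (Finset.sum_le_sum this).trans ?_
    rw [Finset.sum_const, Finset.card_range, nsmul_eq_mul]
    apply le_of_eq; ring
  have p2 : ‖∑ i ∈ Finset.range N, ∑ h ∈ Finset.range H, z (i + h)‖ ≤
      N * (2 * Real.pi * |A| * H ^ 3) + (N * (1 / (2 * η)) + H * F.card) := by
    refine (norm_sum_le _ _).trans ((Finset.sum_le_sum fun i _ => hmain i).trans ?_)
    rw [Finset.sum_add_distrib, Finset.sum_const, Finset.card_range, nsmul_eq_mul]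
    gcongr
  refine (norm_add_le _ _).trans ?_
  have p3 : (H:ℝ) * F.card ≤ H * ((2 * |A| * N + 2) * (η / |A| + 1)) := by gcongr
  linarith

lemma weyl_sum (c1 c2 K ε : ℝ) (hc1 : 0 < c1) (hc2 : 0 < c2) (hK : 0 < K) (hε : 0 < ε) :
    ∃ T0 : ℝ, ∀ T ≥ T0, ∀ A B G : ℝ, c1 / T ≤ |A| → |A| ≤ c2 / T → ∀ N : ℕ, (N : ℝ) ≤ K * T →
      ‖∑ i ∈ Finset.range N, ce (A * i ^ 2 + B * i + G)‖ ≤ ε * T := by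
  set M := 2 * c2 * K + 2 with hM
  have hMp : 0 < M := by positivity
  set η := ε * c1 / (4 * M) with hη
  have hηp : 0 < η := by positivity
  obtain ⟨H, hH⟩ := exists_nat_gt (K / (2 * η) * 4 / ε + 1)
  have hHp : 0 < H := by
    have : (0:ℝ) < H := lt_trans (by positivity) hH
    exact_mod_cast this
  have hH1 : (0:ℝ) < H := by exact_mod_cast hHp
  set W := 2 * H + K * 2 * Real.pi * c2 * H ^ 2 + M with hW
  refine ⟨max 1 (2 * W / ε), fun T hT A B G h1 h2 N hN => ?_⟩
  have hT1 : 1 ≤ T := le_trans (le_max_left _ _) hT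
  have hT0 : 0 < T := by linarith
  have hTW : 2 * W / ε ≤ T := le_trans (le_max_right _ _) hT
  rw [div_le_iff₀ hε] at hTW
  have hAp : 0 < |A| := lt_of_lt_of_le (by positivity) h1
  have hA : A ≠ 0 := abs_pos.mp hAp
  have hb := weyl_block A B G η hA hηp N H hHp
  rw [le_div_iff₀ hT0] at h2
  rw [div_le_iff₀ hT0] at h1
  have hNA : |A| * N ≤ c2 * K := by
    calc |A| * N ≤ |A| * (K * T) := by gcongr
      _ = (|A| * T) * K := by ring
      _ ≤ c2 * K := by gcongr
  have t1 : N * (2 * Real.pi * |A| * H ^ 3) ≤ (c2 * K) * (2 * Real.pi * H ^ 3) := by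
    calc N * (2 * Real.pi * |A| * H ^ 3) = (|A| * N) * (2 * Real.pi * H ^ 3) := by ring
      _ ≤ _ := by gcongr
  have t2 : N * (1 / (2 * η)) ≤ H * (ε / 4 * T) := by
    have : K / (2 * η) * 4 / ε ≤ H := by linarith
    rw [div_le_iff₀ hε] at this
    calc N * (1 / (2 * η)) ≤ K * T * (1 / (2 * η)) := by gcongr
      _ = (K / (2 * η) * 4) * (T / 4) := by ring
      _ ≤ (H * ε) * (T / 4) := by gcongr
      _ = _ := by ring
  have t3 : (2 * |A| * N + 2) * (η / |A| + 1) ≤ M * (ε / (4 * M) * T + 1) := by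
    have : η / |A| ≤ ε / (4 * M) * T := by
      rw [div_le_iff₀ hAp, hη]
      calc ε * c1 / (4 * M) = ε / (4 * M) * c1 := by ring
        _ ≤ ε / (4 * M) * (|A| * T) := by gcongr
        _ = _ := by ring
    have h4 : 2 * |A| * N + 2 ≤ M := by rw [hM]; nlinarith
    have : 0 ≤ η / |A| := by positivity
    gcongr
  have t3' : M * (ε / (4 * M) * T + 1) = ε / 4 * T + M := by field_simp
  rw [t3'] at t3
  have t4 : H * ((2 * |A| * N + 2) * (η / |A| + 1)) ≤ H * (ε / 4 * T + M) := by gcongr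
  have : H * ‖∑ i ∈ Finset.range N, ce (A * i ^ 2 + B * i + G)‖ ≤ H * (W + ε / 4 * T + ε / 4 * T) := by
    refine hb.trans ?_
    have : H * (W + ε / 4 * T + ε / 4 * T) = 2 * H ^ 2 + (c2 * K) * (2 * Real.pi * H ^ 3) +
      H * (ε / 4 * T) + H * (ε / 4 * T + M) := by rw [hW]; ring
    rw [this]
    linarith
  have := le_of_mul_le_mul_left this hH1
  linarith


/-! ## Equidistribution -/

open MeasureTheory in
/-- mean over the circle -/
noncomputable def cmean (g : C(AddCircle (1:ℝ), ℂ)) : ℂ := ∫ t, g t ∂AddCircle.haarAddCircle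

def Equi (g : C(AddCircle (1:ℝ), ℂ)) : Prop := ∀ c1 c2 K ε : ℝ, 0 < c1 → 0 < c2 → 0 < K → 0 < ε →
    ∃ T0 : ℝ, ∀ T ≥ T0, ∀ A B G : ℝ, c1 / T ≤ |A| → |A| ≤ c2 / T → ∀ N : ℕ, (N : ℝ) ≤ K * T →
      ‖∑ i ∈ Finset.range N, g ((A * i ^ 2 + B * i + G : ℝ) : AddCircle (1:ℝ)) - N * cmean g‖ ≤ ε * T

open MeasureTheory in
lemma cmean_int (g : C(AddCircle (1:ℝ), ℂ)) : Integrable g AddCircle.haarAddCircle :=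
  g.continuous.integrable_of_hasCompactSupport (HasCompactSupport.of_compactSpace _)

lemma cmean_fourier (n : ℤ) : cmean (fourier n) = if n = 0 then 1 else 0 := by
  have h := congrFun (fourierCoeff_fourier (T := 1) n) 0
  rw [fourierCoeff] at h
  simp only [neg_zero, fourier_zero, one_smul] at h
  rw [cmean, h, Pi.single_apply]
  simp [eq_comm]

lemma equi_fourier (n : ℤ) : Equi (fourier n) := by
  intro c1 c2 K ε h1 h2 hK hε
  rcases eq_or_ne n 0 with rfl | hn
  · refine ⟨0, fun T hT A B G _ _ N _ => ?_⟩
    rw [cmean_fourier]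
    simp
    positivity
  · have hn' : 0 < |(n:ℝ)| := abs_pos.mpr (by exact_mod_cast hn)
    obtain ⟨T0, hT0⟩ := weyl_sum (|(n:ℝ)| * c1) (|(n:ℝ)| * c2) K ε (by positivity) (by positivity) hK hε
    refine ⟨T0, fun T hT A B G hA1 hA2 N hN => ?_⟩
    have := hT0 T hT (n * A) (n * B) (n * G) (by rw [abs_mul, mul_div_assoc]; gcongr)
      (by rw [abs_mul, mul_div_assoc]; gcongr) N hN
    rw [cmean_fourier, if_neg hn, mul_zero, sub_zero]
    convert this using 3 with i
    rw [fourier_coe_apply, ce]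
    push_cast
    congr 1; ring

lemma cmean_add (f g : C(AddCircle (1:ℝ), ℂ)) : cmean (f + g) = cmean f + cmean g :=
  MeasureTheory.integral_add (cmean_int f) (cmean_int g)

lemma cmean_sub (f g : C(AddCircle (1:ℝ), ℂ)) : cmean (f - g) = cmean f - cmean g :=
  MeasureTheory.integral_sub (cmean_int f) (cmean_int g)

lemma cmean_smul (a : ℂ) (g : C(AddCircle (1:ℝ), ℂ)) : cmean (a • g) = a * cmean g :=
  MeasureTheory.integral_const_mul a _

lemma cmean_norm (g : C(AddCircle (1:ℝ), ℂ)) : ‖cmean g‖ ≤ ‖g‖ := by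
  have := MeasureTheory.norm_integral_le_of_norm_le_const (μ := AddCircle.haarAddCircle (T := 1)) (f := g) (C := ‖g‖)
    (Filter.Eventually.of_forall fun x => g.norm_coe_le_norm x)
  simpa [cmean] using this

lemma equi_all (g : C(AddCircle (1:ℝ), ℂ)) : Equi g := by
  have hspan : ∀ f ∈ Submodule.span ℂ (Set.range (@fourier 1)), Equi f := by
    intro f hf
    induction hf using Submodule.span_induction with
    | mem x hx => obtain ⟨n, rfl⟩ := hx; exact equi_fourier n
    | zero =>
      intro c1 c2 K ε h1 h2 hK hε
      refine ⟨0, fun T hT A B G _ _ N _ => ?_⟩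
      have : cmean 0 = 0 := by simp [cmean]
      simp [this]; positivity
    | add x y _ _ hx hy =>
      intro c1 c2 K ε h1 h2 hK hε
      obtain ⟨T1, hT1⟩ := hx c1 c2 K (ε/2) h1 h2 hK (by positivity)
      obtain ⟨T2, hT2⟩ := hy c1 c2 K (ε/2) h1 h2 hK (by positivity)
      refine ⟨max T1 T2, fun T hT A B G hA1 hA2 N hN => ?_⟩
      have e1 := hT1 T (le_trans (le_max_left _ _) hT) A B G hA1 hA2 N hN
      have e2 := hT2 T (le_trans (le_max_right _ _) hT) A B G hA1 hA2 N hN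
      rw [cmean_add]
      simp only [ContinuousMap.add_apply, Finset.sum_add_distrib]
      have := norm_add_le_of_le e1 e2
      rw [show ε * T = ε / 2 * T + ε / 2 * T by ring]
      refine le_trans (le_of_eq ?_) this
      congr 1; ring
    | smul a x _ hx =>
      intro c1 c2 K ε h1 h2 hK hε
      obtain ⟨T1, hT1⟩ := hx c1 c2 K (ε/(‖a‖+1)) h1 h2 hK (by positivity)
      refine ⟨max 0 T1, fun T hT A B G hA1 hA2 N hN => ?_⟩
      have e1 := hT1 T (le_trans (le_max_right _ _) hT) A B G hA1 hA2 N hN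
      have hT0 : 0 ≤ T := le_trans (le_max_left _ _) hT
      rw [cmean_smul]
      simp only [ContinuousMap.smul_apply, smul_eq_mul, ← Finset.mul_sum]
      rw [mul_left_comm, ← mul_sub, norm_mul]
      calc _ ≤ ‖a‖ * (ε / (‖a‖ + 1) * T) := by gcongr
        _ ≤ (‖a‖ + 1) * (ε / (‖a‖ + 1) * T) := by gcongr; linarith
        _ = ε * T := by field_simp
  have hg : g ∈ (Submodule.span ℂ (Set.range (@fourier 1))).topologicalClosure := by
    rw [span_fourier_closure_eq_top]; trivial
  rw [← SetLike.mem_coe, Submodule.topologicalClosure_coe, Metric.mem_closure_iff] at hg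
  intro c1 c2 K ε h1 h2 hK hε
  obtain ⟨f, hf, hfg⟩ := hg (ε / (4 * K)) (by positivity)
  obtain ⟨T1, hT1⟩ := hspan f hf c1 c2 K (ε/2) h1 h2 hK (by positivity)
  refine ⟨max 0 T1, fun T hT A B G hA1 hA2 N hN => ?_⟩
  have e1 := hT1 T (le_trans (le_max_right _ _) hT) A B G hA1 hA2 N hN
  have hT0 : 0 ≤ T := le_trans (le_max_left _ _) hT
  rw [dist_eq_norm] at hfg
  have e2 : ‖∑ i ∈ Finset.range N, (g - f) ((A * i ^ 2 + B * i + G : ℝ) : AddCircle (1:ℝ))‖ ≤ N * (ε / (4 * K)) := by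
    refine (norm_sum_le _ _).trans ?_
    refine (Finset.sum_le_sum fun i _ => ((g - f).norm_coe_le_norm _).trans hfg.le).trans ?_
    simp
  have e3 : ‖(N:ℂ) * cmean (g - f)‖ ≤ N * (ε / (4 * K)) := by
    rw [norm_mul, Complex.norm_natCast]
    gcongr
    exact (cmean_norm _).trans hfg.le
  have e4 : N * (ε / (4 * K)) ≤ ε / 4 * T := by
    calc N * (ε / (4 * K)) ≤ K * T * (ε / (4 * K)) := by gcongr
      _ = _ := by field_simp
  have e5 : ∑ i ∈ Finset.range N, g ((A * i ^ 2 + B * i + G : ℝ) : AddCircle (1:ℝ)) - N * cmean g =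
     (∑ i ∈ Finset.range N, f ((A * i ^ 2 + B * i + G : ℝ) : AddCircle (1:ℝ)) - N * cmean f) +
     (∑ i ∈ Finset.range N, (g - f) ((A * i ^ 2 + B * i + G : ℝ) : AddCircle (1:ℝ)) - N * cmean (g - f)) := by
    rw [cmean_sub]; simp only [ContinuousMap.sub_apply, Finset.sum_sub_distrib]; ring
  rw [e5]
  refine (norm_add_le_of_le e1 ((norm_sub_le_of_le e2 e3))).trans ?_
  linarith

/-- uniform equidistribution for a continuous function on `[0,1]` with equal endpoints -/
lemma equi_real (φ : ℝ → ℝ) (hφ : Continuous φ) (h01 : φ 0 = φ 1) (c1 c2 K ε : ℝ)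
    (h1 : 0 < c1) (h2 : 0 < c2) (hK : 0 < K) (hε : 0 < ε) :
    ∃ T0 : ℝ, ∀ T ≥ T0, ∀ A B G : ℝ, c1 / T ≤ |A| → |A| ≤ c2 / T → ∀ N : ℕ, (N : ℝ) ≤ K * T →
      |∑ i ∈ Finset.range N, φ (Int.fract (A * i ^ 2 + B * i + G)) - N * ∫ t in (0:ℝ)..1, φ t| ≤ ε * T := by
  have hcont : Continuous (AddCircle.liftIco (1:ℝ) 0 (fun t => (φ t : ℂ))) :=
    AddCircle.liftIco_zero_continuous (by rw [h01]) (by fun_prop)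
  let g : C(AddCircle (1:ℝ), ℂ) := ⟨_, hcont⟩
  have hgv : ∀ t : ℝ, g (t : AddCircle (1:ℝ)) = φ (Int.fract t) := by
    intro t
    have : (t : AddCircle (1:ℝ)) = ((Int.fract t : ℝ) : AddCircle (1:ℝ)) := by
      rw [← sub_eq_zero, ← AddCircle.coe_sub, AddCircle.coe_eq_zero_iff]
      exact ⟨⌊t⌋, by rw [Int.self_sub_fract]; simp⟩
    rw [this]
    exact AddCircle.liftIco_zero_coe_apply (f := fun t => (φ t : ℂ)) ⟨Int.fract_nonneg t, Int.fract_lt_one t⟩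
  have hm : cmean g = ((∫ t in (0:ℝ)..1, φ t : ℝ) : ℂ) := by
    have := fourierCoeff_liftIco_eq (T := 1) (a := 0) (fun t => (φ t : ℂ)) 0
    rw [fourierCoeffOn_eq_integral, fourierCoeff] at this
    simp only [neg_zero, fourier_zero, one_smul, zero_add, sub_zero, div_one,
      intervalIntegral.integral_ofReal] at this
    exact this
  obtain ⟨T0, hT0⟩ := equi_all g c1 c2 K ε h1 h2 hK hε
  refine ⟨T0, fun T hT A B G hA1 hA2 N hN => ?_⟩
  have := hT0 T hT A B G hA1 hA2 N hN
  simp only [hgv, hm] at this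
  rw [← Real.norm_eq_abs, ← Complex.norm_real]
  push_cast
  exact_mod_cast this

lemma equi_fract (c1 c2 K ε : ℝ) (h1 : 0 < c1) (h2 : 0 < c2) (hK : 0 < K) (hε : 0 < ε) :
    ∃ T0 : ℝ, ∀ T ≥ T0, ∀ A B G : ℝ, c1 / T ≤ |A| → |A| ≤ c2 / T → ∀ N : ℕ, (N : ℝ) ≤ K * T →
      |∑ i ∈ Finset.range N, Int.fract (A * i ^ 2 + B * i + G) - N / 2| ≤ ε * T := by
  obtain ⟨k, hk⟩ := exists_nat_gt (2 * K / ε)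
  have hk0 : 0 < k := by
    have : (0:ℝ) < k := lt_trans (by positivity) hk
    exact_mod_cast this
  rw [div_lt_iff₀ hε] at hk
  obtain ⟨T1, hT1⟩ := equi_real (fun t => t + (1 - t) ^ k) (by fun_prop) (by simp [hk0.ne'])
    c1 c2 K (ε / 2) h1 h2 hK (by positivity)
  obtain ⟨T2, hT2⟩ := equi_real (fun t => t - t ^ k) (by fun_prop) (by simp [hk0.ne'])
    c1 c2 K (ε / 2) h1 h2 hK (by positivity)
  have i1 : ∫ t in (0:ℝ)..1, (t + (1 - t) ^ k) = 1 / 2 + 1 / (k + 1) := by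
    rw [intervalIntegral.integral_add (Continuous.intervalIntegrable (by fun_prop) _ _) (Continuous.intervalIntegrable (by fun_prop) _ _)]
    rw [intervalIntegral.integral_comp_sub_left (fun t => t ^ k) 1]
    simp
  have i2 : ∫ t in (0:ℝ)..1, (t - t ^ k) = 1 / 2 - 1 / (k + 1) := by
    rw [intervalIntegral.integral_sub (Continuous.intervalIntegrable (by fun_prop) _ _) (Continuous.intervalIntegrable (by fun_prop) _ _)]
    simp
  refine ⟨max 0 (max T1 T2), fun T hT A B G hA1 hA2 N hN => ?_⟩
  have hT0 : 0 ≤ T := le_trans (le_max_left _ _) hT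
  have e1 := hT1 T (le_trans ((le_max_left _ _).trans (le_max_right _ _)) hT) A B G hA1 hA2 N hN
  have e2 := hT2 T (le_trans ((le_max_right _ _).trans (le_max_right _ _)) hT) A B G hA1 hA2 N hN
  rw [i1] at e1; rw [i2] at e2
  have hs : N * (1 / ((k:ℝ) + 1)) ≤ ε / 2 * T := by
    rw [mul_one_div, div_le_iff₀ (by positivity)]
    nlinarith
  have u1 : ∑ i ∈ Finset.range N, Int.fract (A * i ^ 2 + B * i + G) ≤
      ∑ i ∈ Finset.range N, (Int.fract (A * i ^ 2 + B * i + G) + (1 - Int.fract (A * i ^ 2 + B * i + G)) ^ k) := by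
    refine Finset.sum_le_sum fun i _ => ?_
    have : 0 ≤ (1 - Int.fract (A * i ^ 2 + B * i + G)) ^ k :=
      pow_nonneg (by linarith [Int.fract_lt_one (A * i ^ 2 + B * i + G)]) _
    linarith
  have u2 : ∑ i ∈ Finset.range N, (Int.fract (A * i ^ 2 + B * i + G) - (Int.fract (A * i ^ 2 + B * i + G)) ^ k) ≤
      ∑ i ∈ Finset.range N, Int.fract (A * i ^ 2 + B * i + G) := by
    refine Finset.sum_le_sum fun i _ => ?_
    have : 0 ≤ (Int.fract (A * i ^ 2 + B * i + G)) ^ k := pow_nonneg (Int.fract_nonneg _) _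
    linarith
  rw [abs_le] at e1 e2 ⊢
  constructor <;> nlinarith

/-- number of integers in an open interval -/
lemma card_int_Ioo (P L : ℝ) (hL : 0 < L) : ((Set.ncard {e : ℤ | |(e:ℝ) - P| < L} : ℕ) : ℝ) =
    2 * L - 1 + Int.fract (-(P + L)) + Int.fract (P - L) := by
  have h1 : {e : ℤ | |(e:ℝ) - P| < L} = ↑(Finset.Ioo ⌊P - L⌋ ⌈P + L⌉) := by
    ext e
    simp only [Set.mem_ofPred_eq, Finset.coe_Ioo, Set.mem_Ioo, Int.floor_lt, Int.lt_ceil, abs_lt]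
    constructor <;> rintro ⟨h1, h2⟩ <;> constructor <;> linarith
  rw [h1, Set.ncard_coe_finset, Int.card_Ioo]
  have h2 : ⌊P - L⌋ < ⌈P + L⌉ := by
    rw [Int.floor_lt]; linarith [Int.le_ceil (P + L)]
  have h3 : (((⌈P + L⌉ - ⌊P - L⌋ - 1).toNat : ℤ) : ℝ) = ((⌈P + L⌉ - ⌊P - L⌋ - 1 : ℤ) : ℝ) := by
    rw [Int.toNat_of_nonneg (by omega)]
  rw [Int.cast_natCast] at h3
  rw [h3]
  push_cast
  rw [Int.fract, Int.fract, Int.floor_neg]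
  push_cast; ring

/-- uniform count near a quadratic -/
lemma equi_count (c1 c2 K ε : ℝ) (h1 : 0 < c1) (h2 : 0 < c2) (hK : 0 < K) (hε : 0 < ε) :
    ∃ T0 : ℝ, ∀ T ≥ T0, ∀ A B G : ℝ, c1 / T ≤ |A| → |A| ≤ c2 / T → ∀ L, 0 < L →
    ∀ N : ℕ, (N : ℝ) ≤ K * T →
      |∑ i ∈ Finset.range N, ((Set.ncard {e : ℤ | |(e:ℝ) - (A * i ^ 2 + B * i + G)| < L} : ℕ) : ℝ) - 2 * L * N| ≤ ε * T := by
  obtain ⟨T0, hT0⟩ := equi_fract c1 c2 K (ε / 2) h1 h2 hK (by positivity)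
  refine ⟨T0, fun T hT A B G hA1 hA2 L hL N hN => ?_⟩
  have e1 := hT0 T hT (-A) (-B) (-(G + L)) (by rwa [abs_neg]) (by rwa [abs_neg]) N hN
  have e2 := hT0 T hT A B (G - L) hA1 hA2 N hN
  have e3 : ∑ i ∈ Finset.range N, ((Set.ncard {e : ℤ | |(e:ℝ) - (A * i ^ 2 + B * i + G)| < L} : ℕ) : ℝ)
     = ∑ i ∈ Finset.range N, (2 * L - 1 + Int.fract (-A * i ^ 2 + -B * i + -(G + L)) +
        Int.fract (A * i ^ 2 + B * i + (G - L))) := by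
    refine Finset.sum_congr rfl fun i _ => ?_
    rw [card_int_Ioo _ _ hL]
    congr 3
    · ring
    · ring
  rw [e3, Finset.sum_add_distrib, Finset.sum_add_distrib, Finset.sum_const, Finset.card_range, nsmul_eq_mul]
  rw [abs_le] at e1 e2 ⊢
  constructor <;> linarith


/-! ## Counting in boxes -/

/-- the scaled first four coefficients -/
noncomputable def BQF.q (T : ℝ) (f : BQF) : Fin 4 → ℝ := ![f.a / T, f.b / T, f.c / T, f.d / T]

/-- Lattice points over `S` with small `J` -/
def LS (C T : ℝ) (S : Set (Fin 4 → ℝ)) : Set BQF := {f | f.q T ∈ S ∧ |(f.J : ℝ)| < C * T ^ 2}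

/-- half-open cube -/
def cube (l : Fin 4 → ℝ) (δ : ℝ) : Set (Fin 4 → ℝ) := {m | ∀ i, l i ≤ m i ∧ m i < l i + δ}

lemma ncard_fiber (s : Finset (ℤ × ℤ × ℤ × ℤ)) (P : BQF → Prop)
    (hfin : ∀ m ∈ s, {e : ℤ | P ⟨m.1, m.2.1, m.2.2.1, m.2.2.2, e⟩}.Finite) :
    {f : BQF | (f.a, f.b, f.c, f.d) ∈ s ∧ P f}.Finite ∧
    {f : BQF | (f.a, f.b, f.c, f.d) ∈ s ∧ P f}.ncard =
      ∑ m ∈ s, {e : ℤ | P ⟨m.1, m.2.1, m.2.2.1, m.2.2.2, e⟩}.ncard := by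
  classical
  let E : (ℤ × ℤ × ℤ × ℤ) → Finset ℤ := fun m =>
    if h : m ∈ s then (hfin m h).toFinset else ∅
  let φ : (Σ _ : ℤ × ℤ × ℤ × ℤ, ℤ) → BQF := fun x => ⟨x.1.1, x.1.2.1, x.1.2.2.1, x.1.2.2.2, x.2⟩
  have hφ : Function.Injective φ := by
    rintro ⟨⟨a, b, c, d⟩, e⟩ ⟨⟨a', b', c', d'⟩, e'⟩ h
    simp only [φ, BQF.mk.injEq] at h
    obtain ⟨rfl, rfl, rfl, rfl, rfl⟩ := h
    rfl
  have hset : {f : BQF | (f.a, f.b, f.c, f.d) ∈ s ∧ P f} = φ '' ↑(s.sigma E) := by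
    ext f
    simp only [Set.mem_ofPred_eq, Set.mem_image, Finset.mem_coe, Finset.mem_sigma]
    constructor
    · rintro ⟨h1, h2⟩
      refine ⟨⟨(f.a, f.b, f.c, f.d), f.e⟩, ⟨h1, ?_⟩, rfl⟩
      simp only [E, h1, dif_pos, Set.Finite.mem_toFinset, Set.mem_ofPred_eq]; exact h2
    · rintro ⟨⟨m, e⟩, ⟨h1, h2⟩, rfl⟩
      simp only [E, h1, dif_pos, Set.Finite.mem_toFinset, Set.mem_ofPred_eq] at h2
      exact ⟨h1, h2⟩
  rw [hset]
  refine ⟨(Finset.finite_toSet _).image _, ?_⟩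
  rw [Set.ncard_image_of_injective _ hφ, Set.ncard_coe_finset, Finset.card_sigma]
  refine Finset.sum_congr rfl fun m hm => ?_
  simp only [E, hm, dif_pos]
  rw [Set.ncard_eq_toFinset_card _ (hfin m hm)]

lemma J_small_iff (C T a b c d e : ℝ) (hD : 0 < 8 * a * c - 3 * b ^ 2) :
    |72 * a * c * e + 9 * b * c * d - 27 * a * d ^ 2 - 27 * e * b ^ 2 - 2 * c ^ 3| < C * T ^ 2 ↔
    |e - (27 * a * d ^ 2 - 9 * b * c * d + 2 * c ^ 3) / (9 * (8 * a * c - 3 * b ^ 2))| <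
      C * T ^ 2 / (9 * (8 * a * c - 3 * b ^ 2)) := by
  set D := 8 * a * c - 3 * b ^ 2 with hDdef
  have e1 : 72 * a * c * e + 9 * b * c * d - 27 * a * d ^ 2 - 27 * e * b ^ 2 - 2 * c ^ 3 =
    (9 * D) * (e - (27 * a * d ^ 2 - 9 * b * c * d + 2 * c ^ 3) / (9 * D)) := by
    field_simp; rw [hDdef]; ring
  rw [e1, abs_mul, abs_of_pos (by positivity : 0 < 9 * D), lt_div_iff₀ (by positivity), mul_comm]

lemma sum_Ico_int (u v : ℤ) (g : ℤ → ℝ) :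
    ∑ d ∈ Finset.Ico u v, g d = ∑ i ∈ Finset.range (v - u).toNat, g (u + i) := by
  refine Finset.sum_nbij' (fun d => (d - u).toNat) (fun i => u + (i : ℤ)) ?_ ?_ ?_ ?_ ?_
  · intro d hd; rw [Finset.mem_Ico] at hd; rw [Finset.mem_range]; omega
  · intro i hi; rw [Finset.mem_range] at hi; rw [Finset.mem_Ico]; omega
  · intro d hd; rw [Finset.mem_Ico] at hd; omega
  · intro i hi; omega
  · intro d hd; rw [Finset.mem_Ico] at hd; congr 1; omega

/-- interval of integers in `[lT, (l+δ)T)` -/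
noncomputable def zI (T l δ : ℝ) : Finset ℤ := Finset.Ico ⌈l * T⌉ ⌈(l + δ) * T⌉

lemma mem_zI {T l δ : ℝ} (hT : 0 < T) (n : ℤ) : n ∈ zI T l δ ↔ l ≤ n / T ∧ n / T < l + δ := by
  rw [zI, Finset.mem_Ico, Int.ceil_le, Int.lt_ceil, le_div_iff₀ hT, div_lt_iff₀ hT]

lemma zI_card {T l δ : ℝ} (hT : 0 < T) (hδ : 0 < δ) :
    δ * T - 1 ≤ (zI T l δ).card ∧ ((zI T l δ).card : ℝ) ≤ δ * T + 1 := by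
  rw [zI, Int.card_Ico]
  have h1 := Int.ceil_lt_add_one (l * T)
  have h2 := Int.le_ceil (l * T)
  have h3 := Int.ceil_lt_add_one ((l + δ) * T)
  have h4 := Int.le_ceil ((l + δ) * T)
  have h5 : ⌈l * T⌉ ≤ ⌈(l + δ) * T⌉ := Int.ceil_le_ceil (by nlinarith)
  have h6 : (((⌈(l + δ) * T⌉ - ⌈l * T⌉).toNat : ℤ) : ℝ) = ((⌈(l + δ) * T⌉ - ⌈l * T⌉ : ℤ) : ℝ) := by
    rw [Int.toNat_of_nonneg (by omega)]
  rw [Int.cast_natCast] at h6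
  rw [h6]; push_cast
  constructor <;> linarith

lemma slice_count (C l0 l3 δ Dm DM η : ℝ) (hC : 0 < C) (hl0 : 0 < l0) (hδ : 0 < δ) (hDm : 0 < Dm)
    (hDM : Dm ≤ DM) (hη : 0 < η) :
    ∃ T0 : ℝ, 0 < T0 ∧ ∀ T ≥ T0, ∀ a b c : ℤ, l0 ≤ a / T → a / T < l0 + δ →
      Dm * T ^ 2 ≤ 8 * a * c - 3 * (b:ℝ) ^ 2 → 8 * a * c - 3 * (b:ℝ) ^ 2 ≤ DM * T ^ 2 →
      |∑ d ∈ zI T l3 δ, (({e : ℤ | |((⟨a, b, c, d, e⟩ : BQF).J : ℝ)| < C * T ^ 2}.ncard : ℕ) : ℝ) -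
        2 * (C * T ^ 2 / (9 * (8 * a * c - 3 * (b:ℝ) ^ 2))) * (zI T l3 δ).card| ≤ η * T := by
  have hDM0 : 0 < DM := by linarith
  obtain ⟨T0, hT0⟩ := equi_count (3 * l0 / DM) (3 * (l0 + δ) / Dm) (δ + 1) η (by positivity)
    (by positivity) (by positivity) hη
  refine ⟨max 1 T0, by positivity, fun T hT a b c ha1 ha2 hD1 hD2 => ?_⟩
  have hT1 : 1 ≤ T := le_trans (le_max_left _ _) hT
  have hTp : 0 < T := by linarith
  set D := 8 * a * c - 3 * (b:ℝ) ^ 2 with hD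
  have hDp : 0 < D := lt_of_lt_of_le (by positivity) hD1
  set u := ⌈l3 * T⌉ with hu
  have hap : (0:ℝ) < a := by
    rw [le_div_iff₀ hTp] at ha1; exact lt_of_lt_of_le (by positivity) ha1
  rw [le_div_iff₀ hTp] at ha1
  rw [div_lt_iff₀ hTp] at ha2
  have hq := hT0 T (le_trans (le_max_right _ _) hT) (3 * a / D) (6 * a * u / D - b * c / D)
    (3 * a * u ^ 2 / D - b * c * u / D + 2 * c ^ 3 / (9 * D))
    (by
      rw [abs_of_pos (by positivity), div_div, div_le_div_iff₀ (by positivity) hDp]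
      calc 3 * l0 * D ≤ 3 * l0 * (DM * T ^ 2) := by gcongr
        _ = 3 * (l0 * T) * (DM * T) := by ring
        _ ≤ 3 * a * (DM * T) := by gcongr)
    (by
      rw [abs_of_pos (by positivity), div_div, div_le_div_iff₀ hDp (by positivity)]
      calc 3 * a * (Dm * T) ≤ 3 * ((l0 + δ) * T) * (Dm * T) := by gcongr
        _ = 3 * (l0 + δ) * (Dm * T ^ 2) := by ring
        _ ≤ 3 * (l0 + δ) * D := by gcongr)
    (C * T ^ 2 / (9 * D)) (by positivity) (zI T l3 δ).card
    (by
      have := (zI_card (l := l3) hTp hδ).2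
      nlinarith)
  have e1 : ∑ d ∈ zI T l3 δ, (({e : ℤ | |((⟨a, b, c, d, e⟩ : BQF).J : ℝ)| < C * T ^ 2}.ncard : ℕ) : ℝ) =
    ∑ i ∈ Finset.range (zI T l3 δ).card, (({e : ℤ | |(e:ℝ) - (3 * a / D * (i:ℝ) ^ 2 +
      (6 * a * u / D - b * c / D) * i + (3 * a * u ^ 2 / D - b * c * u / D + 2 * c ^ 3 / (9 * D)))| <
        C * T ^ 2 / (9 * D)}.ncard : ℕ) : ℝ) := by
    rw [zI, sum_Ico_int, Int.card_Ico]
    refine Finset.sum_congr rfl fun i _ => ?_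
    congr 2
    ext e
    simp only [Set.mem_ofPred_eq, BQF.J]
    push_cast
    rw [J_small_iff C T _ _ _ _ _ hDp]
    rw [← hD]
    have : (27 * a * ((u:ℝ) + i) ^ 2 - 9 * b * c * ((u:ℝ) + i) + 2 * (c:ℝ) ^ 3) / (9 * D) =
      3 * a / D * (i:ℝ) ^ 2 +
      (6 * a * u / D - b * c / D) * i + (3 * a * u ^ 2 / D - b * c * u / D + 2 * c ^ 3 / (9 * D)) := by
      field_simp; ring
    rw [← this]
  rw [e1]
  exact hq

lemma fin_e (C T : ℝ) (a b c d : ℤ) (hD : (0:ℝ) < 8 * a * c - 3 * (b:ℝ) ^ 2) :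
    {e : ℤ | |((⟨a, b, c, d, e⟩ : BQF).J : ℝ)| < C * T ^ 2}.Finite := by
  set P := (27 * (a:ℝ) * d ^ 2 - 9 * b * c * d + 2 * c ^ 3) / (9 * (8 * a * c - 3 * (b:ℝ) ^ 2))
  set L := C * T ^ 2 / (9 * (8 * a * c - 3 * (b:ℝ) ^ 2))
  refine (Set.finite_Icc ⌊P - L⌋ ⌈P + L⌉).subset fun e he => ?_
  simp only [Set.mem_ofPred_eq, BQF.J] at he
  push_cast at he
  rw [J_small_iff C T _ _ _ _ _ hD, abs_lt] at he
  constructor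
  · have : (⌊P - L⌋:ℝ) ≤ e := (Int.floor_le _).trans (by linarith [he.1])
    exact_mod_cast this
  · have : (e:ℝ) ≤ ⌈P + L⌉ := le_trans (by linarith [he.2]) (Int.le_ceil _)
    exact_mod_cast this

set_option maxHeartbeats 1000000 in
lemma box_count (C : ℝ) (hC : 0 < C) (l : Fin 4 → ℝ) (δ Dm DM η : ℝ) (hδ : 0 < δ) (hl : 0 < l 0)
    (hDm : 0 < Dm) (hη : 0 < η)
    (hD : ∀ m ∈ cube l δ, Dm ≤ 8 * m 0 * m 2 - 3 * m 1 ^ 2 ∧ 8 * m 0 * m 2 - 3 * m 1 ^ 2 ≤ DM) :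
    ∀ᶠ T : ℝ in Filter.atTop, (LS C T (cube l δ)).Finite ∧
      (2 * C / (9 * DM) * δ ^ 4 - η) * T ^ 4 ≤ (LS C T (cube l δ)).ncard ∧
      ((LS C T (cube l δ)).ncard : ℝ) ≤ (2 * C / (9 * Dm) * δ ^ 4 + η) * T ^ 4 := by
  have hDM : Dm ≤ DM := by
    have := hD l (fun i => ⟨le_rfl, by linarith⟩); linarith [this.1, this.2]
  have hDM0 : 0 < DM := by linarith
  obtain ⟨T0, hT0p, hT0⟩ := slice_count C (l 0) (l 3) δ Dm DM (η / (2 * (δ + 1) ^ 3)) hC hl hδ hDm hDM (by positivity)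
  -- limits of card products
  have hlim : ∀ σ : ℝ, Tendsto (fun T : ℝ => (δ + σ * T⁻¹) ^ 4) atTop (nhds (δ ^ 4)) := by
    intro σ
    have h1 : Tendsto (fun T : ℝ => (δ + σ * T⁻¹) ^ 4) atTop (nhds ((δ + σ * 0) ^ 4)) :=
      (((tendsto_inv_atTop_zero.const_mul σ).const_add δ).pow 4)
    simpa using h1
  set k := 2 * C / (9 * Dm) with hk
  set k' := 2 * C / (9 * DM) with hk'
  have hkp : 0 < k := by positivity
  have hkp' : 0 < k' := by positivity
  have ev1 : ∀ᶠ T : ℝ in atTop, k * (δ + 1 * T⁻¹) ^ 4 < k * δ ^ 4 + η / 2 :=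
    ((hlim 1).const_mul k).eventually_lt_const (by linarith)
  have ev2 : ∀ᶠ T : ℝ in atTop, k' * δ ^ 4 - η / 2 < k' * (δ + (-1) * T⁻¹) ^ 4 :=
    ((hlim (-1)).const_mul k').eventually_const_lt (by linarith)
  filter_upwards [ev1, ev2, eventually_ge_atTop T0, eventually_ge_atTop 1, eventually_ge_atTop (1 / δ)] with T h1 h2 h3 hT1 hTδ
  have hT : 0 < T := by linarith
  have hδT : 1 ≤ δ * T := by rw [div_le_iff₀ hδ] at hTδ; linarith
  let s3 := zI T (l 0) δ ×ˢ zI T (l 1) δ ×ˢ zI T (l 2) δ ×ˢ zI T (l 3) δ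
  have hLS : LS C T (cube l δ) = {f : BQF | (f.a, f.b, f.c, f.d) ∈ s3 ∧ |(f.J : ℝ)| < C * T ^ 2} := by
    ext f
    simp only [LS, cube, BQF.q, Set.mem_ofPred_eq, s3, Finset.mem_product, mem_zI hT, Fin.forall_fin_succ]
    simp
  have hDs : ∀ a ∈ zI T (l 0) δ, ∀ b ∈ zI T (l 1) δ, ∀ c ∈ zI T (l 2) δ,
      Dm * T ^ 2 ≤ 8 * a * c - 3 * (b:ℝ) ^ 2 ∧ 8 * a * c - 3 * (b:ℝ) ^ 2 ≤ DM * T ^ 2 := by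
    intro a ha b hb c hc
    rw [mem_zI hT] at ha hb hc
    have := hD ![a / T, b / T, c / T, l 3] (by
      intro i; fin_cases i
      · exact ha
      · exact hb
      · exact hc
      · exact ⟨le_rfl, by simp; linarith⟩)
    simp only [Matrix.cons_val] at this
    have e : 8 * (a / T) * (c / T) - 3 * ((b:ℝ) / T) ^ 2 = (8 * a * c - 3 * (b:ℝ) ^ 2) / T ^ 2 := by
      field_simp
    rw [e, le_div_iff₀ (by positivity), div_le_iff₀ (by positivity)] at this
    exact this
  obtain ⟨hfin, hcard⟩ := ncard_fiber s3 (fun f => |(f.J : ℝ)| < C * T ^ 2) (by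
    rintro ⟨a, b, c, d⟩ hm
    simp only [s3, Finset.mem_product] at hm
    refine fin_e C T a b c d (lt_of_lt_of_le ?_ (hDs a hm.1 b hm.2.1 c hm.2.2.1).1)
    positivity)
  rw [hLS]
  refine ⟨hfin, ?_⟩
  rw [hcard]
  push_cast
  simp only [s3, Finset.sum_product]
  set n0 : ℝ := ((zI T (l 0) δ).card : ℝ)
  set n1 : ℝ := ((zI T (l 1) δ).card : ℝ)
  set n2 : ℝ := ((zI T (l 2) δ).card : ℝ)
  set n3 : ℝ := ((zI T (l 3) δ).card : ℝ)
  have b0 := zI_card (l := l 0) hT hδ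
  have b1 := zI_card (l := l 1) hT hδ
  have b2 := zI_card (l := l 2) hT hδ
  have b3 := zI_card (l := l 3) hT hδ
  change _ ≤ n0 ∧ n0 ≤ _ at b0
  change _ ≤ n1 ∧ n1 ≤ _ at b1
  change _ ≤ n2 ∧ n2 ≤ _ at b2
  change _ ≤ n3 ∧ n3 ≤ _ at b3
  have hin : ∀ a ∈ zI T (l 0) δ, ∀ b ∈ zI T (l 1) δ, ∀ c ∈ zI T (l 2) δ,
      k' * n3 - η / (2 * (δ + 1) ^ 3) * T ≤ ∑ d ∈ zI T (l 3) δ, (({e : ℤ | |((⟨a, b, c, d, e⟩ : BQF).J : ℝ)| < C * T ^ 2}.ncard : ℕ) : ℝ) ∧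
      ∑ d ∈ zI T (l 3) δ, (({e : ℤ | |((⟨a, b, c, d, e⟩ : BQF).J : ℝ)| < C * T ^ 2}.ncard : ℕ) : ℝ) ≤
        k * n3 + η / (2 * (δ + 1) ^ 3) * T := by
    intro a ha b hb c hc
    obtain ⟨d1, d2⟩ := hDs a ha b hb c hc
    have := hT0 T h3 a b c ((mem_zI hT a).mp ha).1 ((mem_zI hT a).mp ha).2 d1 d2
    rw [abs_le] at this
    have hDp : 0 < 8 * a * c - 3 * (b:ℝ) ^ 2 := lt_of_lt_of_le (by positivity) d1
    have g1 : 2 * (C * T ^ 2 / (9 * (8 * a * c - 3 * (b:ℝ) ^ 2))) ≤ k := by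
      rw [hk, ← mul_div_assoc, div_le_div_iff₀ (by positivity) (by positivity)]
      nlinarith
    have g2 : k' ≤ 2 * (C * T ^ 2 / (9 * (8 * a * c - 3 * (b:ℝ) ^ 2))) := by
      rw [hk', ← mul_div_assoc, div_le_div_iff₀ (by positivity) (by positivity)]
      nlinarith
    have n3n : 0 ≤ n3 := Nat.cast_nonneg _
    have g3 := mul_le_mul_of_nonneg_right g1 n3n
    have g4 := mul_le_mul_of_nonneg_right g2 n3n
    constructor <;> linarith [this.1, this.2]
  have hconst : ∀ v : ℝ, ∑ a ∈ zI T (l 0) δ, ∑ b ∈ zI T (l 1) δ, ∑ c ∈ zI T (l 2) δ, v = n0 * (n1 * (n2 * v)) := by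
    intro v; simp only [Finset.sum_const, nsmul_eq_mul, n0, n1, n2]
  have hTi : T⁻¹ * T = 1 := inv_mul_cancel₀ hT.ne'
  have hprod : n0 * (n1 * n2) ≤ ((δ + 1) * T) ^ 3 := by
    have m0 : n0 ≤ (δ + 1) * T := by linarith [b0.2]
    have m1 : n1 ≤ (δ + 1) * T := by linarith [b1.2]
    have m2 : n2 ≤ (δ + 1) * T := by linarith [b2.2]
    calc n0 * (n1 * n2) ≤ ((δ + 1) * T) * (((δ + 1) * T) * ((δ + 1) * T)) := by gcongr
      _ = _ := by ring
  have herr : n0 * (n1 * (n2 * (η / (2 * (δ + 1) ^ 3) * T))) ≤ η / 2 * T ^ 4 := by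
    calc n0 * (n1 * (n2 * (η / (2 * (δ + 1) ^ 3) * T))) = n0 * (n1 * n2) * (η / (2 * (δ + 1) ^ 3) * T) := by ring
      _ ≤ ((δ + 1) * T) ^ 3 * (η / (2 * (δ + 1) ^ 3) * T) := by gcongr
      _ = _ := by field_simp
  constructor
  · have this := Finset.sum_le_sum fun a ha => Finset.sum_le_sum fun b hb => Finset.sum_le_sum fun c hc => (hin a ha b hb c hc).1
    rw [hconst] at this
    refine le_trans ?_ this
    have hz : 0 ≤ δ * T - 1 := by linarith
    have hp : (δ * T - 1) * ((δ * T - 1) * ((δ * T - 1) * (δ * T - 1))) ≤ n0 * (n1 * (n2 * n3)) := by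
      have := b0.1; have := b1.1; have := b2.1; have := b3.1
      gcongr
    have e4 : (δ * T - 1) * ((δ * T - 1) * ((δ * T - 1) * (δ * T - 1))) = (δ + (-1) * T⁻¹) ^ 4 * T ^ 4 := by
      rw [← mul_pow]
      have : (δ + (-1) * T⁻¹) * T = δ * T - 1 := by linear_combination (-1) * hTi
      rw [this]; ring
    have q1 := mul_le_mul_of_nonneg_left hp hkp'.le
    rw [e4] at q1
    have q2 := mul_le_mul_of_nonneg_right h2.le (by positivity : (0:ℝ) ≤ T ^ 4)
    linarith
  · have this := Finset.sum_le_sum fun a ha => Finset.sum_le_sum fun b hb => Finset.sum_le_sum fun c hc => (hin a ha b hb c hc).2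
    rw [hconst] at this
    refine le_trans this ?_
    have hp : n0 * (n1 * (n2 * n3)) ≤ (δ * T + 1) * ((δ * T + 1) * ((δ * T + 1) * (δ * T + 1))) := by
      have := b0.2; have := b1.2; have := b2.2; have := b3.2
      gcongr
    have e4 : (δ * T + 1) * ((δ * T + 1) * ((δ * T + 1) * (δ * T + 1))) = (δ + 1 * T⁻¹) ^ 4 * T ^ 4 := by
      rw [← mul_pow]
      have : (δ + 1 * T⁻¹) * T = δ * T + 1 := by linear_combination hTi
      rw [this]; ring
    have q1 := mul_le_mul_of_nonneg_left hp hkp.le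
    rw [e4] at q1
    have q2 := mul_le_mul_of_nonneg_right h1.le (by positivity : (0:ℝ) ≤ T ^ 4)
    linarith


/-! ## Counting over compact sets -/

/-- the region where `a > 0` and `8ac - 3b² > 0` -/
def U4 : Set (Fin 4 → ℝ) := {m | 0 < m 0 ∧ 0 < 8 * m 0 * m 2 - 3 * m 1 ^ 2}

/-- density -/
noncomputable def rho (C : ℝ) (m : Fin 4 → ℝ) : ℝ := 2 * C / (9 * (8 * m 0 * m 2 - 3 * m 1 ^ 2))

lemma rho_cont (C : ℝ) : ContinuousOn (rho C) U4 := by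
  unfold rho
  refine ContinuousOn.div (by fun_prop) (by fun_prop) ?_
  intro m hm
  have := hm.2
  positivity

lemma isOpen_U4 : IsOpen U4 := by
  have h1 : Continuous fun m : Fin 4 → ℝ => m 0 := by fun_prop
  have h2 : Continuous fun m : Fin 4 → ℝ => 8 * m 0 * m 2 - 3 * m 1 ^ 2 := by fun_prop
  exact (isOpen_lt continuous_const h1).inter (isOpen_lt continuous_const h2)

lemma cube_eq (l : Fin 4 → ℝ) (δ : ℝ) : cube l δ = Set.univ.pi fun i => Set.Ico (l i) (l i + δ) := by
  ext m; simp [cube, Set.mem_pi]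

lemma cube_meas (l : Fin 4 → ℝ) (δ : ℝ) : MeasurableSet (cube l δ) := by
  rw [cube_eq]; exact MeasurableSet.univ_pi fun i => measurableSet_Ico

lemma cube_vol (l : Fin 4 → ℝ) {δ : ℝ} (hδ : 0 < δ) :
    MeasureTheory.volume.real (cube l δ) = δ ^ 4 := by
  rw [cube_eq, MeasureTheory.measureReal_def, Real.volume_pi_Ico_toReal]
  · simp
  · intro i; simp [hδ.le]

lemma cube_sub (l : Fin 4 → ℝ) (δ : ℝ) : cube l δ ⊆ Set.Icc l (fun i => l i + δ) := by
  intro m hm; exact ⟨fun i => (hm i).1, fun i => (hm i).2.le⟩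

lemma rho_int (C : ℝ) {l : Fin 4 → ℝ} {δ : ℝ} (hU : Set.Icc l (fun i => l i + δ) ⊆ U4) :
    MeasureTheory.IntegrableOn (rho C) (cube l δ) :=
  (((rho_cont C).mono hU).integrableOn_compact isCompact_Icc).mono_set (cube_sub l δ)

lemma cube_rho (C : ℝ) (hC : 0 < C) (l : Fin 4 → ℝ) (δ ξ : ℝ) (hδ : 0 < δ) (hξ : 0 < ξ)
    (hU : Set.Icc l (fun i => l i + δ) ⊆ U4)
    (hr : ∀ m ∈ Set.Icc l (fun i => l i + δ), ∀ m' ∈ Set.Icc l (fun i => l i + δ),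
      rho C m - rho C m' ≤ ξ) :
    ∀ᶠ T : ℝ in atTop, (LS C T (cube l δ)).Finite ∧
      |((LS C T (cube l δ)).ncard : ℝ) - (∫ m in cube l δ, rho C m) * T ^ 4| ≤
        2 * ξ * δ ^ 4 * T ^ 4 := by
  have hne : (Set.Icc l (fun i => l i + δ)).Nonempty :=
    ⟨l, le_refl _, fun i => by simp [hδ.le]⟩
  have hcD : Continuous fun m : Fin 4 → ℝ => 8 * m 0 * m 2 - 3 * m 1 ^ 2 := by fun_prop
  obtain ⟨m1, hm1, h1⟩ := isCompact_Icc.exists_isMinOn hne hcD.continuousOn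
  obtain ⟨m2, hm2, h2⟩ := isCompact_Icc.exists_isMaxOn hne hcD.continuousOn
  rw [isMinOn_iff] at h1
  rw [isMaxOn_iff] at h2
  have hl : 0 < l 0 := (hU ⟨le_refl _, fun i => by simp [hδ.le]⟩ : l ∈ U4).1
  have hp1 := (hU hm1).2
  have hp2 := (hU hm2).2
  have hmono : ∀ m ∈ cube l δ, rho C m2 ≤ rho C m ∧ rho C m ≤ rho C m1 := by
    intro m hm
    have hm' := cube_sub l δ hm
    have := h1 m hm'
    have := h2 m hm'
    have := (hU hm').2
    constructor
    · unfold rho; gcongr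
    · unfold rho; gcongr
  have hv := cube_vol l hδ
  have hfin : MeasureTheory.volume (cube l δ) ≠ ⊤ := by
    intro h; rw [MeasureTheory.measureReal_def, h] at hv; simp at hv; exact absurd hv.symm (by positivity)
  have hi := rho_int C hU
  have i1 := MeasureTheory.setIntegral_ge_of_const_le_real (cube_meas l δ) hfin
    (fun m hm => (hmono m hm).1) hi
  have i2 := MeasureTheory.setIntegral_ge_of_const_le_real (f := fun m => - rho C m) (c := - rho C m1)
    (cube_meas l δ) hfin (fun m hm => neg_le_neg (hmono m hm).2) hi.neg
  rw [MeasureTheory.integral_neg] at i2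
  rw [hv] at i1 i2
  have hd := hr m1 hm1 m2 hm2
  filter_upwards [box_count C hC l δ _ _ (ξ * δ ^ 4) hδ hl hp1 (by positivity)
    (fun m hm => ⟨h1 m (cube_sub l δ hm), h2 m (cube_sub l δ hm)⟩), eventually_gt_atTop 0]
    with T hT hT0
  obtain ⟨hF, ha, hb⟩ := hT
  refine ⟨hF, ?_⟩
  set i := ∫ m in cube l δ, rho C m
  have hT4 : 0 < T ^ 4 := by positivity
  have e1 : 2 * C / (9 * (8 * m1 0 * m1 2 - 3 * m1 1 ^ 2)) = rho C m1 := rfl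
  have e2 : 2 * C / (9 * (8 * m2 0 * m2 2 - 3 * m2 1 ^ 2)) = rho C m2 := rfl
  rw [e1] at hb; rw [e2] at ha
  have hd4 : (rho C m1 - rho C m2) * δ ^ 4 ≤ ξ * δ ^ 4 := by gcongr
  rw [abs_le]; constructor
  · have : (i - 2 * ξ * δ ^ 4) * T ^ 4 ≤ (rho C m2 * δ ^ 4 - ξ * δ ^ 4) * T ^ 4 := by
      refine mul_le_mul_of_nonneg_right ?_ hT4.le; linarith
    linarith
  · have : (rho C m1 * δ ^ 4 + ξ * δ ^ 4) * T ^ 4 ≤ (i + 2 * ξ * δ ^ 4) * T ^ 4 := by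
      refine mul_le_mul_of_nonneg_right ?_ hT4.le; linarith
    linarith

lemma LS_union (C T : ℝ) {ι : Type*} [DecidableEq ι] (F : Finset ι) (s : ι → Set (Fin 4 → ℝ))
    (hd : ∀ i j, i ≠ j → Disjoint (s i) (s j)) (hf : ∀ i ∈ F, (LS C T (s i)).Finite) :
    (LS C T (⋃ i ∈ F, s i)).Finite ∧
    (LS C T (⋃ i ∈ F, s i)).ncard = ∑ i ∈ F, (LS C T (s i)).ncard := by
  induction F using Finset.induction_on with
  | empty => simp [LS]
  | insert i F hi ih =>
    obtain ⟨h1, h2⟩ := ih fun j hj => hf j (Finset.mem_insert_of_mem hj)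
    have h3 := hf i (Finset.mem_insert_self i F)
    have he : LS C T (⋃ j ∈ insert i F, s j) = LS C T (s i) ∪ LS C T (⋃ j ∈ F, s j) := by
      rw [Finset.set_biUnion_insert]
      ext f; simp only [LS, Set.mem_ofPred_eq, Set.mem_union]; tauto
    rw [he, Finset.sum_insert hi, Set.ncard_union_eq _ h3 h1, h2]
    · exact ⟨h3.union h1, rfl⟩
    · rw [Set.disjoint_left]
      intro f hf1 hf2
      have h4 := hf2.1
      simp only [Set.mem_iUnion] at h4
      obtain ⟨j, hj, hm⟩ := h4
      exact Set.disjoint_left.1 (hd i j (by rintro rfl; exact hi hj)) hf1.1 hm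

lemma count_compact (C : ℝ) (hC : 0 < C) (K W : Set (Fin 4 → ℝ)) (hK : IsCompact K) (hW : IsOpen W)
    (hKW : K ⊆ W) (hWU : W ⊆ U4) (η : ℝ) (hη : 0 < η) :
    ∃ Q : Set (Fin 4 → ℝ), ∃ K1, MeasurableSet Q ∧ K ⊆ Q ∧ Q ⊆ K1 ∧ IsCompact K1 ∧ K1 ⊆ W ∧
      ∀ᶠ T : ℝ in atTop, (LS C T Q).Finite ∧
      |((LS C T Q).ncard : ℝ) - (∫ m in Q, rho C m) * T ^ 4| ≤ η * T ^ 4 := by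
  classical
  obtain ⟨r, hr0, hr⟩ := hK.exists_cthickening_subset_open hW hKW
  set K1 := Metric.cthickening r K with hK1
  have hK1c : IsCompact K1 := hK.cthickening
  set V := MeasureTheory.volume.real K1 with hV
  have hV0 : 0 ≤ V := MeasureTheory.measureReal_nonneg
  set ξ := η / (2 * (V + 1)) with hξ
  have hξ0 : 0 < ξ := by positivity
  have huc := hK1c.uniformContinuousOn_of_continuous ((rho_cont C).mono (hr.trans hWU))
  rw [Metric.uniformContinuousOn_iff] at huc
  obtain ⟨δ0, hδ00, hδ0⟩ := huc ξ hξ0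
  set δ := min (δ0 / 2) r with hδ
  have hδp : 0 < δ := by positivity
  have hδ1 : δ ≤ δ0 / 2 := min_le_left _ _
  have hδ2 : δ ≤ r := min_le_right _ _
  let φ : (Fin 4 → ℝ) → (Fin 4 → ℤ) := fun m i => ⌊m i / δ⌋
  let L : (Fin 4 → ℤ) → (Fin 4 → ℝ) := fun k i => k i * δ
  have hmem : ∀ m k, m ∈ cube (L k) δ ↔ φ m = k := by
    intro m k
    rw [funext_iff]
    refine forall_congr' fun i => ?_
    simp only [φ, L]
    rw [Int.floor_eq_iff, le_div_iff₀ hδp, div_lt_iff₀ hδp, add_mul, one_mul]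
  have hFfin : (φ '' K).Finite := by
    obtain ⟨R, hR⟩ := hK.isBounded.subset_closedBall 0
    refine Set.Finite.subset (Set.finite_Icc (fun _ => ⌊-R / δ⌋) (fun _ => ⌊R / δ⌋)) ?_
    rintro _ ⟨m, hm, rfl⟩
    have h1 := hR hm
    rw [mem_closedBall_zero_iff] at h1
    have h2 : ∀ i, |m i| ≤ R := fun i => (norm_le_pi_norm m i).trans h1
    refine ⟨fun i => Int.floor_le_floor ?_, fun i => Int.floor_le_floor ?_⟩
    · gcongr; exact (abs_le.1 (h2 i)).1
    · gcongr; exact (abs_le.1 (h2 i)).2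
  set F := hFfin.toFinset with hF
  have hIcc : ∀ k ∈ F, Set.Icc (L k) (fun i => L k i + δ) ⊆ K1 := by
    intro k hk x hx
    rw [hF, Set.Finite.mem_toFinset] at hk
    obtain ⟨m, hm, hmk⟩ := hk
    have hmc := cube_sub _ _ ((hmem m k).2 hmk)
    refine Metric.mem_cthickening_of_dist_le x m r K hm ?_
    refine le_trans ?_ hδ2
    rw [dist_pi_le_iff hδp.le]
    intro i
    rw [Real.dist_eq, abs_le]
    have a1 := hx.1 i; have a2 := hx.2 i; have a3 := hmc.1 i; have a4 := hmc.2 i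
    simp only at a2 a4
    constructor <;> linarith
  have hdisj : ∀ i j, i ≠ j → Disjoint (cube (L i) δ) (cube (L j) δ) := by
    intro i j hij
    rw [Set.disjoint_left]
    intro m h1 h2
    exact hij (((hmem m i).1 h1).symm.trans ((hmem m j).1 h2))
  have hQ1 : (⋃ k ∈ F, cube (L k) δ) ⊆ K1 :=
    Set.iUnion₂_subset fun k hk => (cube_sub _ _).trans (hIcc k hk)
  have hQm : ∀ k ∈ F, MeasurableSet (cube (L k) δ) := fun k _ => cube_meas _ _
  refine ⟨⋃ k ∈ F, cube (L k) δ, K1, F.measurableSet_biUnion hQm, ?_, hQ1, hK1c, hr, ?_⟩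
  · intro m hm
    simp only [Set.mem_iUnion]
    exact ⟨φ m, by rw [hF, Set.Finite.mem_toFinset]; exact ⟨m, hm, rfl⟩, (hmem m _).2 rfl⟩
  have hall : ∀ k ∈ F, ∀ᶠ T : ℝ in atTop, (LS C T (cube (L k) δ)).Finite ∧
      |((LS C T (cube (L k) δ)).ncard : ℝ) - (∫ m in cube (L k) δ, rho C m) * T ^ 4| ≤
        2 * ξ * δ ^ 4 * T ^ 4 := by
    intro k hk
    refine cube_rho C hC (L k) δ ξ hδp hξ0 ((hIcc k hk).trans (hr.trans hWU)) ?_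
    intro m hm m' hm'
    have hd : dist m m' < δ0 := by
      refine lt_of_le_of_lt (b := δ) ?_ (by linarith)
      rw [dist_pi_le_iff hδp.le]
      intro i
      rw [Real.dist_eq, abs_le]
      have a1 := hm.1 i; have a2 := hm.2 i; have a3 := hm'.1 i; have a4 := hm'.2 i
      simp only at a2 a4
      constructor <;> linarith
    have := hδ0 m (hIcc k hk hm) m' (hIcc k hk hm') hd
    rw [Real.dist_eq] at this
    exact (le_abs_self _).trans this.le
  have hvol : (F.card : ℝ) * δ ^ 4 ≤ V := by
    have h1 : MeasureTheory.volume.real (⋃ k ∈ F, cube (L k) δ) = ∑ k ∈ F, δ ^ 4 := by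
      rw [MeasureTheory.measureReal_biUnion_finset (fun i _ j _ hij => hdisj i j hij) hQm
        (fun k hk => (((hK1c.measure_lt_top).trans_le' (MeasureTheory.measure_mono
          ((cube_sub _ _).trans (hIcc k hk))))).ne)]
      exact Finset.sum_congr rfl fun k _ => cube_vol _ hδp
    rw [Finset.sum_const, nsmul_eq_mul] at h1
    rw [← h1]
    exact MeasureTheory.measureReal_mono hQ1 hK1c.measure_lt_top.ne
  have hint := MeasureTheory.integral_biUnion_finset (f := rho C) (μ := MeasureTheory.volume) F hQm
    (fun i _ j _ hij => hdisj i j hij) (fun k hk => rho_int C ((hIcc k hk).trans (hr.trans hWU)))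
  filter_upwards [(eventually_all_finset F).2 hall, eventually_gt_atTop 0] with T hT hT0
  obtain ⟨u1, u2⟩ := LS_union C T F (fun k => cube (L k) δ) hdisj (fun k hk => (hT k hk).1)
  refine ⟨u1, ?_⟩
  rw [u2, hint, Finset.sum_mul, Nat.cast_sum, ← Finset.sum_sub_distrib]
  refine (Finset.abs_sum_le_sum_abs _ _).trans ((Finset.sum_le_sum fun k hk => (hT k hk).2).trans ?_)
  rw [Finset.sum_const, nsmul_eq_mul]
  have : (F.card : ℝ) * (2 * ξ * δ ^ 4 * T ^ 4) = ((F.card : ℝ) * δ ^ 4) * (2 * ξ) * T ^ 4 := by ring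
  rw [this]
  gcongr
  calc (F.card : ℝ) * δ ^ 4 * (2 * ξ) ≤ (V + 1) * (2 * ξ) := by gcongr; linarith
    _ = η := by rw [hξ]; field_simp


/-! ## The cusp -/

lemma pd_ineq {a b c d e : ℝ} (h : PD a b c d e) :
    0 < a ∧ (8 * a * c - 3 * b ^ 2) ^ 2 < 64 * a ^ 2 * (12 * a * e - 3 * b * d + c ^ 2) ∧
    (8 * a * c - 3 * b ^ 2 < 0 →
      (8 * a * c - 3 * b ^ 2) ^ 2 < 16 * a ^ 2 * (12 * a * e - 3 * b * d + c ^ 2)) := by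
  have ha : 0 < a := by
    have := h 1 0 (by norm_num)
    simpa [ev] using this
  have key : ∀ z : ℝ, 0 < 3 * z ^ 4 + 6 * (8 * a * c - 3 * b ^ 2) * z ^ 2 +
      24 * (b ^ 3 + 8 * a ^ 2 * d - 4 * a * b * c) * z +
      (64 * a ^ 2 * (12 * a * e - 3 * b * d + c ^ 2) - (8 * a * c - 3 * b ^ 2) ^ 2) := by
    intro z
    have h1 := h ((z - b) / (4 * a)) 1 (by norm_num)
    have h2 : 768 * a ^ 3 * ev a b c d e ((z - b) / (4 * a)) 1 = 3 * z ^ 4 + 6 * (8 * a * c - 3 * b ^ 2) * z ^ 2 +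
      24 * (b ^ 3 + 8 * a ^ 2 * d - 4 * a * b * c) * z +
      (64 * a ^ 2 * (12 * a * e - 3 * b * d + c ^ 2) - (8 * a * c - 3 * b ^ 2) ^ 2) := by
      unfold ev; field_simp; ring
    rw [← h2]; positivity
  refine ⟨ha, ?_, ?_⟩
  · have := key 0
    norm_num at this; linarith
  · intro hD
    set p := Real.sqrt (-(8 * a * c - 3 * b ^ 2)) with hp
    have hp2 : p ^ 2 = -(8 * a * c - 3 * b ^ 2) := Real.sq_sqrt (by linarith)
    have h1 := key p
    have h2 := key (-p)
    have h4 : p ^ 4 = (8 * a * c - 3 * b ^ 2) ^ 2 := by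
      rw [show p ^ 4 = (p ^ 2) ^ 2 by ring, hp2]; ring
    have h5 : (-p) ^ 4 = p ^ 4 := by ring
    have h6 : (-p) ^ 2 = p ^ 2 := by ring
    rw [h5, h6] at h2
    rw [h4, hp2] at h1 h2
    nlinarith

lemma r_ident (a b c d e : ℝ) : 27 * (b ^ 3 + 8 * a ^ 2 * d - 4 * a * b * c) ^ 2 =
    -(8 * a * c - 3 * b ^ 2) ^ 3 + 48 * a ^ 2 * (12 * a * e - 3 * b * d + c ^ 2) * (8 * a * c - 3 * b ^ 2)
    - 64 * a ^ 3 * (72 * a * c * e + 9 * b * c * d - 27 * a * d ^ 2 - 27 * e * b ^ 2 - 2 * c ^ 3) := by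
  ring

lemma BQF.I_cast (f : BQF) : (f.I : ℝ) = 12 * f.a * f.e - 3 * f.b * f.d + (f.c : ℝ) ^ 2 := by
  simp [BQF.I]

lemma BQF.J_cast (f : BQF) : (f.J : ℝ) = 72 * f.a * f.c * f.e + 9 * f.b * f.c * f.d
    - 27 * f.a * (f.d : ℝ) ^ 2 - 27 * f.e * (f.b : ℝ) ^ 2 - 2 * (f.c : ℝ) ^ 3 := by
  simp [BQF.J]

lemma fib_count (C k T u v : ℝ) (a b c : ℤ) (hC : 0 < C) (hk : 0 ≤ k) (hT : 1 ≤ T) (hu : 1 ≤ u)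
    (hv : 1 ≤ v) (hu2 : u ≤ 2 * T) (ha : 1 ≤ a) (haT : (a : ℝ) ≤ T)
    (hD : u = 1 ∨ 4 * a * u ≤ |8 * (a:ℝ) * c - 3 * (b:ℝ) ^ 2|)
    (S : Finset BQF) (hS : ∀ f ∈ S, f.a = a ∧ f.b = b ∧ f.c = c ∧ 0 < (f.I : ℝ) ∧ (f.I : ℝ) < T ^ 2 ∧
      |(f.J : ℝ)| ≤ C * T ^ 2 ∧
      ((b:ℝ) ^ 3 + 8 * (a:ℝ) ^ 2 * f.d - 4 * a * b * c) ^ 2 ≤ (a:ℝ) ^ 3 * T ^ 2 * v ^ 2 * k ^ 2) :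
    (S.card : ℝ) ≤ (k + 1) * (C + 3) * T ^ 3 * (v / u) / (a * √a) := by
  classical
  have ha' : (1:ℝ) ≤ a := by exact_mod_cast ha
  have ha0 : (0:ℝ) < a := by linarith
  have hsa : 0 < √(a:ℝ) := Real.sqrt_pos.2 ha0
  have hsa2 : √(a:ℝ) * √a = a := Real.mul_self_sqrt ha0.le
  have hsaT : √(a:ℝ) ≤ T := by nlinarith [Real.one_le_sqrt.2 ha']
  have he : ∀ d ∈ S.image BQF.d, ((S.filter (fun f => f.d = d)).card : ℝ) ≤ (C + 3) * T ^ 2 / (a * u) := by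
    intro d _
    have hinj : Set.InjOn BQF.e (S.filter (fun f => f.d = d)) := by
      intro f hf g hg hfg
      simp only [Finset.coe_filter, Set.mem_ofPred_eq] at hf hg
      have h1 := hS f hf.1; have h2 := hS g hg.1
      cases f; cases g
      simp only [BQF.mk.injEq] at *
      refine ⟨by rw [h1.1, h2.1], by rw [h1.2.1, h2.2.1], by rw [h1.2.2.1, h2.2.2.1],
        by rw [hf.2, hg.2], hfg⟩
    rw [← Finset.card_image_of_injOn hinj]
    have hone : 1 ≤ 2 * T ^ 2 / (a * u) := by
      rw [le_div_iff₀ (by positivity)]; nlinarith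
    have hL : (C + 3) * T ^ 2 / (a * u) = (C + 1) * T ^ 2 / (a * u) + 2 * T ^ 2 / (a * u) := by ring
    refine (card_le_of_diam _ ((C + 1) * T ^ 2 / (a * u)) (by positivity) ?_).trans (by linarith)
    intro x hx y hy
    simp only [Finset.mem_image, Finset.mem_filter] at hx hy
    obtain ⟨f, ⟨hf, hfd⟩, rfl⟩ := hx
    obtain ⟨g, ⟨hg, hgd⟩, rfl⟩ := hy
    obtain ⟨f1, f2, f3, f4, f5, f6, -⟩ := hS f hf
    obtain ⟨g1, g2, g3, g4, g5, g6, -⟩ := hS g hg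
    rw [BQF.I_cast, f1, f2, f3, hfd] at f4 f5
    rw [BQF.I_cast, g1, g2, g3, hgd] at g4 g5
    rw [BQF.J_cast, f1, f2, f3, hfd, abs_le] at f6
    rw [BQF.J_cast, g1, g2, g3, hgd, abs_le] at g6
    rw [le_div_iff₀ (by positivity)]
    rcases hD with h | h
    · rw [h]
      have : (0:ℝ) ≤ C * T ^ 2 := by positivity
      have h2 : (0:ℝ) ≤ T ^ 2 := by positivity
      linarith
    · rcases le_abs.1 h with h | h
      · by_contra! hcon
        have h1 : 0 < (f.e : ℝ) - g.e := by
          by_contra! h'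
          have : ((f.e:ℝ) - g.e) * (a * u) ≤ 0 := mul_nonpos_of_nonpos_of_nonneg h' (by positivity)
          nlinarith [sq_nonneg T]
        have := mul_le_mul_of_nonneg_right h h1.le
        nlinarith [sq_nonneg T]
      · by_contra! hcon
        have h1 : 0 < (f.e : ℝ) - g.e := by
          by_contra! h'
          have : ((f.e:ℝ) - g.e) * (a * u) ≤ 0 := mul_nonpos_of_nonpos_of_nonneg h' (by positivity)
          nlinarith [sq_nonneg T]
        have := mul_le_mul_of_nonneg_right h h1.le
        nlinarith [sq_nonneg T]
  have hd : ((S.image BQF.d).card : ℝ) ≤ (k + 1) * T * v / √a := by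
    have hone : 1 ≤ T * v / √a := by
      rw [le_div_iff₀ hsa]; nlinarith
    have hL : (k + 1) * T * v / √a = k * T * v / √a + T * v / √a := by ring
    refine (card_le_of_diam _ (k * T * v / √a) (by positivity) ?_).trans (by linarith)
    intro x hx y hy
    simp only [Finset.mem_image] at hx hy
    obtain ⟨f, hf, rfl⟩ := hx
    obtain ⟨g, hg, rfl⟩ := hy
    have f7 := (hS f hf).2.2.2.2.2.2
    have g7 := (hS g hg).2.2.2.2.2.2
    have hsq : (a:ℝ) ^ 3 * T ^ 2 * v ^ 2 * k ^ 2 = (a * √a * T * v * k) ^ 2 := by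
      have : √(a:ℝ) ^ 2 = a := Real.sq_sqrt ha0.le
      rw [mul_pow, mul_pow, mul_pow, mul_pow, this]; ring
    rw [hsq] at f7 g7
    have f8 := abs_le_of_sq_le_sq' f7 (by positivity)
    have g8 := abs_le_of_sq_le_sq' g7 (by positivity)
    rw [le_div_iff₀ hsa]
    have h1 : 8 * (a:ℝ) ^ 2 * ((f.d:ℝ) - g.d) ≤ 2 * (a * √a * T * v * k) := by linarith [f8.2, g8.1]
    have h2 : (a:ℝ) * √a * (4 * (((f.d:ℝ) - g.d) * √a)) ≤ a * √a * (k * T * v) := by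
      nlinarith
    have h3 := le_of_mul_le_mul_left h2 (by positivity)
    have h4 : 0 ≤ k * T * v := by positivity
    linarith
  have hmain : (S.card : ℝ) ≤ (C + 3) * T ^ 2 / (a * u) * (S.image BQF.d).card := by
    have h1 := Finset.card_eq_sum_card_image BQF.d S
    rw [h1, Nat.cast_sum]
    refine (Finset.sum_le_sum he).trans ?_
    rw [Finset.sum_const, nsmul_eq_mul, mul_comm]
  refine hmain.trans ((mul_le_mul_of_nonneg_left hd (by positivity)).trans (le_of_eq ?_))
  field_simp


lemma sum_inv_sqrt (N : ℕ) : ∑ i ∈ Finset.range N, 1 / √((i:ℝ) + 1) ≤ 2 * √N := by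
  induction N with
  | zero => simp
  | succ n ih =>
    rw [Finset.sum_range_succ]
    have h1 : (0:ℝ) ≤ n := by positivity
    have h2 : 0 < √((n:ℝ) + 1) := Real.sqrt_pos.2 (by linarith)
    have h3 := Real.sqrt_nonneg (n:ℝ)
    have h4 : √((n:ℝ) + 1) ^ 2 = n + 1 := Real.sq_sqrt (by linarith)
    have h5 : √(n:ℝ) ^ 2 = n := Real.sq_sqrt h1
    have h6 : 1 / √((n:ℝ) + 1) ≤ 2 * √((n:ℝ) + 1) - 2 * √n := by
      rw [div_le_iff₀ h2]
      nlinarith [sq_nonneg (√((n:ℝ) + 1) - √n)]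
    push_cast
    linarith

/-- weight -/
noncomputable def wt (j : ℤ) : ℝ := if 0 ≤ j then 1 / √((j:ℝ) + 1) else 1 / (-j)

lemma wt_nonneg (j : ℤ) : 0 ≤ wt j := by
  unfold wt
  split_ifs with h
  · positivity
  · have : (j:ℝ) < 0 := by exact_mod_cast not_le.1 h
    apply div_nonneg <;> linarith

lemma wt_sum (M N : ℕ) : ∑ j ∈ Finset.Ico (-(M:ℤ)) N, wt j ≤ 2 * √N + 1 + Real.log M := by
  rw [← Finset.Ico_union_Ico_eq_Ico (a := -(M:ℤ)) (b := 0) (c := N) (by omega) (by omega),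
    Finset.sum_union (Finset.Ico_disjoint_Ico_consecutive _ _ _)]
  have h1 : ∑ j ∈ Finset.Ico (0:ℤ) N, wt j ≤ 2 * √N := by
    refine le_trans (le_of_eq ?_) (sum_inv_sqrt N)
    symm
    refine Finset.sum_bij (fun i _ => (i:ℤ)) (fun i hi => ?_) (fun i _ j _ h => by exact_mod_cast h)
      (fun j hj => ?_) (fun i hi => ?_)
    · simp at hi ⊢; exact hi
    · simp only [Finset.mem_Ico] at hj
      exact ⟨j.toNat, by simp; omega, by omega⟩
    · simp [wt]
  have h2 : ∑ j ∈ Finset.Ico (-(M:ℤ)) 0, wt j ≤ 1 + Real.log M := by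
    refine le_trans (le_of_eq ?_) (harmonic_le_one_add_log M)
    unfold harmonic
    push_cast
    symm
    refine Finset.sum_bij (fun i _ => -((i:ℤ) + 1)) (fun i hi => ?_) (fun i _ j _ h => ?_)
      (fun j hj => ?_) (fun i hi => ?_)
    · simp at hi ⊢; omega
    · omega
    · simp only [Finset.mem_Ico] at hj
      exact ⟨(-j-1).toNat, by simp; omega, by omega⟩
    · have : ¬ (0 ≤ -((i:ℤ) + 1)) := by omega
      simp only [wt, this, if_false]
      push_cast
      simp
  linarith

lemma r_bound {a D Iv Jv C T n : ℝ} (hT : 0 < T) (ha : 0 < a) (hI : 0 < Iv) (hI2 : Iv < T ^ 2)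
    (hJ : -(C * T ^ 2) ≤ Jv) (h3 : D < 0 → D ^ 2 < 16 * a ^ 2 * Iv) (hn : D ≤ 8 * a * (n + 1)) :
    -D ^ 3 + 48 * a ^ 2 * Iv * D - 64 * a ^ 3 * Jv ≤ a ^ 3 * T ^ 2 * (384 * max (n + 1) 0 + 64 * C) := by
  have a3 : 0 < a ^ 3 := by positivity
  have j1 : -(64 * a ^ 3 * Jv) ≤ a ^ 3 * T ^ 2 * (64 * C) := by
    have := mul_le_mul_of_nonneg_left hJ a3.le
    linarith
  rcases lt_or_ge D 0 with hneg | hpos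
  · have t4 := h3 hneg
    have : 0 ≤ (-D) * (48 * a ^ 2 * Iv - D ^ 2) := by
      apply mul_nonneg (by linarith)
      have : 0 < a ^ 2 * Iv := by positivity
      linarith
    have : 0 ≤ a ^ 3 * T ^ 2 * (384 * max (n + 1) 0) := by positivity
    linarith
  · have hm : n + 1 ≤ max (n + 1) 0 := le_max_left _ _
    have h8 : a ^ 2 * Iv * D ≤ a ^ 2 * T ^ 2 * (8 * a * max (n + 1) 0) := by
      gcongr
      exact hn.trans (by gcongr)
    have : 0 ≤ D ^ 3 := by positivity
    linarith

set_option maxHeartbeats 1000000 in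
lemma cusp_count (C : ℝ) (hC : 0 < C) : ∃ K : ℝ, 0 < K ∧ ∀ T A l : ℝ, 1 ≤ T → 1 ≤ A → A ≤ T → 0 ≤ l →
    ∀ S : Finset BQF, (∀ f ∈ S, f.PDf ∧ (f.a : ℝ) ≤ A ∧ 0 ≤ f.b ∧ f.b < 4 * f.a ∧ (f.I : ℝ) < T ^ 2 ∧
      |(f.J : ℝ)| ≤ C * T ^ 2 ∧ 8 * (f.a : ℝ) * f.c - 3 * (f.b : ℝ) ^ 2 ≤ 8 * f.a * l * T) →
    (S.card : ℝ) ≤ K * T ^ 3 * √A * (√(l * T + 1) + 1 + Real.log (T + 2)) := by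
  classical
  set k := √(15 + 3 * C) with hk
  have hk2 : k ^ 2 = 15 + 3 * C := Real.sq_sqrt (by positivity)
  have hk0 : 0 ≤ k := Real.sqrt_nonneg _
  refine ⟨16 * ((k + 1) * (C + 3)), by positivity, ?_⟩
  intro T A l hT hA hAT hl S hS
  have hT0 : 0 < T := by linarith
  set K0 := (k + 1) * (C + 3) with hK0
  have hK00 : 0 < K0 := by positivity
  let jj : BQF → ℤ := fun f => (8 * f.a * f.c - 3 * f.b ^ 2) / (8 * f.a)
  set M := ⌊T + 2⌋₊ with hM
  set N := ⌊l * T + 1⌋₊ with hN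
  have hlT : 0 ≤ l * T := by positivity
  have hMle : (M:ℝ) ≤ T + 2 := Nat.floor_le (by linarith)
  have hNle : (N:ℝ) ≤ l * T + 1 := Nat.floor_le (by linarith)
  have hj : ∀ f ∈ S, 0 < (f.a:ℝ) ∧ 8 * (f.a:ℝ) * jj f ≤ 8 * (f.a : ℝ) * f.c - 3 * (f.b : ℝ) ^ 2 ∧
      8 * (f.a : ℝ) * f.c - 3 * (f.b : ℝ) ^ 2 < 8 * (f.a:ℝ) * (jj f + 1) ∧ (jj f : ℝ) < T ∧ -(T+1) < jj f
      ∧ (jj f : ℝ) ≤ l * T := by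
    intro f hf
    obtain ⟨h1, -, -, -, h5, h6, h7⟩ := hS f hf
    obtain ⟨p1, p2, p3⟩ := pd_ineq h1
    have q1 : 0 < f.a := by exact_mod_cast p1
    have e1 : (8 * f.a) * jj f ≤ 8 * f.a * f.c - 3 * f.b ^ 2 := Int.mul_ediv_self_le (by omega)
    have e2 : 8 * f.a * f.c - 3 * f.b ^ 2 < (8 * f.a) * jj f + (8 * f.a) :=
      Int.lt_mul_ediv_self_add (by omega)
    have e1' : (8 * f.a) * (jj f : ℝ) ≤ 8 * f.a * f.c - 3 * (f.b:ℝ) ^ 2 := by exact_mod_cast e1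
    have e2' : 8 * f.a * f.c - 3 * (f.b:ℝ) ^ 2 < (8 * f.a) * (jj f : ℝ) + (8 * f.a) := by exact_mod_cast e2
    have hb : (8 * (f.a:ℝ) * f.c - 3 * (f.b : ℝ) ^ 2) ^ 2 < (8 * f.a * T) ^ 2 := by
      refine p2.trans ?_
      rw [← BQF.I_cast]
      have : 64 * (f.a:ℝ) ^ 2 * f.I < 64 * (f.a:ℝ) ^ 2 * T ^ 2 := by gcongr
      nlinarith
    have hb2 := abs_lt_of_sq_lt_sq' hb (by positivity)
    have p8 : 0 < 8 * (f.a : ℝ) := by linarith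
    refine ⟨p1, e1', by linarith, ?_, ?_, ?_⟩
    · refine lt_of_mul_lt_mul_left (a := 8 * (f.a:ℝ)) ?_ p8.le
      linarith
    · refine lt_of_mul_lt_mul_left (a := 8 * (f.a:ℝ)) ?_ p8.le
      linarith
    · refine le_of_mul_le_mul_left (a := 8 * (f.a:ℝ)) ?_ p8
      linarith
  have hfib : ∀ a b j : ℤ, ((S.filter fun f => f.a = a ∧ f.b = b ∧ jj f = j).card : ℝ) ≤
      K0 * T ^ 3 * wt j / (a * √a) := by
    intro a b j
    rcases (S.filter fun f => f.a = a ∧ f.b = b ∧ jj f = j).eq_empty_or_nonempty with he | ⟨f0, hf0⟩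
    · rw [he, Finset.card_empty, Nat.cast_zero]
      rcases le_total 0 (a:ℝ) with h | h
      · have := wt_nonneg j
        positivity
      · rw [Real.sqrt_eq_zero_of_nonpos h]; simp
    rw [Finset.mem_filter] at hf0
    obtain ⟨hf0S, rfl, rfl, rfl⟩ := hf0
    obtain ⟨p1, e1, e2, e3, e4, e5⟩ := hj f0 hf0S
    have hc : ∀ f ∈ S, f.a = f0.a → f.b = f0.b → jj f = jj f0 → f.c = f0.c := by
      intro f hf h1 h2 h3
      simp only [jj, h1, h2] at h3
      have q1 : 0 < f0.a := by exact_mod_cast p1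
      have hh : ∀ c : ℤ, (8 * f0.a * c - 3 * f0.b ^ 2) / (8 * f0.a) = c + (-(3 * f0.b ^ 2)) / (8 * f0.a) := by
        intro c
        rw [show 8 * f0.a * c - 3 * f0.b ^ 2 = -(3 * f0.b ^ 2) + 8 * f0.a * c by ring,
          Int.add_mul_ediv_left _ _ (by omega : 8 * f0.a ≠ 0)]
        ring
      rw [hh, hh] at h3
      linarith
    have hr : ∀ f ∈ S.filter (fun f => f.a = f0.a ∧ f.b = f0.b ∧ jj f = jj f0),
        f ∈ S ∧ f.a = f0.a ∧ f.b = f0.b ∧ f.c = f0.c ∧ 0 < (f.I:ℝ) ∧ (f.I:ℝ) < T ^ 2 ∧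
        |(f.J:ℝ)| ≤ C * T ^ 2 ∧ 27 * ((f0.b:ℝ) ^ 3 + 8 * (f0.a:ℝ) ^ 2 * f.d - 4 * f0.a * f0.b * f0.c) ^ 2 ≤
          (f0.a:ℝ) ^ 3 * T ^ 2 * (384 * max (jj f0 + 1 : ℝ) 0 + 64 * C) := by
      intro f hf
      rw [Finset.mem_filter] at hf
      obtain ⟨hfS, h1, h2, h3⟩ := hf
      have h4 := hc f hfS h1 h2 h3
      obtain ⟨s1, -, -, -, s5, s6, s7⟩ := hS f hfS
      obtain ⟨t1, t2, t3⟩ := pd_ineq s1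
      rw [← BQF.I_cast] at t2 t3
      have hI : 0 < (f.I:ℝ) := by
        by_contra! hcon
        nlinarith [sq_nonneg (8 * (f.a:ℝ) * f.c - 3 * (f.b : ℝ) ^ 2), sq_nonneg (f.a:ℝ)]
      refine ⟨hfS, h1, h2, h4, hI, s5, s6, ?_⟩
      have hid := r_ident f.a f.b f.c f.d f.e
      rw [← BQF.I_cast, ← BQF.J_cast, h1, h2, h4] at hid
      rw [h1, h2, h4] at t3
      have hJ := (abs_le.1 s6).1
      rw [hid]
      set D := 8 * (f0.a:ℝ) * f0.c - 3 * (f0.b : ℝ) ^ 2 with hD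
      exact r_bound hT0 p1 hI s5 hJ t3 e2.le
    have q1 : 1 ≤ f0.a := by have : 0 < f0.a := by exact_mod_cast p1
                             omega
    have haA := (hS f0 hf0S).2.1
    rcases lt_or_ge (jj f0) 0 with hneg | hpos
    · have hw : wt (jj f0) = 1 / (-(jj f0 : ℝ)) := by simp [wt, hneg]
      rw [hw]
      have hneg' : (jj f0 : ℝ) ≤ -1 := by exact_mod_cast (by omega : jj f0 ≤ -1)
      refine fib_count C k T (-(jj f0 : ℝ)) 1 f0.a f0.b f0.c hC hk0 hT (by linarith) le_rfl
        (by linarith) q1 (by linarith) ?_ _ ?_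
      · rcases eq_or_ne (jj f0) (-1) with h | h
        · left; rw [h]; norm_num
        · right
          have h2 : (jj f0 : ℝ) ≤ -2 := by exact_mod_cast (by omega : jj f0 ≤ -2)
          refine le_trans ?_ (neg_le_abs _)
          nlinarith
      · intro f hf
        obtain ⟨-, h1, h2, h3, h4, h5, h6, h7⟩ := hr f hf
        refine ⟨h1, h2, h3, h4, h5, h6, ?_⟩
        rw [max_eq_right (by linarith)] at h7
        rw [hk2]
        have : 0 ≤ (f0.a:ℝ) ^ 3 * T ^ 2 := by positivity
        nlinarith
    · have hpos' : (0:ℝ) ≤ jj f0 := by exact_mod_cast hpos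
      have hs : 0 < √((jj f0:ℝ) + 1) := Real.sqrt_pos.2 (by linarith)
      have hs2 : √((jj f0:ℝ) + 1) ^ 2 = jj f0 + 1 := Real.sq_sqrt (by linarith)
      have hw : wt (jj f0) = √((jj f0:ℝ) + 1) / ((jj f0 : ℝ) + 1) := by
        simp only [wt, hpos, if_true]
        rw [div_eq_div_iff hs.ne' (by linarith)]
        linarith
      rw [hw]
      refine fib_count C k T ((jj f0 : ℝ) + 1) (√((jj f0:ℝ) + 1)) f0.a f0.b f0.c hC hk0 hT (by linarith)
        (Real.one_le_sqrt.2 (by linarith)) (by linarith) q1 (by linarith) ?_ _ ?_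
      · rcases eq_or_ne (jj f0) 0 with h | h
        · left; rw [h]; norm_num
        · right
          have h2 : 1 ≤ (jj f0 : ℝ) := by exact_mod_cast (by omega : 1 ≤ jj f0)
          refine le_trans ?_ (le_abs_self _)
          nlinarith
      · intro f hf
        obtain ⟨-, h1, h2, h3, h4, h5, h6, h7⟩ := hr f hf
        refine ⟨h1, h2, h3, h4, h5, h6, ?_⟩
        rw [max_eq_left (by linarith)] at h7
        rw [hk2, hs2]
        have h9 : 0 ≤ (f0.a:ℝ) ^ 3 * T ^ 2 := by positivity
        have h8 : 0 ≤ (f0.a:ℝ) ^ 3 * T ^ 2 * (jj f0 * C) := by positivity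
        have h10 : 0 ≤ (f0.a:ℝ) ^ 3 * T ^ 2 * (jj f0) := by positivity
        have h11 : 0 ≤ (f0.a:ℝ) ^ 3 * T ^ 2 * C := by positivity
        linarith
  set W := 2 * √N + 1 + Real.log M with hW
  have hW0 : 0 ≤ W := by
    have : 0 ≤ Real.log M := Real.log_natCast_nonneg M
    positivity
  have hab : ∀ a ∈ Finset.Ico (1:ℤ) (⌊A⌋₊ + 1), ((S.filter fun f => f.a = a).card : ℝ) ≤
      4 * (K0 * T ^ 3 * W) * (1 / √a) := by
    intro a ha
    rw [Finset.mem_Ico] at ha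
    have ha0 : (0:ℝ) < a := by exact_mod_cast (by omega : 0 < a)
    have hmap : Set.MapsTo (fun f : BQF => (f.b, jj f)) (S.filter fun f => f.a = a)
        (Finset.Ico (0:ℤ) (4 * a) ×ˢ Finset.Ico (-(M:ℤ)) N : Finset (ℤ × ℤ)) := by
      intro f hf
      simp only [Finset.coe_filter, Set.mem_ofPred_eq] at hf
      obtain ⟨hf, rfl⟩ := hf
      obtain ⟨p1, e1, e2, e3, e4, e5⟩ := hj f hf
      obtain ⟨-, -, h3, h4, -⟩ := hS f hf
      simp only [Finset.coe_product, Set.mem_prod, Finset.coe_Ico, Set.mem_Ico]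
      refine ⟨⟨h3, h4⟩, ?_, ?_⟩
      · have h := Nat.lt_floor_add_one (T + 2)
        have : -((M:ℤ):ℝ) - 1 < jj f - 1 := by push_cast; linarith
        have : -(M:ℤ) - 1 < jj f - 1 := by exact_mod_cast this
        omega
      · have h := Nat.lt_floor_add_one (l * T + 1)
        have : (jj f : ℝ) < ((N:ℤ) : ℝ) := by push_cast; linarith
        exact_mod_cast this
    rw [Finset.card_eq_sum_card_fiberwise hmap, Nat.cast_sum, Finset.sum_product]
    have h1 : ∀ b ∈ Finset.Ico (0:ℤ) (4 * a), ∑ j ∈ Finset.Ico (-(M:ℤ)) N,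
        (((S.filter fun f => f.a = a).filter fun f => (f.b, jj f) = (b, j)).card : ℝ) ≤
        K0 * T ^ 3 * W / (a * √a) := by
      intro b _
      have h2 : ∀ j ∈ Finset.Ico (-(M:ℤ)) N,
        (((S.filter fun f => f.a = a).filter fun f => (f.b, jj f) = (b, j)).card : ℝ) ≤
          K0 * T ^ 3 / (a * √a) * wt j := by
        intro j _
        refine (le_of_eq ?_).trans ((hfib a b j).trans (le_of_eq (by ring)))
        rw [Finset.filter_filter]
        simp only [Prod.mk.injEq]
      refine (Finset.sum_le_sum h2).trans ?_
      rw [← Finset.mul_sum]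
      refine (mul_le_mul_of_nonneg_left (wt_sum M N) (by positivity)).trans (le_of_eq ?_)
      rw [hW]; ring
    refine (Finset.sum_le_sum h1).trans ?_
    rw [Finset.sum_const, Int.card_Ico, nsmul_eq_mul]
    have h3 : (((4 * a - 0).toNat : ℕ) : ℝ) = 4 * a := by
      have : (((4 * a - 0).toNat : ℕ) : ℤ) = 4 * a := by omega
      exact_mod_cast this
    rw [h3]
    have : 0 < √(a:ℝ) := Real.sqrt_pos.2 ha0
    apply le_of_eq
    field_simp
  have hmapA : Set.MapsTo BQF.a S (Finset.Ico (1:ℤ) (⌊A⌋₊ + 1) : Finset ℤ) := by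
    intro f hf
    have h1 := (hj f hf).1
    have h2 := (hS f hf).2.1
    simp only [Finset.coe_Ico, Set.mem_Ico]
    have h3 : 0 < f.a := by exact_mod_cast h1
    refine ⟨by omega, ?_⟩
    have h := Nat.lt_floor_add_one A
    have : (f.a : ℝ) < (((⌊A⌋₊ : ℤ) + 1 : ℤ) : ℝ) := by push_cast; linarith
    exact_mod_cast this
  rw [Finset.card_eq_sum_card_fiberwise hmapA, Nat.cast_sum]
  refine (Finset.sum_le_sum hab).trans ?_
  rw [← Finset.mul_sum]
  have hs : ∑ a ∈ Finset.Ico (1:ℤ) (⌊A⌋₊ + 1), 1 / √(a:ℝ) ≤ 2 * √A := by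
    rw [sum_Ico_int]
    have h1 : ((⌊A⌋₊ : ℤ) + 1 - 1).toNat = ⌊A⌋₊ := by omega
    rw [h1]
    have h2 := sum_inv_sqrt ⌊A⌋₊
    have h3 : √(⌊A⌋₊ : ℝ) ≤ √A := Real.sqrt_le_sqrt (Nat.floor_le (by linarith))
    refine le_trans (le_of_eq ?_) (h2.trans (by linarith))
    refine Finset.sum_congr rfl fun i _ => ?_
    push_cast; rw [add_comm]
  have hWle : W ≤ 2 * (√(l * T + 1) + 1 + Real.log (T + 2)) := by
    have h1 : √(N:ℝ) ≤ √(l * T + 1) := Real.sqrt_le_sqrt hNle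
    have h2 : Real.log M ≤ Real.log (T + 2) := by
      have hM0 : 0 < M := Nat.floor_pos.2 (by linarith)
      exact Real.log_le_log (by exact_mod_cast hM0) hMle
    have h3 : 0 ≤ Real.log (T + 2) := Real.log_nonneg (by linarith)
    rw [hW]; linarith
  calc 4 * (K0 * T ^ 3 * W) * ∑ a ∈ Finset.Ico (1:ℤ) (⌊A⌋₊ + 1), 1 / √(a:ℝ)
      ≤ 4 * (K0 * T ^ 3 * (2 * (√(l * T + 1) + 1 + Real.log (T + 2)))) * (2 * √A) := by
        have : 0 ≤ Real.log (T + 2) := Real.log_nonneg (by linarith)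
        gcongr
    _ = _ := by ring


/-! ## Reducible forms -/

open Polynomial in
lemma quad_form {R : Type*} [Semiring R] {p : R[X]} (h : p.natDegree ≤ 2) (x : R) :
    p.eval x = p.coeff 2 * x ^ 2 + p.coeff 1 * x + p.coeff 0 := by
  rw [Polynomial.eval_eq_sum_range' (n := 3) (by omega)]
  simp [Finset.sum_range_succ]
  abel

open Polynomial in
lemma reducible_factor (f : BQF) (hP : f.PDf) (hI : ¬ f.Irred) : ∃ p q r s t u : ℤ,
    f.a = p * s ∧ f.b = p * t + q * s ∧ f.c = p * u + q * t + r * s ∧ f.d = q * u + r * t ∧ f.e = r * u ∧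
    0 < p ∧ 0 < s := by
  have ha : 0 < f.a := by exact_mod_cast (pd_ineq hP).1
  set F : ℤ[X] := C f.a * X ^ 4 + C f.b * X ^ 3 + C f.c * X ^ 2 + C f.d * X + C f.e with hF
  have hdeg : F.natDegree = 4 := by rw [hF]; compute_degree!; exact ha.ne'
  have hF0 : F ≠ 0 := by intro h; rw [h] at hdeg; simp at hdeg
  have hnoroot : ∀ x : ℝ, F.eval₂ (Int.castRingHom ℝ) x ≠ 0 := by
    intro x h
    have h1 := hP x 1 (by norm_num)
    have h2 : F.eval₂ (Int.castRingHom ℝ) x = ev f.a f.b f.c f.d f.e x 1 := by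
      rw [hF]; simp only [eval₂_add, eval₂_mul, eval₂_C, eval₂_X_pow, eval₂_X, ev]; simp
    rw [← h2, h] at h1
    exact lt_irrefl _ h1
  have hFr := eq_C_content_mul_primPart F
  set c := F.content
  set G := F.primPart with hG
  have hGp : G.IsPrimitive := isPrimitive_primPart F
  have hc0 : c ≠ 0 := by rintro h; rw [h] at hFr; simp at hFr; exact hF0 hFr
  have hGdeg : G.natDegree = 4 := by rw [hG, natDegree_primPart, hdeg]
  have hGI : ¬ Irreducible G := by
    intro h
    rw [IsPrimitive.Int.irreducible_iff_irreducible_map_cast hGp] at h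
    apply hI
    refine ⟨ha.ne', ?_⟩
    have h2 : F.map (Int.castRingHom ℚ) = C (f.a : ℚ) * X ^ 4 + C (f.b : ℚ) * X ^ 3 +
      C (f.c : ℚ) * X ^ 2 + C (f.d : ℚ) * X + C (f.e : ℚ) := by
      rw [hF]; simp
    rw [← h2, hFr, Polynomial.map_mul, Polynomial.map_C]
    have hu : IsUnit (C ((Int.castRingHom ℚ) c)) := by
      rw [isUnit_C]; simp [hc0]
    exact (irreducible_isUnit_mul hu).2 h
  have hGu : ¬ IsUnit G := by
    intro h; have := natDegree_eq_zero_of_isUnit h; omega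
  rw [irreducible_iff] at hGI
  push Not at hGI
  obtain ⟨g, h, hgh, hg, hh⟩ := hGI hGu
  have hG0 : G ≠ 0 := by intro h; rw [h] at hGdeg; simp at hGdeg
  have hg0 : g ≠ 0 := by rintro rfl; simp at hgh; exact hG0 hgh
  have hh0 : h ≠ 0 := by rintro rfl; simp at hgh; exact hG0 hgh
  have hsum : g.natDegree + h.natDegree = 4 := by rw [← natDegree_mul hg0 hh0, ← hgh, hGdeg]
  have key : ∀ k : ℤ[X], k ∣ G → ¬ IsUnit k → k.natDegree ≠ 0 ∧ k.natDegree ≠ 1 := by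
    intro k hk hku
    constructor
    · intro h0
      obtain ⟨z, rfl⟩ := natDegree_eq_zero.1 h0
      exact hku (isUnit_C.2 (hGp z hk))
    · intro h1
      have hF' : k ∣ F := hk.trans ⟨C c, by rw [mul_comm]; exact hFr⟩
      obtain ⟨m, hm⟩ := hF'
      have hlc : k.coeff 1 ≠ 0 := by
        have := leadingCoeff_ne_zero.2 (show k ≠ 0 by rintro rfl; simp at h1)
        rwa [leadingCoeff, h1] at this
      have hlc' : (k.coeff 1 : ℝ) ≠ 0 := by exact_mod_cast hlc
      refine hnoroot (-(k.coeff 0 : ℝ) / k.coeff 1) ?_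
      rw [hm, eval₂_mul]
      have : k.eval₂ (Int.castRingHom ℝ) (-(k.coeff 0 : ℝ) / k.coeff 1) = 0 := by
        rw [eval₂_eq_sum_range, h1]
        simp [Finset.sum_range_succ]
        field_simp; ring
      rw [this, zero_mul]
  have kg := key g ⟨h, hgh⟩ hg
  have kh := key h ⟨g, by rw [mul_comm]; exact hgh⟩ hh
  have hg2 : g.natDegree ≤ 2 := by omega
  have hh2 : h.natDegree ≤ 2 := by omega
  have hev : ∀ x : ℤ, f.a * x ^ 4 + f.b * x ^ 3 + f.c * x ^ 2 + f.d * x + f.e =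
      c * ((g.coeff 2 * x ^ 2 + g.coeff 1 * x + g.coeff 0) * (h.coeff 2 * x ^ 2 + h.coeff 1 * x + h.coeff 0)) := by
    intro x
    rw [← quad_form hg2, ← quad_form hh2, ← eval_mul, ← hgh]
    have : F.eval x = f.a * x ^ 4 + f.b * x ^ 3 + f.c * x ^ 2 + f.d * x + f.e := by
      rw [hF]; simp
    rw [← this]
    conv_lhs => rw [hFr]
    simp
  have h0 := hev 0
  have h1 := hev 1
  have h2 := hev (-1)
  have h3 := hev 2
  have h4 := hev (-2)
  ring_nf at h0 h1 h2 h3 h4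
  have haa : f.a = c * g.coeff 2 * h.coeff 2 := by linarith
  have hmain : ∃ p q r s t u : ℤ,
    f.a = p * s ∧ f.b = p * t + q * s ∧ f.c = p * u + q * t + r * s ∧ f.d = q * u + r * t ∧ f.e = r * u :=
    ⟨c * g.coeff 2, c * g.coeff 1, c * g.coeff 0, h.coeff 2, h.coeff 1, h.coeff 0,
      by linarith, by linarith, by linarith, by linarith, by linarith⟩
  obtain ⟨p, q, r, s, t, u, e1, e2, e3, e4, e5⟩ := hmain
  rw [e1] at ha
  rcases pos_and_pos_or_neg_and_neg_of_mul_pos ha with ⟨hp, hs⟩ | ⟨hp, hs⟩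
  · exact ⟨p, q, r, s, t, u, e1, e2, e3, e4, e5, hp, hs⟩
  · exact ⟨-p, -q, -r, -s, -t, -u, by linarith, by linarith, by linarith, by linarith, by linarith,
      by omega, by omega⟩

lemma disc_neg {p q r : ℝ} (hp : 0 < p) (h : ∀ x : ℝ, p * x ^ 2 + q * x + r ≠ 0) : q ^ 2 < 4 * p * r := by
  by_contra! hcon
  obtain ⟨w, hw⟩ : ∃ w : ℝ, w ^ 2 = q ^ 2 - 4 * p * r := ⟨_, Real.sq_sqrt (by linarith)⟩
  refine h ((-q + w) / (2 * p)) ?_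
  field_simp
  linarith

lemma reducible_factor' (f : BQF) (hP : f.PDf) (hI : ¬ f.Irred) : ∃ p q r s t u : ℤ,
    f = ⟨p * s, p * t + q * s, p * u + q * t + r * s, q * u + r * t, r * u⟩ ∧
    0 < p ∧ 0 < s ∧ 0 < r ∧ 0 < u ∧ q ^ 2 < 4 * p * r ∧ t ^ 2 < 4 * s * u := by
  obtain ⟨p, q, r, s, t, u, e1, e2, e3, e4, e5, hp, hs⟩ := reducible_factor f hP hI
  have hne : ∀ x : ℝ, (p * x ^ 2 + q * x + r) * (s * x ^ 2 + t * x + u) ≠ 0 := by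
    intro x
    have h1 := hP x 1 (by norm_num)
    refine ne_of_gt (lt_of_lt_of_eq h1 ?_)
    rw [e1, e2, e3, e4, e5]
    unfold ev; push_cast; ring
  have hq : q ^ 2 < 4 * p * r := by
    have := disc_neg (q := q) (r := r) (by exact_mod_cast hp : (0:ℝ) < p) fun x => left_ne_zero_of_mul (hne x)
    exact_mod_cast this
  have ht : t ^ 2 < 4 * s * u := by
    have := disc_neg (q := t) (r := u) (by exact_mod_cast hs : (0:ℝ) < s) fun x => right_ne_zero_of_mul (hne x)
    exact_mod_cast this
  refine ⟨p, q, r, s, t, u, ?_, hp, hs, ?_, ?_, hq, ht⟩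
  · cases f; simp only at e1 e2 e3 e4 e5; rw [e1, e2, e3, e4, e5]
  · by_contra! h; nlinarith [sq_nonneg q]
  · by_contra! h; nlinarith [sq_nonneg t]

lemma hyp_count (N : ℕ) : ((((Finset.Icc 1 N ×ˢ Finset.Icc 1 N).filter
    fun x : ℕ × ℕ => x.1 * x.2 ≤ N).card : ℕ) : ℝ) ≤ N * (1 + Real.log N) := by
  classical
  have h1 : ((Finset.Icc 1 N ×ˢ Finset.Icc 1 N).filter fun x : ℕ × ℕ => x.1 * x.2 ≤ N).card =
      ∑ p ∈ Finset.Icc 1 N, ((Finset.Icc 1 N).filter fun s => p * s ≤ N).card := by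
    rw [Finset.card_filter, Finset.sum_product]
    refine Finset.sum_congr rfl fun p _ => ?_
    rw [Finset.card_filter]
  rw [h1, Nat.cast_sum]
  have h2 := harmonic_le_one_add_log N
  rw [harmonic_eq_sum_Icc] at h2
  push_cast at h2
  refine le_trans ?_ (mul_le_mul_of_nonneg_left h2 (Nat.cast_nonneg N))
  rw [Finset.mul_sum]
  refine Finset.sum_le_sum fun p hp => ?_
  rw [Finset.mem_Icc] at hp
  have hp0 : 0 < p := by omega
  have h3 : ((Finset.Icc 1 N).filter fun s => p * s ≤ N) ⊆ Finset.Icc 1 (N / p) := by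
    intro s hs
    simp only [Finset.mem_filter, Finset.mem_Icc] at hs ⊢
    refine ⟨hs.1.1, ?_⟩
    rw [Nat.le_div_iff_mul_le hp0, mul_comm]; exact hs.2
  have h4 := Finset.card_le_card h3
  rw [Nat.card_Icc, Nat.add_sub_cancel] at h4
  calc ((((Finset.Icc 1 N).filter fun s => p * s ≤ N).card : ℕ) : ℝ) ≤ ((N / p : ℕ) : ℝ) := by exact_mod_cast h4
    _ ≤ (N : ℝ) / p := Nat.cast_div_le
    _ = _ := by rw [div_eq_mul_inv]

lemma card_sq_lt (m : ℤ) (hm : 0 < m) (s : Finset ℤ) (hs : ∀ q ∈ s, q ^ 2 < 4 * m) :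
    (s.card : ℝ) ≤ 5 * √m := by
  have hm' : (1:ℝ) ≤ m := by exact_mod_cast hm
  have h1 : 1 ≤ √(m:ℝ) := Real.one_le_sqrt.2 hm'
  have hsq : √(m:ℝ) ^ 2 = m := Real.sq_sqrt (by linarith)
  have h2 : ∀ q ∈ s, |(q:ℝ)| ≤ 2 * √m := by
    intro q hq
    apply abs_le_of_sq_le_sq _ (by positivity)
    have : ((q:ℝ)) ^ 2 < 4 * m := by exact_mod_cast hs q hq
    nlinarith
  refine (card_le_of_diam s (4 * √m) (by positivity) ?_).trans (by linarith)
  intro x hx y hy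
  have a1 := abs_le.1 (h2 x hx); have a2 := abs_le.1 (h2 y hy)
  linarith

lemma reducible_count (N : ℕ) (S : Finset BQF) (hS : ∀ f ∈ S, f.PDf ∧ ¬ f.Irred ∧ f.a ≤ N ∧ f.e ≤ N) :
    (S.card : ℝ) ≤ 25 * N * (N * (1 + Real.log N)) ^ 2 := by
  classical
  choose! p q r s t u hf using fun f (hf : f ∈ S) => reducible_factor' f (hS f hf).1 (hS f hf).2.1
  let φ : BQF → (ℕ × ℕ) × (ℕ × ℕ) := fun f => (((p f).toNat, (s f).toNat), ((r f).toNat, (u f).toNat))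
  let D := (Finset.Icc 1 N ×ˢ Finset.Icc 1 N).filter fun x : ℕ × ℕ => x.1 * x.2 ≤ N
  have hmul : ∀ x y z : ℤ, 0 < x → 0 < y → z = x * y → z ≤ N → (x.toNat, y.toNat) ∈ D := by
    intro x y z hx hy hz hzN
    simp only [D, Finset.mem_filter, Finset.mem_product, Finset.mem_Icc]
    have h1 : ((x.toNat * y.toNat : ℕ) : ℤ) ≤ N := by
      push_cast; rw [Int.toNat_of_nonneg hx.le, Int.toNat_of_nonneg hy.le, ← hz]; exact hzN
    have h1' : x.toNat * y.toNat ≤ N := by exact_mod_cast h1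
    have h2 : 1 ≤ x.toNat := by omega
    have h3 : 1 ≤ y.toNat := by omega
    refine ⟨⟨⟨h2, ?_⟩, h3, ?_⟩, h1'⟩ <;> nlinarith
  have hmap : Set.MapsTo φ S (D ×ˢ D : Finset _) := by
    intro f hfS
    obtain ⟨h1, h2, h3, h4, h5, h6, h7⟩ := hf f hfS
    simp only [Finset.coe_product, Set.mem_prod, Finset.mem_coe]
    exact ⟨hmul _ _ _ h2 h3 (congrArg BQF.a h1) (hS f hfS).2.2.1,
      hmul _ _ _ h4 h5 (congrArg BQF.e h1) (hS f hfS).2.2.2⟩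
  rw [Finset.card_eq_sum_card_fiberwise hmap, Nat.cast_sum]
  have hfib : ∀ x ∈ D ×ˢ D, ((S.filter fun f => φ f = x).card : ℝ) ≤ 25 * N := by
    rintro ⟨⟨P, Sx⟩, ⟨R, U⟩⟩ hx
    simp only [D, Finset.mem_product, Finset.mem_filter, Finset.mem_Icc] at hx
    obtain ⟨⟨⟨⟨p1, -⟩, s1, -⟩, ps⟩, ⟨⟨r1, -⟩, u1, -⟩, ru⟩ := hx
    set S' := S.filter fun f => φ f = ((P, Sx), (R, U)) with hS'
    have hv : ∀ f ∈ S', f ∈ S ∧ p f = P ∧ s f = Sx ∧ r f = R ∧ u f = U := by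
      intro f hfS
      rw [hS', Finset.mem_filter] at hfS
      obtain ⟨h1, h2, h3, h4, h5, h6, h7⟩ := hf f hfS.1
      have := hfS.2
      simp only [φ, Prod.mk.injEq] at this
      refine ⟨hfS.1, ?_, ?_, ?_, ?_⟩ <;> omega
    have hinj : Set.InjOn (fun f => (q f, t f)) S' := by
      intro f hfS g hgS hfg
      obtain ⟨f0, f1, f2, f3, f4⟩ := hv f hfS
      obtain ⟨g0, g1, g2, g3, g4⟩ := hv g hgS
      simp only [Prod.mk.injEq] at hfg
      rw [(hf f f0).1, (hf g g0).1, f1, f2, f3, f4, g1, g2, g3, g4, hfg.1, hfg.2]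
    have hsub : S'.image (fun f => (q f, t f)) ⊆ S'.image q ×ˢ S'.image t := by
      intro x hx
      rw [Finset.mem_image] at hx
      obtain ⟨f, hfS, rfl⟩ := hx
      simp only [Finset.mem_product]
      exact ⟨Finset.mem_image_of_mem _ hfS, Finset.mem_image_of_mem _ hfS⟩
    have hcard := Finset.card_le_card hsub
    rw [Finset.card_image_of_injOn hinj, Finset.card_product] at hcard
    have hq := card_sq_lt (P * R) (by positivity) (S'.image q) (by
      intro x hx
      rw [Finset.mem_image] at hx
      obtain ⟨f, hfS, rfl⟩ := hx
      obtain ⟨f0, f1, f2, f3, f4⟩ := hv f hfS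
      have := (hf f f0).2.2.2.2.2.1
      rw [f1, f3] at this; linarith)
    have ht := card_sq_lt (Sx * U) (by positivity) (S'.image t) (by
      intro x hx
      rw [Finset.mem_image] at hx
      obtain ⟨f, hfS, rfl⟩ := hx
      obtain ⟨f0, f1, f2, f3, f4⟩ := hv f hfS
      have := (hf f f0).2.2.2.2.2.2
      rw [f2, f4] at this; linarith)
    calc (S'.card : ℝ) ≤ ((S'.image q).card : ℝ) * (S'.image t).card := by exact_mod_cast hcard
      _ ≤ (5 * √((P * R : ℤ):ℝ)) * (5 * √((Sx * U : ℤ):ℝ)) := by gcongr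
      _ = 25 * √(((P * R : ℤ):ℝ) * ((Sx * U : ℤ):ℝ)) := by rw [Real.sqrt_mul (by positivity)]; ring
      _ ≤ 25 * √((N:ℝ) ^ 2) := by
        have a1 : (P:ℝ) * Sx ≤ N := by exact_mod_cast ps
        have a2 : (R:ℝ) * U ≤ N := by exact_mod_cast ru
        gcongr
        push_cast
        calc (P:ℝ) * R * (Sx * U) = (P * Sx) * (R * U) := by ring
          _ ≤ N * N := by gcongr
          _ = _ := by ring
      _ = 25 * N := by rw [Real.sqrt_sq (Nat.cast_nonneg N)]
  refine (Finset.sum_le_sum hfib).trans ?_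
  rw [Finset.sum_const, nsmul_eq_mul, Finset.card_product, Nat.cast_mul]
  have h := hyp_count N
  have h0 : (0:ℝ) ≤ D.card := Nat.cast_nonneg _
  calc (D.card : ℝ) * D.card * (25 * N) ≤ (N * (1 + Real.log N)) * (N * (1 + Real.log N)) * (25 * N) := by gcongr
    _ = _ := by ring


/-! ## Uniqueness of the reduced representative -/

lemma bal_pd_iff {A B C x y : ℝ} (hy : 0 < y) :
    PD A (pb A B x y) (pc A B C x y) (pd A B C x y) (pe A B C x y) ↔
      0 < A ∧ 0 < 8 * A ^ 2 + 4 * A * C - B ^ 2 := by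
  have hid : ∀ X Y, 0 < A → 4 * A * ev A B C (-B) A X Y =
      (2 * A * X ^ 2 + B * X * Y - 2 * A * Y ^ 2) ^ 2 +
      (8 * A ^ 2 + 4 * A * C - B ^ 2) * (X * Y) ^ 2 := by
    intro X Y _; unfold ev; ring
  constructor
  · intro h
    have hA : 0 < A := by simpa [ev] using h 1 0 (by norm_num)
    refine ⟨hA, ?_⟩
    obtain ⟨w, hw⟩ : ∃ w : ℝ, w ^ 2 = B ^ 2 + 16 * A ^ 2 := ⟨_, Real.sq_sqrt (by positivity)⟩
    set X := (-B + w) / (4 * A) with hX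
    have hroot : 2 * A * X ^ 2 + B * X - 2 * A = 0 := by
      rw [hX]; field_simp; linarith
    have h1 := h (X - x / y) (1 / y) (by rintro ⟨-, h⟩; simp at h; exact hy.ne' h)
    rw [ev_par, show X - x / y + x * (1 / y) = X by ring, show y * (1 / y) = 1 by field_simp] at h1
    have h2 := hid X 1 hA
    have h3 : 2 * A * X ^ 2 + B * X * 1 - 2 * A * 1 ^ 2 = 0 := by linarith
    rw [h3] at h2
    have h4 : 0 < (8 * A ^ 2 + 4 * A * C - B ^ 2) * (X * 1) ^ 2 := by
      have : 0 < 4 * A * ev A B C (-B) A X 1 := by positivity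
      linarith
    exact pos_of_mul_pos_left h4 (sq_nonneg _)
  · rintro ⟨hA, hΔ⟩ X Y hXY
    rw [ev_par]
    have h2 := hid (X + x * Y) (y * Y) hA
    have : 0 < 4 * A * ev A B C (-B) A (X + x * Y) (y * Y) := by
      rw [h2]
      by_cases hY : Y = 0
      · have hX : X ≠ 0 := fun h => hXY ⟨h, hY⟩
        rw [hY]; simp only [mul_zero, add_zero]
        have : 0 < (2 * A * X ^ 2) ^ 2 := by positivity
        nlinarith
      · by_cases hU : X + x * Y = 0
        · rw [hU]
          have : 0 < (2 * A * (y * Y) ^ 2) ^ 2 := by positivity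
          nlinarith
        · have : (X + x * Y) * (y * Y) ≠ 0 := mul_ne_zero hU (mul_ne_zero hy.ne' hY)
          positivity
    exact pos_of_mul_pos_right this (by positivity)

lemma bal_unique0 {A B C A' B' C' u v : ℝ} (hv : 0 < v) (hΔ : 8 * A ^ 2 + 4 * A * C - B ^ 2 ≠ 0)
    (hA : A ≠ 0)
    (h : ∀ X Y, ev A' B' C' (-B') A' X Y = ev A B C (-B) A (X + u * Y) (v * Y)) : u = 0 ∧ v = 1 := by
  simp only [← ev_par] at h
  obtain ⟨h1, h2, h3, h4, h5⟩ := ev_coeffs h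
  rw [h1] at h5
  rw [h2] at h4
  unfold pb pd at h4
  unfold pe at h5
  have k1 : (2 * A * (v ^ 2 - 1 - u ^ 2) - B * u * v) * (1 + u ^ 2 + v ^ 2) = 0 := by
    linear_combination (-2) * h5 + u * h4
  have k2 : 2 * A * (v ^ 2 - 1 - u ^ 2) = B * u * v := by
    have : 1 + u ^ 2 + v ^ 2 ≠ 0 := by positivity
    have := (mul_eq_zero.1 k1).resolve_right this
    linarith
  by_cases hu : u = 0
  · subst hu
    refine ⟨rfl, ?_⟩
    have : 2 * A * (v ^ 2 - 1) = 0 := by linarith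
    have : v ^ 2 - 1 = 0 := (mul_eq_zero.1 this).resolve_left (by simpa using hA)
    have : (v - 1) * (v + 1) = 0 := by linarith
    rcases mul_eq_zero.1 this with h | h <;> linarith
  · exfalso
    apply hΔ
    have k3 : (8 * A ^ 2 + 4 * A * C - B ^ 2) * (u * v) ^ 2 = 0 := by
      linear_combination (-2 * A * u) * h4 + (4 * A * u ^ 2 + B * u * v) * k2
    exact (mul_eq_zero.1 k3).resolve_right (pow_ne_zero 2 (mul_ne_zero hu hv.ne'))

lemma bal_unique {A B C x y A' B' C' x' y' : ℝ} (hy : 0 < y) (hy' : 0 < y')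
    (hΔ : 8 * A ^ 2 + 4 * A * C - B ^ 2 ≠ 0) (hA : A ≠ 0)
    (h : ∀ X Y, ev A' B' C' (-B') A' (X + x' * Y) (y' * Y) = ev A B C (-B) A (X + x * Y) (y * Y)) :
    x = x' ∧ y = y' := by
  obtain ⟨h1, h2⟩ := bal_unique0 (u := (x - x') / y') (v := y / y') (A' := A') (B' := B') (C' := C')
    (by positivity) hΔ hA (by
      intro X Y
      have := h (X - x' / y' * Y) (Y / y')
      rw [show X - x' / y' * Y + x' * (Y / y') = X by ring, show y' * (Y / y') = Y by field_simp] at this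
      rw [this]; congr 1 <;> ring)
  rw [div_eq_one_iff_eq hy'.ne'] at h2
  rw [div_eq_zero_iff] at h1
  rcases h1 with h1 | h1
  · exact ⟨by linarith, h2⟩
  · exact absurd h1 hy'.ne'

/-- strictly reduced forms -/
def BQF.SR (f : BQF) : Prop := ∃ A B C x y : ℝ, RedPar f.a f.b f.c f.d f.e A B C x y ∧ 0 < A ∧
  0 < 8 * A ^ 2 + 4 * A * C - B ^ 2 ∧ 0 < x ∧ x < 1 / 2 ∧ 1 < x ^ 2 + y ^ 2

lemma RedPar.ev_eq {a b c d e A B C x y : ℝ} (h : RedPar a b c d e A B C x y) (X Y : ℝ) :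
    ev a b c d e X Y = ev A B C (-B) A (X + x * Y) (y * Y) := by
  obtain ⟨_, rfl, rfl, rfl, rfl, rfl⟩ := h
  exact ev_par ..

lemma BQF.SR.pd {f : BQF} (h : f.SR) : f.PDf := by
  obtain ⟨A, B, C, x, y, ⟨hy, h1, h2, h3, h4, h5⟩, hA, hΔ, -⟩ := h
  unfold BQF.PDf
  rw [h1, h2, h3, h4, h5]
  exact (bal_pd_iff hy).2 ⟨hA, hΔ⟩

lemma red_aux {p q : ℤ} {x y : ℝ} (hx0 : 0 < x) (hx : x < 1 / 2) (hxy : 1 < x ^ 2 + y ^ 2)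
    (h : (p + x * q) ^ 2 + (y * q) ^ 2 ≤ 1) : q = 0 := by
  by_contra hq
  have h1 : (1 : ℤ) ≤ p ^ 2 - |p| * |q| + q ^ 2 := by
    have : 0 < p ^ 2 - |p| * |q| + q ^ 2 := by
      have h2 : 0 < q ^ 2 := by positivity
      nlinarith [sq_nonneg (2 * |p| - |q|), sq_abs p, sq_abs q]
    linarith
  have h1' : (1 : ℝ) ≤ (p : ℝ) ^ 2 - |(p : ℝ)| * |(q : ℝ)| + (q : ℝ) ^ 2 := by exact_mod_cast h1
  have hq' : 0 < (q : ℝ) ^ 2 := by positivity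
  have h3 : -(|(p : ℝ)| * |(q : ℝ)|) ≤ 2 * x * (p * q) := by
    rw [← abs_mul]
    have := neg_abs_le ((p : ℝ) * q)
    nlinarith [abs_nonneg ((p : ℝ) * q)]
  nlinarith

lemma BQF.SR.unique {f g : BQF} (hf : f.SR) (hg : g.SR) (h : BQF.Equivalent f g) : f = g := by
  obtain ⟨A, B, C, x, y, hr, hA, hΔ, hx0, hx, hxy⟩ := id hf
  obtain ⟨A', B', C', x', y', hr', hA', hΔ', hx0', hx', hxy'⟩ := id hg
  wlog hyy : y ≤ y' generalizing f g A B C x y A' B' C' x' y'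
  · exact (this hg hf (BQF.equiv_symm h) A' B' C' x' y' hr' hA' hΔ' hx0' hx' hxy'
      A B C x y hr hA hΔ hx0 hx hxy (le_of_not_ge hyy)).symm
  obtain ⟨p, q, r, s, hd, hgf⟩ := BQF.equiv_iff.mp h
  have hy := hr.1
  have hy' := hr'.1
  have hd' : |(p : ℝ) * s - q * r| = 1 := by
    have : |p * s - q * r| = 1 := by rcases hd with h | h <;> rw [h] <;> norm_num
    exact_mod_cast this
  have hdd : |(p + x * q) * (y * s) - (y * q) * (r + x * s)| = y := by
    rw [show (p + x * q) * (y * s) - (y * q) * (r + x * s) = y * ((p : ℝ) * s - q * r) by ring,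
      abs_mul, hd', abs_of_pos hy, mul_one]
  obtain ⟨A1, B1, C1, hqr⟩ := qr_form A B C (p + x * q) (r + x * s) (y * q) (y * s)
    (by intro h0; rw [h0, abs_zero] at hdd; exact hy.ne hdd)
  rw [hdd] at hqr
  set n := (p + x * q) ^ 2 + (y * q) ^ 2 with hn
  have hnp : 0 < n := by
    rcases (show 0 ≤ n by positivity).lt_or_eq with h | h
    · exact h
    · exfalso
      have z1 : (p + x * q : ℝ) = 0 := by nlinarith [sq_nonneg (p + x * q : ℝ), sq_nonneg (y * q : ℝ)]
      have z2 : (y * q : ℝ) = 0 := by nlinarith [sq_nonneg (p + x * q : ℝ), sq_nonneg (y * q : ℝ)]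
      rw [z1, z2] at hdd
      simp at hdd; exact hy.ne hdd
  obtain ⟨e1, e2⟩ := bal_unique (A := A') (B := B') (C := C') (x := x') (y := y')
    (A' := A1) (B' := B1) (C' := C1) hy' (div_pos hy hnp) hΔ'.ne' hA'.ne' (by
      intro X Y
      rw [← hqr, ← hr'.ev_eq, ← BQF.evalR_eq, hgf, BQF.tr_evalR, BQF.evalR_eq, hr.ev_eq]
      congr 1 <;> ring)
  have hn1 : n ≤ 1 := by
    rw [e2, le_div_iff₀ hnp] at hyy
    nlinarith
  have hq : q = 0 := red_aux hx0 hx hxy hn1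
  subst hq
  simp only [Int.cast_zero, mul_zero, add_zero, zero_mul] at *
  simp only [sub_zero] at hd
  have hp : p = 1 ∧ s = 1 ∨ p = -1 ∧ s = -1 ∨ p = 1 ∧ s = -1 ∨ p = -1 ∧ s = 1 := by
    rcases hd with h | h
    · rcases Int.mul_eq_one_iff_eq_one_or_neg_one.mp h with h | h <;> simp [h]
    · rcases Int.mul_eq_neg_one_iff_eq_one_or_neg_one.mp h with h | h <;> simp [h]
  have hr0 : r = 0 ∧ p * s = 1 := by
    rcases hp with ⟨rfl, rfl⟩ | ⟨rfl, rfl⟩ | ⟨rfl, rfl⟩ | ⟨rfl, rfl⟩ <;> norm_num [hn] at e1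
    · have a1 : (r : ℝ) < 1 := by linarith
      have a2 : (-1 : ℝ) < r := by linarith
      norm_cast at a1; have a2 : -1 < r := by exact_mod_cast a2
      exact ⟨by omega, by norm_num⟩
    · have a1 : (r : ℝ) < 1 := by linarith
      have a2 : (-1 : ℝ) < r := by linarith
      norm_cast at a1; have a2 : -1 < r := by exact_mod_cast a2
      exact ⟨by omega, by norm_num⟩
    · exfalso
      have a1 : (r : ℝ) < 1 := by linarith
      have a2 : (0 : ℝ) < r := by linarith
      norm_cast at a1 a2; omega
    · exfalso
      have a1 : (r : ℝ) < 0 := by linarith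
      have a2 : (-1 : ℝ) < r := by linarith
      norm_cast at a1; have a2 : -1 < r := by exact_mod_cast a2
      omega
  obtain ⟨rfl, hps⟩ := hr0
  rw [hgf]
  apply BQF.ext_eval
  intro X Y
  rw [BQF.tr_eval]
  rcases hp with ⟨rfl, rfl⟩ | ⟨rfl, rfl⟩ | ⟨rfl, rfl⟩ | ⟨rfl, rfl⟩
  · simp
  · simp only [BQF.evalZ]; ring
  · norm_num at hps
  · norm_num at hps


/-! ## Openness of the reduced region -/

/-- coefficients from parameters -/
noncomputable def Psi (p : Fin 5 → ℝ) : Fin 5 → ℝ :=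
  ![p 0, pb (p 0) (p 1) (p 3) (p 4), pc (p 0) (p 1) (p 2) (p 3) (p 4),
    pd (p 0) (p 1) (p 2) (p 3) (p 4), pe (p 0) (p 1) (p 2) (p 3) (p 4)]

lemma Psi_deriv (p : Fin 5 → ℝ) : ∃ L : (Fin 5 → ℝ) →L[ℝ] (Fin 5 → ℝ), HasStrictFDerivAt Psi L p ∧
    ∀ h, L h 0 = h 0 ∧ L h 1 = 4 * h 0 * p 3 + 4 * p 0 * h 3 + h 1 * p 4 + p 1 * h 4 ∧
    L h 2 = 6 * h 0 * p 3 ^ 2 + 12 * p 0 * p 3 * h 3 + 3 * (h 1 * p 3 * p 4 + p 1 * h 3 * p 4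
      + p 1 * p 3 * h 4) + h 2 * p 4 ^ 2 + 2 * p 2 * p 4 * h 4 ∧
    L h 3 = 4 * h 0 * p 3 ^ 3 + 12 * p 0 * p 3 ^ 2 * h 3 + 3 * (h 1 * p 3 ^ 2 * p 4 +
      2 * p 1 * p 3 * h 3 * p 4 + p 1 * p 3 ^ 2 * h 4) + 2 * (h 2 * p 3 * p 4 ^ 2 + p 2 * h 3 * p 4 ^ 2
      + 2 * p 2 * p 3 * p 4 * h 4) - h 1 * p 4 ^ 3 - 3 * p 1 * p 4 ^ 2 * h 4 ∧
    L h 4 = h 0 * p 3 ^ 4 + 4 * p 0 * p 3 ^ 3 * h 3 + h 1 * p 3 ^ 3 * p 4 + 3 * p 1 * p 3 ^ 2 * h 3 * p 4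
      + p 1 * p 3 ^ 3 * h 4 + h 2 * p 3 ^ 2 * p 4 ^ 2 + 2 * p 2 * p 3 * h 3 * p 4 ^ 2
      + 2 * p 2 * p 3 ^ 2 * p 4 * h 4 - h 1 * p 3 * p 4 ^ 3 - p 1 * h 3 * p 4 ^ 3
      - 3 * p 1 * p 3 * p 4 ^ 2 * h 4 + h 0 * p 4 ^ 4 + 4 * p 0 * p 4 ^ 3 * h 4 := by
  have P : ∀ i, HasStrictFDerivAt (fun p : Fin 5 → ℝ => p i)
      (ContinuousLinearMap.proj i : (Fin 5 → ℝ) →L[ℝ] ℝ) p :=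
    fun i => hasStrictFDerivAt_apply i p
  obtain ⟨L1, g1, e1⟩ : ∃ L : (Fin 5 → ℝ) →L[ℝ] ℝ, HasStrictFDerivAt (fun p => Psi p 1) L p ∧
      ∀ h, L h = 4 * h 0 * p 3 + 4 * p 0 * h 3 + h 1 * p 4 + p 1 * h 4 :=
    ⟨_, (((P 0).const_mul 4).mul (P 3)).add ((P 1).mul (P 4)), fun h => by simp; ring⟩
  obtain ⟨L2, g2, e2⟩ : ∃ L : (Fin 5 → ℝ) →L[ℝ] ℝ, HasStrictFDerivAt (fun p => Psi p 2) L p ∧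
      ∀ h, L h = 6 * h 0 * p 3 ^ 2 + 12 * p 0 * p 3 * h 3 + 3 * (h 1 * p 3 * p 4 + p 1 * h 3 * p 4
      + p 1 * p 3 * h 4) + h 2 * p 4 ^ 2 + 2 * p 2 * p 4 * h 4 :=
    ⟨_, ((((P 0).const_mul 6).mul ((P 3).pow 2)).add ((((P 1).const_mul 3).mul (P 3)).mul (P 4))).add
    ((P 2).mul ((P 4).pow 2)), fun h => by simp; ring⟩
  obtain ⟨L3, g3, e3⟩ : ∃ L : (Fin 5 → ℝ) →L[ℝ] ℝ, HasStrictFDerivAt (fun p => Psi p 3) L p ∧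
      ∀ h, L h = 4 * h 0 * p 3 ^ 3 + 12 * p 0 * p 3 ^ 2 * h 3 + 3 * (h 1 * p 3 ^ 2 * p 4 +
      2 * p 1 * p 3 * h 3 * p 4 + p 1 * p 3 ^ 2 * h 4) + 2 * (h 2 * p 3 * p 4 ^ 2 + p 2 * h 3 * p 4 ^ 2
      + 2 * p 2 * p 3 * p 4 * h 4) - h 1 * p 4 ^ 3 - 3 * p 1 * p 4 ^ 2 * h 4 :=
    ⟨_, (((((P 0).const_mul 4).mul ((P 3).pow 3)).add ((((P 1).const_mul 3).mul
    ((P 3).pow 2)).mul (P 4))).add ((((P 2).const_mul 2).mul (P 3)).mul ((P 4).pow 2))).sub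
    ((P 1).mul ((P 4).pow 3)), fun h => by simp; ring⟩
  obtain ⟨L4, g4, e4⟩ : ∃ L : (Fin 5 → ℝ) →L[ℝ] ℝ, HasStrictFDerivAt (fun p => Psi p 4) L p ∧
      ∀ h, L h = h 0 * p 3 ^ 4 + 4 * p 0 * p 3 ^ 3 * h 3 + h 1 * p 3 ^ 3 * p 4
      + 3 * p 1 * p 3 ^ 2 * h 3 * p 4
      + p 1 * p 3 ^ 3 * h 4 + h 2 * p 3 ^ 2 * p 4 ^ 2 + 2 * p 2 * p 3 * h 3 * p 4 ^ 2
      + 2 * p 2 * p 3 ^ 2 * p 4 * h 4 - h 1 * p 3 * p 4 ^ 3 - p 1 * h 3 * p 4 ^ 3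
      - 3 * p 1 * p 3 * p 4 ^ 2 * h 4 + h 0 * p 4 ^ 4 + 4 * p 0 * p 4 ^ 3 * h 4 :=
    ⟨_, (((((P 0).mul ((P 3).pow 4)).add (((P 1).mul ((P 3).pow 3)).mul (P 4))).add
    (((P 2).mul ((P 3).pow 2)).mul ((P 4).pow 2))).sub (((P 1).mul (P 3)).mul ((P 4).pow 3))).add
    ((P 0).mul ((P 4).pow 4)), fun h => by simp; ring⟩
  refine ⟨ContinuousLinearMap.pi ![ContinuousLinearMap.proj 0, L1, L2, L3, L4],
    hasStrictFDerivAt_pi.2 fun i => ?_, fun h => ⟨rfl, e1 h, e2 h, e3 h, e4 h⟩⟩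
  fin_cases i
  · exact P 0
  · exact g1
  · exact g2
  · exact g3
  · exact g4

lemma Psi_nhds (p : Fin 5 → ℝ) (hy : p 4 ≠ 0) (hA : p 0 ≠ 0)
    (hΔ : 8 * p 0 ^ 2 + 4 * p 0 * p 2 - p 1 ^ 2 ≠ 0) : map Psi (nhds p) = nhds (Psi p) := by
  obtain ⟨L, hL, e⟩ := Psi_deriv p
  have hinj : Function.Injective L := by
    rw [injective_iff_map_eq_zero]
    intro h hh
    obtain ⟨e0, e1, e2, e3, e4⟩ := e h
    rw [hh] at e0 e1 e2 e3 e4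
    simp only [Pi.zero_apply] at e0 e1 e2 e3 e4
    rw [← e0] at e1 e2 e3 e4
    have k4 : p 4 ^ 3 * (4 * p 0 * h 4 - p 1 * h 3) = 0 := by
      linear_combination -e4 + p 3 * e3 - p 3 ^ 2 * e2 + p 3 ^ 3 * e1
    have k4' := (mul_eq_zero.1 k4).resolve_left (pow_ne_zero 3 hy)
    have k3 : p 4 ^ 2 * (-h 1 * p 4 + 2 * p 2 * h 3 - 3 * p 1 * h 4) = 0 := by
      linear_combination -e3 + 2 * p 3 * e2 - 3 * p 3 ^ 2 * e1
    have k3' := (mul_eq_zero.1 k3).resolve_left (pow_ne_zero 2 hy)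
    have k2 : p 4 * (h 2 * p 4 + 3 * p 1 * h 3 + 2 * p 2 * h 4) = 0 := by
      linear_combination -e2 + 3 * p 3 * e1
    have k2' := (mul_eq_zero.1 k2).resolve_left hy
    have hx : (8 * p 0 ^ 2 + 4 * p 0 * p 2 - p 1 ^ 2) * h 3 = 0 := by
      linear_combination 2 * p 0 * k3' - 2 * p 0 * e1 + p 1 * k4'
    have hx := (mul_eq_zero.1 hx).resolve_left hΔ
    rw [hx] at k4' k3' k2' e1
    have h4 : h 4 = 0 := by
      have : 4 * p 0 * h 4 = 0 := by linarith
      exact (mul_eq_zero.1 this).resolve_left (by simpa using hA)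
    rw [h4] at k4' k3' k2' e1
    have h1 : h 1 = 0 := by
      have : h 1 * p 4 = 0 := by linarith
      exact (mul_eq_zero.1 this).resolve_right hy
    have h2 : h 2 = 0 := by
      have : h 2 * p 4 = 0 := by linarith
      exact (mul_eq_zero.1 this).resolve_right hy
    ext i
    fin_cases i
    · exact e0.symm
    · exact h1
    · exact h2
    · exact hx
    · exact h4
  set E := (LinearEquiv.ofInjectiveEndo (L : (Fin 5 → ℝ) →ₗ[ℝ] (Fin 5 → ℝ)) hinj).toContinuousLinearEquiv
  have hE : (E : (Fin 5 → ℝ) →L[ℝ] (Fin 5 → ℝ)) = L := by ext x; rfl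
  exact HasStrictFDerivAt.map_nhds_eq_of_equiv (f' := E) (by rw [hE]; exact hL)

/-- open parameter region -/
def Om (p : Fin 5 → ℝ) : Prop := 0 < p 0 ∧ 0 < 8 * p 0 ^ 2 + 4 * p 0 * p 2 - p 1 ^ 2 ∧ 0 < p 3 ∧
  p 3 < 1 / 2 ∧ 1 < p 3 ^ 2 + p 4 ^ 2 ∧ 0 < p 4 ∧ (12 * p 0 ^ 2 + 3 * p 1 ^ 2 + p 2 ^ 2) * p 4 ^ 4 < 1

def Om5 : Set (Fin 5 → ℝ) := Psi '' {p | Om p}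

lemma isOpen_Om5 : IsOpen Om5 := by
  have hO : IsOpen {p | Om p} := by
    unfold Om
    iterate 6 refine IsOpen.and (isOpen_lt (by fun_prop) (by fun_prop)) ?_
    exact isOpen_lt (by fun_prop) (by fun_prop)
  rw [isOpen_iff_mem_nhds]
  rintro _ ⟨p, hp, rfl⟩
  have hp' : Om p := hp
  rw [← Psi_nhds p hp'.2.2.2.2.2.1.ne' hp'.1.ne' hp'.2.1.ne']
  exact image_mem_map (hO.mem_nhds hp)

lemma I_par (A B C x y : ℝ) : 12 * A * pe A B C x y - 3 * pb A B x y * pd A B C x y +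
    pc A B C x y ^ 2 = (12 * A ^ 2 + 3 * B ^ 2 + C ^ 2) * y ^ 4 := by
  unfold pb pc pd pe; ring

lemma J_par (A B C x y : ℝ) : 72 * A * pc A B C x y * pe A B C x y
    + 9 * pb A B x y * pc A B C x y * pd A B C x y - 27 * A * pd A B C x y ^ 2
    - 27 * pe A B C x y * pb A B x y ^ 2 - 2 * pc A B C x y ^ 3
    = y ^ 6 * ((6 * A + C) * (12 * A * C - 2 * C ^ 2 - 9 * B ^ 2)) := by
  unfold pb pc pd pe; ring

lemma D_par (A B C x y : ℝ) : 8 * A * pc A B C x y - 3 * pb A B x y ^ 2 =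
    y ^ 2 * (8 * A * C - 3 * B ^ 2) := by
  unfold pb pc; ring

lemma Om5_SR {f : BQF} {T : ℝ} (hT : 0 < T)
    (h : ![(f.a : ℝ) / T, f.b / T, f.c / T, f.d / T, f.e / T] ∈ Om5) :
    f.SR ∧ (f.I : ℝ) < T ^ 2 := by
  obtain ⟨p, ⟨h1, h2, h3, h4, h5, h6, h7⟩, hp⟩ := h
  have q : ∀ i : Fin 5, T * Psi p i = T * ![(f.a : ℝ) / T, f.b / T, f.c / T, f.d / T, f.e / T] i := by
    intro i; rw [hp]
  have q0 := q 0
  have q1 := q 1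
  have q2 := q 2
  have q3 := q 3
  have q4 := q 4
  simp [Psi, mul_div_cancel₀ _ hT.ne'] at q0 q1 q2 q3 q4
  have R : RedPar f.a f.b f.c f.d f.e (T * p 0) (T * p 1) (T * p 2) (p 3) (p 4) := by
    refine ⟨h6, by linarith, ?_, ?_, ?_, ?_⟩
    · rw [← q1]; unfold pb; ring
    · rw [← q2]; unfold pc; ring
    · rw [← q3]; unfold pd; ring
    · rw [← q4]; unfold pe; ring
  refine ⟨⟨_, _, _, _, _, R, by positivity, ?_, h3, h4, h5⟩, ?_⟩
  · have : 0 < T ^ 2 * (8 * p 0 ^ 2 + 4 * p 0 * p 2 - p 1 ^ 2) := by positivity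
    linarith
  · obtain ⟨-, r0, r1, r2, r3, r4⟩ := R
    rw [BQF.I_cast, r0, r1, r2, r3, r4, I_par]
    have : T ^ 2 * ((12 * p 0 ^ 2 + 3 * p 1 ^ 2 + p 2 ^ 2) * p 4 ^ 4) < T ^ 2 * 1 := by gcongr
    linarith


/-! ## Parametrisation of the cone `J = 0` and its volume -/

noncomputable def pA (t : Fin 4 → ℝ) : ℝ := t 2 * (3 + Real.cos (t 3)) / 4
noncomputable def pB (t : Fin 4 → ℝ) : ℝ := -(t 2 * Real.sin (t 3))
noncomputable def pC (t : Fin 4 → ℝ) : ℝ := 3 / 2 * t 2 * (1 - Real.cos (t 3))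

/-- the parametrisation, `t = (x, y, s, ψ)` -/
noncomputable def Phi (t : Fin 4 → ℝ) : Fin 4 → ℝ :=
  ![pA t, pb (pA t) (pB t) (t 0) (t 1), pc (pA t) (pB t) (pC t) (t 0) (t 1),
    pd (pA t) (pB t) (pC t) (t 0) (t 1)]

noncomputable def PhiM (t : Fin 4 → ℝ) : Matrix (Fin 4) (Fin 4) ℝ :=
  let x := t 0
  let y := t 1
  let A := pA t
  let B := pB t
  let C := pC t
  let c := Real.cos (t 3)
  let n := Real.sin (t 3)
  let s := t 2
  !![0, 0, (3 + c) / 4, -(s * n) / 4;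
     4 * A, B, (3 + c) * x - n * y, -(s * n) * x - s * c * y;
     12 * A * x + 3 * B * y, 3 * B * x + 2 * C * y,
      3 / 2 * (3 + c) * x ^ 2 - 3 * n * x * y + 3 / 2 * (1 - c) * y ^ 2,
      -(3 / 2 * s * n) * x ^ 2 - 3 * s * c * x * y + 3 / 2 * s * n * y ^ 2;
     12 * A * x ^ 2 + 6 * B * x * y + 2 * C * y ^ 2, 3 * B * x ^ 2 + 4 * C * x * y - 3 * B * y ^ 2,
      (3 + c) * x ^ 3 - 3 * n * x ^ 2 * y + 3 * (1 - c) * x * y ^ 2 + n * y ^ 3,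
      -(s * n) * x ^ 3 - 3 * s * c * x ^ 2 * y + 3 * s * n * x * y ^ 2 + s * c * y ^ 3]

lemma PhiM_det (t : Fin 4 → ℝ) : (PhiM t).det = -(12 * t 2 ^ 3 * t 1 ^ 4 * (1 - Real.cos (t 3))) := by
  have hu := Real.sin_sq_add_cos_sq (t 3)
  simp only [PhiM, Matrix.det_succ_row_zero, Fin.sum_univ_succ, pA, pB, pC]
  simp [Fin.succAbove, Matrix.submatrix]
  generalize Real.cos (t 3) = c at *
  generalize Real.sin (t 3) = n at *
  linear_combination (t 1 ^ 4 * t 2 ^ 3 * (-18 + (30 - 6 * c + 6 * (c ^ 2 + n ^ 2 - 1)) / 4)) * hu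

lemma Phi_deriv (t : Fin 4 → ℝ) :
    HasFDerivAt Phi (LinearMap.toContinuousLinearMap (Matrix.toLin' (PhiM t))) t := by
  have P : ∀ i, HasFDerivAt (fun p : Fin 4 → ℝ => p i)
      (ContinuousLinearMap.proj i : (Fin 4 → ℝ) →L[ℝ] ℝ) t := fun i => hasFDerivAt_apply i t
  obtain ⟨LA, hA, eA⟩ : ∃ L : (Fin 4 → ℝ) →L[ℝ] ℝ, HasFDerivAt pA L t ∧ ∀ h, L h =
      (3 + Real.cos (t 3)) / 4 * h 2 - t 2 * Real.sin (t 3) / 4 * h 3 :=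
    ⟨_, ((P 2).fun_mul ((P 3).cos.const_add 3)).mul_const 4⁻¹, fun h => by simp; ring⟩
  obtain ⟨LB, hB, eB⟩ : ∃ L : (Fin 4 → ℝ) →L[ℝ] ℝ, HasFDerivAt pB L t ∧ ∀ h, L h =
      - Real.sin (t 3) * h 2 - t 2 * Real.cos (t 3) * h 3 :=
    ⟨_, ((P 2).fun_mul (P 3).sin).fun_neg, fun h => by simp; ring⟩
  obtain ⟨LC, hC, eC⟩ : ∃ L : (Fin 4 → ℝ) →L[ℝ] ℝ, HasFDerivAt pC L t ∧ ∀ h, L h =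
      3 / 2 * (1 - Real.cos (t 3)) * h 2 + 3 / 2 * t 2 * Real.sin (t 3) * h 3 :=
    ⟨_, ((P 2).const_mul (3 / 2)).fun_mul ((P 3).cos.const_sub 1), fun h => by simp; ring⟩
  have key : ∀ i h, (ContinuousLinearMap.proj i ∘L (LinearMap.toContinuousLinearMap
      (Matrix.toLin' (PhiM t)))) h = PhiM t i 0 * h 0 + PhiM t i 1 * h 1 + PhiM t i 2 * h 2
      + PhiM t i 3 * h 3 := by
    intro i h
    simp [Matrix.mulVec, dotProduct, Fin.sum_univ_four]
  rw [hasFDerivAt_pi']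
  intro i
  fin_cases i
  · refine hA.congr_fderiv (ContinuousLinearMap.ext fun h => ?_)
    rw [key, eA]; simp [PhiM]; ring
  · refine (((hA.const_mul 4).fun_mul (P 0)).fun_add (hB.fun_mul (P 1))).congr_fderiv
      (ContinuousLinearMap.ext fun h => ?_)
    rw [key]; simp [PhiM, eA, eB]; ring
  · refine ((((hA.const_mul 6).fun_mul ((P 0).pow 2)).fun_add (((hB.const_mul 3).fun_mul (P 0)).fun_mul
      (P 1))).fun_add (hC.fun_mul ((P 1).pow 2))).congr_fderiv (ContinuousLinearMap.ext fun h => ?_)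
    rw [key]; simp [PhiM, eA, eB, eC]; ring
  · refine (((((hA.const_mul 4).fun_mul ((P 0).pow 3)).fun_add (((hB.const_mul 3).fun_mul
      ((P 0).pow 2)).fun_mul (P 1))).fun_add (((hC.const_mul 2).fun_mul (P 0)).fun_mul
      ((P 1).pow 2))).fun_sub (hB.fun_mul ((P 1).pow 3))).congr_fderiv
      (ContinuousLinearMap.ext fun h => ?_)
    rw [key]; simp [PhiM, eA, eB, eC]; ring

/-- the `e`-coefficient forced by `J = 0` -/
noncomputable def es (m : Fin 4 → ℝ) : ℝ :=
  (27 * m 0 * m 3 ^ 2 - 9 * m 1 * m 2 * m 3 + 2 * m 2 ^ 3) / (9 * (8 * m 0 * m 2 - 3 * m 1 ^ 2))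

lemma pABC (t : Fin 4 → ℝ) : 12 * pA t * pC t - 2 * pC t ^ 2 - 9 * pB t ^ 2 = 0 ∧
    8 * pA t ^ 2 + 4 * pA t * pC t - pB t ^ 2 = 8 * t 2 ^ 2 ∧
    12 * pA t ^ 2 + 3 * pB t ^ 2 + pC t ^ 2 = 12 * t 2 ^ 2 ∧
    8 * pA t * pC t - 3 * pB t ^ 2 = 6 * t 2 ^ 2 * (1 - Real.cos (t 3)) ∧
    pA t + pC t / 6 = t 2 := by
  have hu := Real.sin_sq_add_cos_sq (t 3)
  simp only [pA, pB, pC]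
  refine ⟨?_, ?_, ?_, ?_, by ring⟩
  · linear_combination (-9) * t 2 ^ 2 * hu
  · linear_combination (-1) * t 2 ^ 2 * hu
  · linear_combination 3 * t 2 ^ 2 * hu
  · linear_combination (-3) * t 2 ^ 2 * hu

lemma one_sub_cos_pos {ψ : ℝ} (h0 : 0 < ψ) (h1 : ψ < 2 * Real.pi) : 0 < 1 - Real.cos ψ := by
  have h := Real.sin_pos_of_pos_of_lt_pi (x := ψ / 2) (by linarith) (by linarith)
  have : Real.cos ψ = 1 - 2 * Real.sin (ψ / 2) ^ 2 := by
    rw [Real.sin_sq_eq_half_sub]; ring_nf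
  rw [this]; have := pow_pos h 2; linarith

/-- basic domain -/
def Bd (t : Fin 4 → ℝ) : Prop := 0 < t 1 ∧ 0 < t 2 ∧ 0 < t 3 ∧ t 3 < 2 * Real.pi

lemma Phi_D (t : Fin 4 → ℝ) : 8 * Phi t 0 * Phi t 2 - 3 * Phi t 1 ^ 2 =
    6 * t 2 ^ 2 * t 1 ^ 2 * (1 - Real.cos (t 3)) := by
  have := D_par (pA t) (pB t) (pC t) (t 0) (t 1)
  rw [(pABC t).2.2.2.1] at this
  simp only [Phi]; simp only [Matrix.cons_val]
  linarith

lemma pA_pos {t : Fin 4 → ℝ} (h : Bd t) : 0 < pA t := by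
  have := Real.neg_one_le_cos (t 3)
  have := h.2.1
  have : 0 < 3 + Real.cos (t 3) := by linarith
  unfold pA; positivity

lemma Phi_U4 {t : Fin 4 → ℝ} (h : Bd t) : Phi t ∈ U4 := by
  refine ⟨pA_pos h, ?_⟩
  rw [Phi_D]
  have := one_sub_cos_pos h.2.2.1 h.2.2.2
  have := h.1; have := h.2.1
  positivity

lemma Phi_es {t : Fin 4 → ℝ} (h : Bd t) : es (Phi t) = pe (pA t) (pB t) (pC t) (t 0) (t 1) := by
  have h1 := (Phi_U4 h).2
  have := J_par (pA t) (pB t) (pC t) (t 0) (t 1)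
  rw [(pABC t).1] at this
  unfold es
  rw [div_eq_iff (by positivity)]
  simp only [Phi]; simp only [Matrix.cons_val]
  linarith

lemma Phi_inj : Set.InjOn Phi {t | Bd t} := by
  intro t ht t' ht' h
  have he : pe (pA t) (pB t) (pC t) (t 0) (t 1) = pe (pA t') (pB t') (pC t') (t' 0) (t' 1) := by
    rw [← Phi_es ht, ← Phi_es ht', h]
  have q0 := congrFun h 0
  have q1 := congrFun h 1
  have q2 := congrFun h 2
  have q3 := congrFun h 3
  simp only [Phi] at q0 q1 q2 q3
  simp only [Matrix.cons_val] at q0 q1 q2 q3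
  have hs : 0 < t 2 := ht.2.1
  have hs' : 0 < t' 2 := ht'.2.1
  obtain ⟨ex, ey⟩ := bal_unique (A := pA t) (B := pB t) (C := pC t) (A' := pA t') (B' := pB t')
    (C' := pC t') (x := t 0) (x' := t' 0) ht.1 ht'.1 (by rw [(pABC t).2.1]; positivity) (pA_pos ht).ne' (by
      intro X Y; rw [← ev_par, ← ev_par, q1, q2, q3, he, q0])
  have hy : t 1 ≠ 0 := ht.1.ne'
  have eB : pB t = pB t' := by
    unfold pb at q1
    rw [← q0, ← ex, ← ey] at q1
    exact mul_right_cancel₀ hy (by linarith)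
  have eC : pC t = pC t' := by
    unfold pc at q2
    rw [← q0, ← ex, ← ey, ← eB] at q2
    exact mul_right_cancel₀ (pow_ne_zero 2 hy) (by linarith)
  have es : t 2 = t' 2 := by rw [← (pABC t).2.2.2.2, ← (pABC t').2.2.2.2, q0, eC]
  have ec : Real.cos (t 3) = Real.cos (t' 3) := by
    unfold pA at q0; rw [← es] at q0
    have := mul_left_cancel₀ hs.ne' (show t 2 * (3 + Real.cos (t 3)) = t 2 * (3 + Real.cos (t' 3)) by linarith)
    linarith
  have en : Real.sin (t 3) = Real.sin (t' 3) := by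
    unfold pB at eB; rw [← es] at eB
    exact mul_left_cancel₀ hs.ne' (by linarith)
  have eψ : t 3 = t' 3 := by
    have h1 : Real.cos (t 3 - t' 3) = 1 := by
      rw [Real.cos_sub, ec, en]; nlinarith [Real.sin_sq_add_cos_sq (t' 3)]
    have := ht.2.2; have := ht'.2.2
    have := (Real.cos_eq_one_iff_of_lt_of_lt (by linarith) (by linarith)).1 h1
    linarith
  ext i
  fin_cases i
  · exact ex
  · exact ey
  · exact es
  · exact eψ

lemma Phi_vol {C : ℝ} (hC : 0 < C) {S : Set (Fin 4 → ℝ)} (hS : MeasurableSet S) (hB : ∀ t ∈ S, Bd t) :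
    ∫⁻ m in Phi '' S, ENNReal.ofReal (rho C m) =
      ∫⁻ t in S, ENNReal.ofReal (4 * C / 9 * (t 1 ^ 2 * t 2)) := by
  rw [MeasureTheory.lintegral_image_eq_lintegral_abs_det_fderiv_mul MeasureTheory.volume hS
    (fun t _ => (Phi_deriv t).hasFDerivWithinAt) (Phi_inj.mono hB)]
  refine MeasureTheory.setLIntegral_congr_fun hS fun t ht => ?_
  have hc := one_sub_cos_pos (hB t ht).2.2.1 (hB t ht).2.2.2
  have hy := (hB t ht).1
  have hs := (hB t ht).2.1
  beta_reduce
  rw [← ENNReal.ofReal_mul (abs_nonneg _)]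
  congr 1
  have : (LinearMap.toContinuousLinearMap (Matrix.toLin' (PhiM t))).det = (PhiM t).det := by
    rw [← LinearMap.det_toLin']; rfl
  rw [this, PhiM_det, abs_neg, abs_of_pos (by positivity), rho, Phi_D]
  field_simp
  norm_num


open MeasureTheory in
lemma lint_succ (n : ℕ) {F : (Fin (n + 1) → ℝ) → ENNReal} (hF : Measurable F) :
    ∫⁻ t, F t = ∫⁻ x : ℝ, ∫⁻ u : Fin n → ℝ, F (Matrix.vecCons x u) := by
  have h := (volume_preserving_piFinSuccAbove (fun _ : Fin (n + 1) => ℝ) 0).symm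
  rw [← h.lintegral_comp hF, Measure.volume_eq_prod, lintegral_prod]
  · refine lintegral_congr fun x => lintegral_congr fun u => ?_
    congr 1
    simp [MeasurableEquiv.piFinSuccAbove, Fin.insertNthEquiv, Fin.insertNth_zero']
    rfl
  · exact (hF.comp h.measurable).aemeasurable

open MeasureTheory in
lemma lint4 {F : (Fin 4 → ℝ) → ENNReal} (hF : Measurable F) :
    ∫⁻ t, F t = ∫⁻ x : ℝ, ∫⁻ y : ℝ, ∫⁻ s : ℝ, ∫⁻ p : ℝ, F ![x, y, s, p] := by
  have hc : ∀ (n : ℕ) (x : ℝ), Measurable fun u : Fin n → ℝ => Matrix.vecCons x u := by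
    intro n x
    rw [measurable_pi_iff]; intro i
    refine Fin.cases ?_ (fun j => ?_) i
    · simp only [Matrix.cons_val_zero]; exact measurable_const
    · simp only [Matrix.cons_val_succ]; exact measurable_pi_apply j
  rw [lint_succ 3 hF]
  refine lintegral_congr fun x => ?_
  have h1 := hF.comp (hc 3 x)
  rw [show (∫⁻ u, F (Matrix.vecCons x u)) = _ from lint_succ 2 h1]
  refine lintegral_congr fun y => ?_
  have h2 := h1.comp (hc 2 y)
  refine (lint_succ 1 h2).trans (lintegral_congr fun s => ?_)
  have h3 := h2.comp (hc 1 s)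
  refine (lint_succ 0 h3).trans (lintegral_congr fun p => ?_)
  rw [lintegral_unique]
  have hv : (volume : Measure (Fin 0 → ℝ)) Set.univ = 1 := by
    rw [volume_pi, Measure.pi_of_empty]; simp
  rw [hv, mul_one]
  exact congrArg F (by ext i; fin_cases i <;> rfl)

/-- region with strict or weak inequalities `r` -/
def OO (r : ℝ → ℝ → Prop) : Set (Fin 4 → ℝ) := {t | (r 0 (t 0) ∧ r (t 0) (1 / 2)) ∧
  (0 < t 1 ∧ r 1 (t 0 ^ 2 + t 1 ^ 2)) ∧ (0 < t 2 ∧ r (12 * t 2 ^ 2 * t 1 ^ 4) 1) ∧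
  (0 < t 3 ∧ t 3 < 2 * Real.pi)}

lemma ae_btw {S : Set ℝ} {a b : ℝ} (h1 : Set.Ioo a b ⊆ S) (h2 : S ⊆ Set.Icc a b) :
    S =ᵐ[MeasureTheory.volume] Set.Ioc a b := by
  have h := MeasureTheory.Ioo_ae_eq_Icc (a := a) (b := b) (μ := MeasureTheory.volume)
  have h3 := MeasureTheory.Ioo_ae_eq_Ioc (a := a) (b := b) (μ := MeasureTheory.volume)
  exact (EventuallyLE.antisymm ((LE.le.eventuallyLE h2).trans h.symm.le)
    (LE.le.eventuallyLE h1)).trans h3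

lemma ae_btw' {S : Set ℝ} {a : ℝ} (h1 : Set.Ioi a ⊆ S) (h2 : S ⊆ Set.Ici a) :
    S =ᵐ[MeasureTheory.volume] Set.Ioi a := by
  have h := MeasureTheory.Ioi_ae_eq_Ici (a := a) (μ := MeasureTheory.volume)
  exact EventuallyLE.antisymm ((LE.le.eventuallyLE h2).trans h.symm.le)
    (LE.le.eventuallyLE h1)

open MeasureTheory in
lemma vol_val {C : ℝ} (hC : 0 < C) (r : ℝ → ℝ → Prop) (hr : ∀ a b, a < b → r a b)
    (hr' : ∀ a b, r a b → a ≤ b) (hm : MeasurableSet (OO r)) :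
    ∫⁻ t in OO r, ENNReal.ofReal (4 * C / 9 * (t 1 ^ 2 * t 2)) = ENNReal.ofReal (C * Real.pi ^ 2 / 162) := by
  have hpi := Real.pi_pos
  rw [← lintegral_indicator hm, lint4]
  swap
  · refine Measurable.indicator ?_ hm
    fun_prop
  -- the integral over `p`
  have e1 : ∀ x y s : ℝ, (∫⁻ p : ℝ, (OO r).indicator
      (fun t => ENNReal.ofReal (4 * C / 9 * (t 1 ^ 2 * t 2))) ![x, y, s, p]) =
      {s | (r 0 x ∧ r x (1 / 2)) ∧ (0 < y ∧ r 1 (x ^ 2 + y ^ 2)) ∧ (0 < s ∧ r (12 * s ^ 2 * y ^ 4) 1)}.indicator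
        (fun s => ENNReal.ofReal (8 * Real.pi * C / 9 * y ^ 2 * s)) s := by
    intro x y s
    by_cases h : (r 0 x ∧ r x (1 / 2)) ∧ (0 < y ∧ r 1 (x ^ 2 + y ^ 2)) ∧ (0 < s ∧ r (12 * s ^ 2 * y ^ 4) 1)
    · rw [Set.indicator_of_mem (by exact h)]
      have : ∀ p : ℝ, (OO r).indicator (fun t => ENNReal.ofReal (4 * C / 9 * (t 1 ^ 2 * t 2))) ![x, y, s, p] =
          (Set.Ioo 0 (2 * Real.pi)).indicator (fun _ => ENNReal.ofReal (4 * C / 9 * (y ^ 2 * s))) p := by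
        intro p
        by_cases hp : p ∈ Set.Ioo 0 (2 * Real.pi)
        · rw [Set.indicator_of_mem hp, Set.indicator_of_mem (by exact ⟨h.1, h.2.1, h.2.2, hp⟩)]; simp
        · rw [Set.indicator_of_notMem hp, Set.indicator_of_notMem (by exact fun q => hp q.2.2.2)]
      simp_rw [this]
      rw [lintegral_indicator measurableSet_Ioo, setLIntegral_const, Real.volume_Ioo,
        ← ENNReal.ofReal_mul (by have := h.2.2.1; positivity)]
      congr 1; ring
    · rw [Set.indicator_of_notMem (by exact h), ← lintegral_zero (μ := (volume : Measure ℝ))]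
      refine lintegral_congr fun p => Set.indicator_of_notMem (fun q => h ⟨q.1, q.2.1, q.2.2.1⟩) _
  simp_rw [e1]
  -- the integral over `s`
  have e2 : ∀ x y : ℝ, (∫⁻ s : ℝ, {s | (r 0 x ∧ r x (1 / 2)) ∧ (0 < y ∧ r 1 (x ^ 2 + y ^ 2)) ∧
      (0 < s ∧ r (12 * s ^ 2 * y ^ 4) 1)}.indicator
        (fun s => ENNReal.ofReal (8 * Real.pi * C / 9 * y ^ 2 * s)) s) =
      {y | (r 0 x ∧ r x (1 / 2)) ∧ (0 < y ∧ r 1 (x ^ 2 + y ^ 2))}.indicator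
        (fun y => ENNReal.ofReal (Real.pi * C / 27 * y ^ (-2 : ℝ))) y := by
    intro x y
    by_cases h : (r 0 x ∧ r x (1 / 2)) ∧ (0 < y ∧ r 1 (x ^ 2 + y ^ 2))
    · rw [Set.indicator_of_mem (by exact h)]
      have hy := h.2.1
      set M := √((12 * y ^ 4)⁻¹) with hM
      have hM2 : M ^ 2 = (12 * y ^ 4)⁻¹ := Real.sq_sqrt (by positivity)
      have hM0 : 0 < M := Real.sqrt_pos.2 (by positivity)
      have hk : 12 * M ^ 2 * y ^ 4 = 1 := by rw [hM2]; field_simp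
      have hae : {s | (r 0 x ∧ r x (1 / 2)) ∧ (0 < y ∧ r 1 (x ^ 2 + y ^ 2)) ∧ (0 < s ∧ r (12 * s ^ 2 * y ^ 4) 1)}
          =ᵐ[volume] Set.Ioc 0 M := by
        apply ae_btw
        · rintro s ⟨h0, h1⟩
          refine ⟨h.1, h.2, h0, hr _ _ ?_⟩
          rw [← hk]; gcongr
        · rintro s ⟨-, -, h0, h1⟩
          refine ⟨h0.le, ?_⟩
          have := hr' _ _ h1
          rw [← hk] at this
          by_contra hc
          push Not at hc
          have : 12 * M ^ 2 * y ^ 4 < 12 * s ^ 2 * y ^ 4 := by gcongr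
          linarith
      have hnm : NullMeasurableSet {s | (r 0 x ∧ r x (1 / 2)) ∧ (0 < y ∧ r 1 (x ^ 2 + y ^ 2)) ∧
          (0 < s ∧ r (12 * s ^ 2 * y ^ 4) 1)} volume :=
        measurableSet_Ioc.nullMeasurableSet.congr hae.symm
      rw [lintegral_indicator₀ hnm, setLIntegral_congr hae, ← ofReal_integral_eq_lintegral_ofReal]
      · rw [← intervalIntegral.integral_of_le hM0.le, intervalIntegral.integral_const_mul, integral_id, hM2,
          Real.rpow_neg hy.le]
        congr 1
        norm_num
        field_simp
        norm_num
      · exact (Continuous.integrableOn_Ioc (by fun_prop))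
      · refine (ae_restrict_iff' measurableSet_Ioc).2 (Eventually.of_forall fun s hs => ?_)
        have := hs.1
        simp only [Pi.zero_apply]; positivity
    · rw [Set.indicator_of_notMem (by exact h), ← lintegral_zero (μ := (volume : Measure ℝ))]
      refine lintegral_congr fun p => Set.indicator_of_notMem (fun q => h ⟨q.1, q.2.1⟩) _
  simp_rw [e2]
  -- the integral over `y`
  have e3 : ∀ x : ℝ, (∫⁻ y : ℝ, {y | (r 0 x ∧ r x (1 / 2)) ∧ (0 < y ∧ r 1 (x ^ 2 + y ^ 2))}.indicator
        (fun y => ENNReal.ofReal (Real.pi * C / 27 * y ^ (-2 : ℝ))) y) =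
      {x | r 0 x ∧ r x (1 / 2)}.indicator (fun x => ENNReal.ofReal (Real.pi * C / 27 * (1 / √(1 - x ^ 2)))) x := by
    intro x
    by_cases h : r 0 x ∧ r x (1 / 2)
    · rw [Set.indicator_of_mem (by exact h)]
      have hx0 := hr' _ _ h.1
      have hx1 := hr' _ _ h.2
      have hp : 0 < 1 - x ^ 2 := by nlinarith
      set M := √(1 - x ^ 2) with hM
      have hM2 : M ^ 2 = 1 - x ^ 2 := Real.sq_sqrt hp.le
      have hM0 : 0 < M := Real.sqrt_pos.2 hp
      have hae : {y | (r 0 x ∧ r x (1 / 2)) ∧ (0 < y ∧ r 1 (x ^ 2 + y ^ 2))} =ᵐ[volume] Set.Ioi M := by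
        apply ae_btw'
        · intro y hy
          have hy : M < y := hy
          refine ⟨h, hM0.trans hy, hr _ _ ?_⟩
          nlinarith
        · rintro y ⟨-, h0, h1⟩
          have := hr' _ _ h1
          exact (sq_le_sq₀ hM0.le h0.le).1 (by linarith)
      have hnm : NullMeasurableSet {y | (r 0 x ∧ r x (1 / 2)) ∧ (0 < y ∧ r 1 (x ^ 2 + y ^ 2))} volume :=
        measurableSet_Ioi.nullMeasurableSet.congr hae.symm
      rw [lintegral_indicator₀ hnm, setLIntegral_congr hae, ← ofReal_integral_eq_lintegral_ofReal]
      · rw [integral_const_mul, integral_Ioi_rpow_of_lt (by norm_num) hM0]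
        congr 1
        norm_num [Real.rpow_neg_one]
      · exact (integrableOn_Ioi_rpow_of_lt (by norm_num) hM0).const_mul _
      · refine (ae_restrict_iff' measurableSet_Ioi).2 (Eventually.of_forall fun s hs => ?_)
        have : 0 < s := hM0.trans hs
        simp only [Pi.zero_apply]; positivity
    · rw [Set.indicator_of_notMem (by exact h), ← lintegral_zero (μ := (volume : Measure ℝ))]
      refine lintegral_congr fun p => Set.indicator_of_notMem (fun q => h q.1) _
  simp_rw [e3]
  have hae : {x | r 0 x ∧ r x (1 / 2)} =ᵐ[volume] Set.Ioc 0 (1 / 2) :=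
    ae_btw (fun x hx => ⟨hr _ _ hx.1, hr _ _ hx.2⟩) (fun x hx => ⟨hr' _ _ hx.1, hr' _ _ hx.2⟩)
  have hnm : NullMeasurableSet {x | r 0 x ∧ r x (1 / 2)} volume :=
    measurableSet_Ioc.nullMeasurableSet.congr hae.symm
  have hcont : ContinuousOn (fun x : ℝ => 1 / √(1 - x ^ 2)) (Set.uIcc 0 (1 / 2)) := by
    refine ContinuousOn.div (by fun_prop) (by fun_prop) fun x hx => ?_
    rw [Set.uIcc_of_le (by norm_num)] at hx
    have : 0 < 1 - x ^ 2 := by nlinarith [hx.1, hx.2]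
    positivity
  rw [lintegral_indicator₀ hnm, setLIntegral_congr hae, ← ofReal_integral_eq_lintegral_ofReal]
  · rw [← intervalIntegral.integral_of_le (by norm_num), intervalIntegral.integral_const_mul,
      intervalIntegral.integral_eq_sub_of_hasDerivAt (f := Real.arcsin)]
    · have : Real.arcsin (1 / 2) = Real.pi / 6 := by
        rw [← Real.sin_pi_div_six]
        exact Real.arcsin_sin (by linarith) (by linarith)
      rw [this, Real.arcsin_zero]; congr 1; ring
    · intro x hx
      rw [Set.uIcc_of_le (by norm_num)] at hx
      exact Real.hasDerivAt_arcsin (by linarith [hx.1]) (by linarith [hx.2])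
    · exact hcont.intervalIntegrable
  · exact (hcont.intervalIntegrable (μ := volume)).1.const_mul _
  · refine (ae_restrict_iff' measurableSet_Ioc).2 (Eventually.of_forall fun s hs => ?_)
    simp only [Pi.zero_apply]; positivity

lemma OO_Bd {r : ℝ → ℝ → Prop} {t : Fin 4 → ℝ} (h : t ∈ OO r) : Bd t :=
  ⟨h.2.1.1, h.2.2.1.1, h.2.2.2.1, h.2.2.2.2⟩

lemma OO_lt_open : IsOpen (OO (· < ·)) := by
  unfold OO
  refine (IsOpen.and ?_ ?_).and ((IsOpen.and ?_ ?_).and ((IsOpen.and ?_ ?_).and (IsOpen.and ?_ ?_)))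
  all_goals exact isOpen_lt (by fun_prop) (by fun_prop)

lemma OO_le_meas : MeasurableSet (OO (· ≤ ·)) := by
  have h1 : IsClosed {t : Fin 4 → ℝ | (0 ≤ t 0 ∧ t 0 ≤ 1 / 2) ∧ 1 ≤ t 0 ^ 2 + t 1 ^ 2 ∧
      12 * t 2 ^ 2 * t 1 ^ 4 ≤ 1} := by
    refine (IsClosed.and ?_ ?_).and (IsClosed.and ?_ ?_)
    all_goals exact isClosed_le (by fun_prop) (by fun_prop)
  have h2 : IsOpen {t : Fin 4 → ℝ | (0 < t 1 ∧ 0 < t 2) ∧ 0 < t 3 ∧ t 3 < 2 * Real.pi} := by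
    refine (IsOpen.and ?_ ?_).and (IsOpen.and ?_ ?_)
    all_goals exact isOpen_lt (by fun_prop) (by fun_prop)
  convert h1.measurableSet.inter h2.measurableSet using 1
  ext t
  simp only [OO, Set.mem_inter_iff, Set.mem_ofPred_eq]
  tauto

lemma vol_lt {C : ℝ} (hC : 0 < C) : ∫⁻ m in Phi '' OO (· < ·), ENNReal.ofReal (rho C m) =
    ENNReal.ofReal (C * Real.pi ^ 2 / 162) := by
  rw [Phi_vol hC OO_lt_open.measurableSet fun t => OO_Bd,
    vol_val hC _ (fun _ _ h => h) (fun _ _ h => h.le) OO_lt_open.measurableSet]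

lemma vol_le {C : ℝ} (hC : 0 < C) : ∫⁻ m in Phi '' OO (· ≤ ·), ENNReal.ofReal (rho C m) =
    ENNReal.ofReal (C * Real.pi ^ 2 / 162) := by
  rw [Phi_vol hC OO_le_meas fun t => OO_Bd,
    vol_val hC _ (fun _ _ h => h.le) (fun _ _ h => h) OO_le_meas]


/-! ## Lower bound -/

lemma red_asymp {c ε : ℝ} (hc : 0 < c) (hε : 0 < ε) : ∀ᶠ T : ℝ in atTop,
    25 * (⌈c * T⌉₊ : ℝ) * (⌈c * T⌉₊ * (1 + Real.log ⌈c * T⌉₊)) ^ 2 ≤ ε * T ^ 4 := by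
  have h1 : (fun x : ℝ => 1 + Real.log x) =o[atTop] fun x => x ^ (1 / 2 : ℝ) := by
    refine Asymptotics.IsLittleO.add ?_ (isLittleO_log_rpow_atTop (by norm_num))
    refine (Asymptotics.isLittleO_const_left).2 (Or.inr ?_)
    exact (tendsto_norm_atTop_atTop.comp (tendsto_rpow_atTop (by norm_num)))
  have h2 := h1.pow (n := 2) (by norm_num)
  have hc2 : 0 < 2 * c := by positivity
  set k := ε / (25 * (2 * c) ^ 4) with hk
  have hk0 : 0 < k := by positivity
  have h3 := h2.bound hk0
  have ht : Tendsto (fun T : ℝ => 2 * c * T) atTop atTop := tendsto_id.const_mul_atTop hc2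
  filter_upwards [ht.eventually h3, eventually_ge_atTop (1 / c), eventually_gt_atTop 0] with T h hT hT0
  have hcT : 1 ≤ c * T := by rw [div_le_iff₀ hc] at hT; linarith
  have hN1 : (⌈c * T⌉₊ : ℝ) ≤ 2 * c * T := by
    have := Nat.ceil_lt_add_one (show 0 ≤ c * T by linarith); linarith
  have hN0 : 1 ≤ (⌈c * T⌉₊ : ℝ) := hcT.trans (Nat.le_ceil _)
  have hlog : Real.log ⌈c * T⌉₊ ≤ Real.log (2 * c * T) := Real.log_le_log (by linarith) hN1
  have hlog0 : 0 ≤ Real.log ⌈c * T⌉₊ := Real.log_nonneg hN0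
  rw [Real.norm_of_nonneg (by positivity), Real.norm_of_nonneg (by positivity),
    ← Real.rpow_natCast, ← Real.rpow_natCast, ← Real.rpow_mul (by positivity)] at h
  norm_num at h
  calc _ ≤ 25 * (2 * c * T) * ((2 * c * T) * (1 + Real.log (2 * c * T))) ^ 2 := by gcongr
    _ = 25 * (2 * c * T) ^ 3 * (1 + Real.log (2 * c * T)) ^ 2 := by ring
    _ ≤ 25 * (2 * c * T) ^ 3 * (k * (2 * c * T)) := by gcongr
    _ = ε * T ^ 4 := by rw [hk]; field_simp

open MeasureTheory in
lemma exists_compact_lower {C ε : ℝ} (hC : 0 < C) (hε : 0 < ε) : ∃ K ⊆ Phi '' OO (· < ·), IsCompact K ∧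
    ENNReal.ofReal (C * Real.pi ^ 2 / 162 - ε) < ∫⁻ m in K, ENNReal.ofReal (rho C m) := by
  obtain ⟨F, hF1, hF2, hF3, hF4⟩ := OO_lt_open.exists_iUnion_isClosed
  have hF2 : ∀ n, F n ⊆ OO (· < ·) := hF2
  set g : (Fin 4 → ℝ) → ENNReal := fun t => ENNReal.ofReal (4 * C / 9 * (t 1 ^ 2 * t 2)) with hg
  set Kn : ℕ → Set (Fin 4 → ℝ) := fun n => F n ∩ Metric.closedBall 0 n with hKn
  have hKc : ∀ n, IsCompact (Kn n) := fun n => (isCompact_closedBall 0 (n : ℝ)).inter_left (hF1 n)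
  have hmono : Monotone Kn := fun i j hij => Set.inter_subset_inter (hF4 hij)
    (Metric.closedBall_subset_closedBall (by exact_mod_cast hij))
  have hU : ⋃ n, Kn n = OO (· < ·) := by
    refine Set.Subset.antisymm (Set.iUnion_subset fun n => Set.inter_subset_left.trans (hF2 n)) ?_
    intro t ht
    rw [← hF3, Set.mem_iUnion] at ht
    obtain ⟨i, hi⟩ := ht
    obtain ⟨j, hj⟩ := exists_nat_ge ‖t‖
    refine Set.mem_iUnion.2 ⟨max i j, hF4 (le_max_left _ _) hi, ?_⟩
    rw [mem_closedBall_zero_iff]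
    exact hj.trans (by exact_mod_cast le_max_right _ _)
  have ht := tendsto_measure_iUnion_atTop (μ := volume.withDensity g) hmono
  rw [hU, withDensity_apply _ OO_lt_open.measurableSet] at ht
  rw [vol_val hC _ (fun _ _ h => h) (fun _ _ h => h.le) OO_lt_open.measurableSet] at ht
  have hV : 0 < C * Real.pi ^ 2 / 162 := by have := Real.pi_pos; positivity
  obtain ⟨n, hn⟩ := (ht.eventually_const_lt (u := ENNReal.ofReal (C * Real.pi ^ 2 / 162 - ε))
    ((ENNReal.ofReal_lt_ofReal_iff hV).2 (by linarith))).exists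
  have hsub : Kn n ⊆ OO (· < ·) := Set.inter_subset_left.trans (hF2 n)
  refine ⟨Phi '' Kn n, Set.image_mono hsub, (hKc n).image ?_, ?_⟩
  · exact continuous_iff_continuousAt.2 fun t => (Phi_deriv t).continuousAt
  · rw [Phi_vol hC (hKc n).measurableSet fun t ht => OO_Bd (hsub ht)]
    simpa [withDensity_apply _ (hKc n).measurableSet] using hn

/-- lift to five coefficients -/
def lift5 (m : Fin 4 → ℝ) (e : ℝ) : Fin 5 → ℝ := ![m 0, m 1, m 2, m 3, e]

lemma es_cont : ContinuousOn es U4 := by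
  unfold es
  refine ContinuousOn.div (by fun_prop) (by fun_prop) ?_
  intro m hm
  have := hm.2
  positivity

lemma lift_cont : ContinuousOn (fun m => lift5 m (es m)) U4 := by
  unfold lift5
  rw [continuousOn_pi]
  intro i
  fin_cases i
  · exact (continuous_apply 0).continuousOn
  · exact (continuous_apply 1).continuousOn
  · exact (continuous_apply 2).continuousOn
  · exact (continuous_apply 3).continuousOn
  · exact es_cont

def GG : Set (Fin 4 → ℝ) := U4 ∩ (fun m => lift5 m (es m)) ⁻¹' Om5

lemma GG_open : IsOpen GG := lift_cont.isOpen_inter_preimage isOpen_U4 isOpen_Om5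

lemma Phi_GG : Phi '' OO (· < ·) ⊆ GG := by
  rintro _ ⟨t, ht, rfl⟩
  have hb := OO_Bd ht
  obtain ⟨⟨h1, h2⟩, ⟨h3, h4⟩, ⟨h5, h6⟩, -⟩ := ht
  refine ⟨Phi_U4 hb, ![pA t, pB t, pC t, t 0, t 1], ⟨pA_pos hb, ?_, h1, h2, h4, h3, ?_⟩, ?_⟩
  · show 0 < 8 * pA t ^ 2 + 4 * pA t * pC t - pB t ^ 2
    rw [(pABC t).2.1]; positivity
  · show (12 * pA t ^ 2 + 3 * pB t ^ 2 + pC t ^ 2) * t 1 ^ 4 < 1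
    rw [(pABC t).2.2.1]; exact h6
  · show Psi _ = lift5 (Phi t) (es (Phi t))
    rw [Phi_es hb]
    ext i; fin_cases i <;> rfl

lemma q_close {C T : ℝ} (hT : 0 < T) {f : BQF} (hm : f.q T ∈ U4) (hJ : |(f.J : ℝ)| < C * T ^ 2) :
    |(f.e : ℝ) / T - es (f.q T)| < C / (9 * (8 * f.q T 0 * f.q T 2 - 3 * f.q T 1 ^ 2) * T) := by
  have hD := hm.2
  have e0 : f.q T 0 = f.a / T := rfl
  have e1 : f.q T 1 = f.b / T := rfl
  have e2 : f.q T 2 = f.c / T := rfl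
  have e3 : f.q T 3 = f.d / T := rfl
  have hDf : 8 * (f.a : ℝ) * f.c - 3 * (f.b : ℝ) ^ 2 = T ^ 2 * (8 * f.q T 0 * f.q T 2 - 3 * f.q T 1 ^ 2) := by
    rw [e0, e1, e2]; field_simp
  set D := 8 * f.q T 0 * f.q T 2 - 3 * f.q T 1 ^ 2 with hDdef
  have hDp : 0 < 8 * (f.a : ℝ) * f.c - 3 * (f.b : ℝ) ^ 2 := by rw [hDf]; positivity
  rw [BQF.J_cast] at hJ
  have h := (J_small_iff C T f.a f.b f.c f.d f.e hDp).1 hJ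
  rw [hDf] at h
  have hes : (27 * (f.a : ℝ) * (f.d : ℝ) ^ 2 - 9 * f.b * f.c * f.d + 2 * (f.c : ℝ) ^ 3) / (9 * (T ^ 2 * D)) =
      T * es (f.q T) := by
    rw [es, ← hDdef, e0, e1, e2, e3]; field_simp
  rw [hes] at h
  rw [show (f.e : ℝ) / T - es (f.q T) = (f.e - T * es (f.q T)) / T by field_simp, abs_div, abs_of_pos hT,
    div_lt_iff₀ hT]
  refine h.trans_eq ?_
  field_simp

lemma rho_integrable (C : ℝ) {K : Set (Fin 4 → ℝ)} (hK : IsCompact K) (hU : K ⊆ U4) :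
    MeasureTheory.IntegrableOn (rho C) K := ((rho_cont C).mono hU).integrableOn_compact hK

lemma rho_nonneg {C : ℝ} (hC : 0 < C) {m : Fin 4 → ℝ} (hm : m ∈ U4) : 0 ≤ rho C m := by
  have := hm.2; unfold rho; positivity

open MeasureTheory in
lemma rho_lint {C : ℝ} (hC : 0 < C) {Q K : Set (Fin 4 → ℝ)} (hQ : MeasurableSet Q) (hK : IsCompact K)
    (hQK : Q ⊆ K) (hU : K ⊆ U4) :
    ENNReal.ofReal (∫ m in Q, rho C m) = ∫⁻ m in Q, ENNReal.ofReal (rho C m) := by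
  rw [ofReal_integral_eq_lintegral_ofReal]
  · exact (rho_integrable C hK hU).mono_set hQK
  · exact (ae_restrict_iff' hQ).2 (Eventually.of_forall fun m hm => rho_nonneg hC (hU (hQK hm)))

lemma lower_bound {C ε : ℝ} (hC : 0 < C) (hε : 0 < ε) : ∀ᶠ T : ℝ in atTop, ∃ S : Finset BQF,
    (∀ f ∈ S, f.SR ∧ f.Irred ∧ (f.I : ℝ) < T ^ 2 ∧ |(f.J : ℝ)| < C * T ^ 2) ∧
    (C * Real.pi ^ 2 / 162 - ε) * T ^ 4 ≤ S.card := by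
  classical
  obtain ⟨K, hKO, hKc, hKv⟩ := exists_compact_lower hC (show 0 < ε / 3 by positivity)
  obtain ⟨Q, K1, hQm, hKQ, hQK1, hK1c, hK1G, hev⟩ := count_compact C hC K GG hKc GG_open
    (hKO.trans Phi_GG) Set.inter_subset_left (ε / 3) (by positivity)
  have hK1U : K1 ⊆ U4 := hK1G.trans Set.inter_subset_left
  have hint : C * Real.pi ^ 2 / 162 - ε / 3 ≤ ∫ m in Q, rho C m := by
    by_contra hc
    push Not at hc
    have h1 := ENNReal.ofReal_le_ofReal hc.le
    rw [rho_lint hC hQm hK1c hQK1 hK1U] at h1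
    exact absurd (hKv.trans_le (MeasureTheory.lintegral_mono_set hKQ)) (not_lt.2 h1)
  -- thickening of the graph
  have hΓc : IsCompact ((fun m => lift5 m (es m)) '' K1) := hK1c.image_of_continuousOn (lift_cont.mono hK1U)
  obtain ⟨δ, hδ, hδO⟩ := hΓc.exists_thickening_subset_open isOpen_Om5
    (by rintro _ ⟨m, hm, rfl⟩; exact (hK1G hm).2)
  obtain ⟨d0, hd0, hd⟩ : ∃ d0 > 0, ∀ m ∈ K1, d0 ≤ 8 * m 0 * m 2 - 3 * m 1 ^ 2 := by
    rcases K1.eq_empty_or_nonempty with h | h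
    · exact ⟨1, one_pos, by simp [h]⟩
    · obtain ⟨m, hm, hmin⟩ := hK1c.exists_isMinOn h (f := fun m => 8 * m 0 * m 2 - 3 * m 1 ^ 2) (by fun_prop)
      exact ⟨_, (hK1U hm).2, fun m' hm' => hmin hm'⟩
  obtain ⟨R, hR⟩ := hΓc.isBounded.exists_norm_le
  have hc : 0 < |R| + δ := by positivity
  filter_upwards [hev, red_asymp hc (show 0 < ε / 3 by positivity), eventually_gt_atTop 0,
    eventually_gt_atTop (C / (9 * d0 * δ))] with T hT hred hT0 hTδ
  obtain ⟨hfin, hcard⟩ := hT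
  have hclose : ∀ f ∈ LS C T Q, |(f.e : ℝ) / T - es (f.q T)| < δ := by
    rintro f ⟨hq, hJ⟩
    refine (q_close hT0 (hK1U (hQK1 hq)) hJ).trans_le ?_
    have hD := hd _ (hQK1 hq)
    set D := 8 * f.q T 0 * f.q T 2 - 3 * f.q T 1 ^ 2
    have hDp : 0 < D := hd0.trans_le hD
    rw [div_lt_iff₀ (by positivity)] at hTδ
    rw [div_le_iff₀ (by positivity)]
    have : T * (9 * d0 * δ) ≤ δ * (9 * D * T) := by
      have : d0 * (9 * T * δ) ≤ D * (9 * T * δ) := by gcongr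
      linarith
    linarith
  have hOm : ∀ f ∈ LS C T Q, f.SR ∧ (f.I : ℝ) < T ^ 2 := by
    intro f hf
    refine Om5_SR hT0 (hδO (Metric.mem_thickening_iff.2 ⟨_, ⟨f.q T, hQK1 hf.1, rfl⟩, ?_⟩))
    rw [dist_pi_lt_iff hδ]
    intro i
    fin_cases i
    · simpa [lift5, BQF.q] using hδ
    · simpa [lift5, BQF.q] using hδ
    · simpa [lift5, BQF.q] using hδ
    · simpa [lift5, BQF.q] using hδ
    · simpa [lift5, Real.dist_eq] using hclose f hf
  refine ⟨hfin.toFinset.filter fun f => f.Irred, ?_, ?_⟩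
  · intro f hf
    rw [Finset.mem_filter, Set.Finite.mem_toFinset] at hf
    exact ⟨(hOm f hf.1).1, hf.2, (hOm f hf.1).2, hf.1.2⟩
  · have h1 := reducible_count ⌈(|R| + δ) * T⌉₊ (hfin.toFinset.filter fun f => ¬ f.Irred) (by
      intro f hf
      rw [Finset.mem_filter, Set.Finite.mem_toFinset] at hf
      have hn := hR _ ⟨f.q T, hQK1 hf.1.1, rfl⟩
      have n0 := (norm_le_pi_norm _ 0).trans hn
      have n4 := (norm_le_pi_norm _ 4).trans hn
      simp only [lift5, Real.norm_eq_abs] at n0 n4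
      have n0 : |(f.a : ℝ) / T| ≤ R := n0
      have n4 : |es (f.q T)| ≤ R := n4
      have hcl := (abs_lt.1 (hclose f hf.1)).2
      have b1 : (f.a : ℝ) ≤ (|R| + δ) * T := by
        rw [← div_le_iff₀ hT0]; linarith [le_abs_self ((f.a : ℝ) / T), le_abs_self R]
      have b2 : (f.e : ℝ) ≤ (|R| + δ) * T := by
        rw [← div_le_iff₀ hT0]; linarith [le_abs_self (es (f.q T)), le_abs_self R]
      refine ⟨(hOm f hf.1).1.pd, hf.2, ?_, ?_⟩
      · have := b1.trans (Nat.le_ceil _); exact_mod_cast this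
      · have := b2.trans (Nat.le_ceil _); exact_mod_cast this)
    have h2 := Finset.card_filter_add_card_filter_not (s := hfin.toFinset) (fun f => f.Irred)
    rw [Set.ncard_eq_toFinset_card _ hfin] at hcard
    have h3 := (abs_le.1 hcard).1
    have h4 : (C * Real.pi ^ 2 / 162 - ε / 3) * T ^ 4 ≤ (∫ m in Q, rho C m) * T ^ 4 := by gcongr
    have h2' : ((hfin.toFinset.filter fun f => f.Irred).card : ℝ) +
      ((hfin.toFinset.filter fun f => ¬ f.Irred).card : ℝ) = hfin.toFinset.card := by exact_mod_cast h2
    linarith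


/-! ## Upper bound -/

lemma finite_of_bound {α : Type*} {X : Set α} {B : ℝ} (h : ∀ S : Finset α, (S : Set α) ⊆ X → (S.card : ℝ) ≤ B) :
    ∃ S : Finset α, (∀ f ∈ X, f ∈ S) ∧ (S.card : ℝ) ≤ B := by
  have hfin : X.Finite := by
    by_contra hc
    obtain ⟨t, ht, hcard⟩ := Set.Infinite.exists_subset_card_eq hc (⌈B⌉₊ + 1)
    have h1 := h t ht
    rw [hcard] at h1
    push_cast at h1
    linarith [Nat.le_ceil B]
  exact ⟨hfin.toFinset, fun f hf => by simpa using hf, h _ (by simp)⟩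

lemma shift_red (g : BQF) (ha : 0 < g.a) : ∃ g' : BQF, BQF.Equivalent g g' ∧ g'.a = g.a ∧ 0 ≤ g'.b ∧
    g'.b < 4 * g'.a ∧ 8 * g'.a * g'.c - 3 * g'.b ^ 2 = 8 * g.a * g.c - 3 * g.b ^ 2 := by
  set k := -(g.b / (4 * g.a)) with hk
  have e1 : (g.tr 1 0 k 1).a = g.a := by simp [BQF.tr, BQF.evalZ]
  have e2 : (g.tr 1 0 k 1).b = g.b % (4 * g.a) := by
    rw [Int.emod_def]; simp [BQF.tr, hk]; ring
  refine ⟨g.tr 1 0 k 1, g.tr_equiv 1 0 k 1 (by simp), e1, ?_, ?_, ?_⟩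
  · rw [e2]; exact Int.emod_nonneg _ (by positivity)
  · rw [e1, e2]; exact Int.emod_lt_of_pos _ (by positivity)
  · simp [BQF.tr, BQF.evalZ]; ring

lemma cusp_ev {l : ℝ} (hl : 0 < l) : ∀ᶠ T : ℝ in atTop,
    √(l * T + 1) + 1 + Real.log (T + 2) ≤ 3 * √l * √T := by
  have h1 : (fun x : ℝ => 1 + Real.log x) =o[atTop] fun x => x ^ (1 / 2 : ℝ) := by
    refine Asymptotics.IsLittleO.add ?_ (isLittleO_log_rpow_atTop (by norm_num))
    refine (Asymptotics.isLittleO_const_left).2 (Or.inr ?_)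
    exact (tendsto_norm_atTop_atTop.comp (tendsto_rpow_atTop (by norm_num)))
  have hk : 0 < √l / 2 := by positivity
  have ht : Tendsto (fun T : ℝ => T + 2) atTop atTop := tendsto_atTop_add_const_right _ _ tendsto_id
  filter_upwards [ht.eventually (h1.bound hk), eventually_ge_atTop (1 / l), eventually_ge_atTop 2] with T h hT hT1
  rw [← Real.sqrt_eq_rpow, Real.norm_of_nonneg (Real.sqrt_nonneg _)] at h
  have h2 : 1 + Real.log (T + 2) ≤ √l / 2 * √(T + 2) := (le_abs_self _).trans h
  have h3 : √(T + 2) ≤ 2 * √T := by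
    rw [Real.sqrt_le_left (by positivity), mul_pow, Real.sq_sqrt (by linarith)]; linarith
  have h4 : √(l * T + 1) ≤ 2 * (√l * √T) := by
    rw [div_le_iff₀ hl] at hT
    rw [← Real.sqrt_mul hl.le, Real.sqrt_le_left (by positivity), mul_pow, Real.sq_sqrt (by positivity)]
    linarith
  have h5 : √l / 2 * √(T + 2) ≤ √l / 2 * (2 * √T) := by gcongr
  linarith

/-- cusp forms are covered by few representatives -/
def Cusp (C T A l : ℝ) (f : BQF) : Prop := f.PDf ∧ (f.a : ℝ) ≤ A ∧ (f.I : ℝ) < T ^ 2 ∧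
  |(f.J : ℝ)| ≤ C * T ^ 2 ∧ 8 * (f.a : ℝ) * f.c - 3 * (f.b : ℝ) ^ 2 ≤ 8 * f.a * l * T

lemma cusp_cover {C : ℝ} (hC : 0 < C) : ∃ K, 0 < K ∧ ∀ T A l, 1 ≤ T → 1 ≤ A → A ≤ T → 0 ≤ l →
    ∃ S : Finset BQF, (∀ f, Cusp C T A l f → ∃ g ∈ S, BQF.Equivalent f g) ∧
    (S.card : ℝ) ≤ K * T ^ 3 * √A * (√(l * T + 1) + 1 + Real.log (T + 2)) := by
  obtain ⟨K, hK, h⟩ := cusp_count C hC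
  refine ⟨K, hK, fun T A l h1 h2 h3 h4 => ?_⟩
  obtain ⟨S, hS, hc⟩ := finite_of_bound (X := {f : BQF | f.PDf ∧ (f.a : ℝ) ≤ A ∧ 0 ≤ f.b ∧ f.b < 4 * f.a ∧
    (f.I : ℝ) < T ^ 2 ∧ |(f.J : ℝ)| ≤ C * T ^ 2 ∧ 8 * (f.a : ℝ) * f.c - 3 * (f.b : ℝ) ^ 2 ≤ 8 * f.a * l * T})
    (fun S hS => h T A l h1 h2 h3 h4 S fun f hf => hS hf)
  refine ⟨S, fun f ⟨c1, c2, c3, c4, c5⟩ => ?_, hc⟩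
  have ha : 0 < f.a := by exact_mod_cast (pd_ineq c1).1
  obtain ⟨g, g1, g2, g3, g4, g5⟩ := shift_red f ha
  refine ⟨g, hS g ⟨BQF.equiv_PD g1 c1, by rw [g2]; exact c2, g3, g4, ?_, ?_, ?_⟩, g1⟩
  · rw [BQF.equiv_I g1]; exact c3
  · rw [BQF.equiv_J g1]; exact c4
  · rw [g2] at g5 ⊢
    have : 8 * (g.a : ℝ) * g.c - 3 * (g.b : ℝ) ^ 2 = 8 * f.a * f.c - 3 * (f.b : ℝ) ^ 2 := by
      rw [g2]; exact_mod_cast g5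
    rw [g2] at this
    linarith

lemma exists_angle {u v : ℝ} (h : u ^ 2 + v ^ 2 = 1) (hu : u < 1) :
    ∃ ψ, 0 < ψ ∧ ψ < 2 * Real.pi ∧ Real.cos ψ = u ∧ Real.sin ψ = v := by
  have hpi := Real.pi_pos
  have hu1 : -1 ≤ u := by nlinarith
  have h0 := Real.arccos_pos.2 hu
  have h1 := Real.arccos_le_pi u
  have hc := Real.cos_arccos hu1 hu.le
  have hs : Real.sin (Real.arccos u) = |v| := by
    rw [Real.sin_arccos, show 1 - u ^ 2 = v ^ 2 by linarith, Real.sqrt_sq_eq_abs]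
  rcases le_total 0 v with hv | hv
  · exact ⟨Real.arccos u, h0, by linarith, hc, by rw [hs, abs_of_nonneg hv]⟩
  · refine ⟨2 * Real.pi - Real.arccos u, by linarith, by linarith, ?_, ?_⟩
    · rw [Real.cos_two_pi_sub, hc]
    · rw [Real.sin_two_pi_sub, hs, abs_of_nonpos hv, neg_neg]

/-- compact parameter sets for the main body -/
def Ps (κ δ s : ℝ) : Set (Fin 5 → ℝ) := {p | κ ≤ p 0 ∧ δ ≤ p 4 ^ 2 * (8 * p 0 * p 2 - 3 * p 1 ^ 2) ∧
  (12 * p 0 ^ 2 + 3 * p 1 ^ 2 + p 2 ^ 2) * p 4 ^ 4 ≤ 1 ∧ |p 4 ^ 6 * ((6 * p 0 + p 2) *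
    (12 * p 0 * p 2 - 2 * p 2 ^ 2 - 9 * p 1 ^ 2))| ≤ s ∧ 0 ≤ p 3 ∧ p 3 ≤ 1 / 2 ∧
  1 ≤ p 3 ^ 2 + p 4 ^ 2 ∧ 0 ≤ p 4}

/-- projection to the first four coefficients -/
noncomputable def prj (p : Fin 5 → ℝ) : Fin 4 → ℝ :=
  ![p 0, pb (p 0) (p 1) (p 3) (p 4), pc (p 0) (p 1) (p 2) (p 3) (p 4), pd (p 0) (p 1) (p 2) (p 3) (p 4)]

lemma prj_cont : Continuous prj := by
  unfold prj pb pc pd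
  refine continuous_pi fun i => ?_
  fin_cases i
  · exact continuous_apply 0
  all_goals simp only [Fin.reduceFinMk, Matrix.cons_val]; fun_prop

lemma y_bd {x y : ℝ} (h1 : 0 ≤ x) (h2 : x ≤ 1 / 2) (h3 : 1 ≤ x ^ 2 + y ^ 2) : 1 / 2 ≤ y ^ 4 := by
  have : 3 / 4 ≤ y ^ 2 := by nlinarith
  nlinarith

lemma Ps_compact {κ δ s : ℝ} (hκ : 0 < κ) : IsCompact (Ps κ δ s) := by
  refine Metric.isCompact_of_isClosed_isBounded ?_ ?_
  · unfold Ps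
    iterate 7 refine IsClosed.and (isClosed_le (by fun_prop) (by fun_prop)) ?_
    exact isClosed_le (by fun_prop) (by fun_prop)
  · rw [isBounded_iff_forall_norm_le]
    refine ⟨2 + 1 / κ, ?_⟩
    rintro p ⟨h1, -, h2, -, h3, h4, h5, h6⟩
    have hy := y_bd h3 h4 h5
    have hk : 0 < 1 / κ := by positivity
    have hS : 12 * p 0 ^ 2 + 3 * p 1 ^ 2 + p 2 ^ 2 ≤ 2 := by
      have : 0 ≤ 12 * p 0 ^ 2 + 3 * p 1 ^ 2 + p 2 ^ 2 := by positivity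
      nlinarith
    rw [pi_norm_le_iff_of_nonneg (by positivity)]
    have b0 : |p 0| ≤ 2 := abs_le_of_sq_le_sq (by nlinarith [sq_nonneg (p 1), sq_nonneg (p 2)]) (by norm_num)
    have b1 : |p 1| ≤ 2 := abs_le_of_sq_le_sq (by nlinarith [sq_nonneg (p 0), sq_nonneg (p 2)]) (by norm_num)
    have b2 : |p 2| ≤ 2 := abs_le_of_sq_le_sq (by nlinarith [sq_nonneg (p 0), sq_nonneg (p 1)]) (by norm_num)
    have b4 : |p 4| ≤ 2 + 1 / κ := by
      rw [abs_of_nonneg h6]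
      have hy2 : κ * p 4 ^ 2 ≤ 1 := by
        have : (κ * p 4 ^ 2) ^ 2 ≤ 1 ^ 2 := by
          have : κ ^ 2 * p 4 ^ 4 ≤ p 0 ^ 2 * p 4 ^ 4 := by gcongr
          have : 0 ≤ (11 * p 0 ^ 2 + 3 * p 1 ^ 2 + p 2 ^ 2) * p 4 ^ 4 := by positivity
          nlinarith
        exact (sq_le_sq₀ (by positivity) (by norm_num)).1 this
      have : p 4 ^ 2 ≤ 1 / κ := by rw [le_div_iff₀ hκ]; linarith
      nlinarith [sq_nonneg (p 4 - 1)]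
    intro i
    rw [Real.norm_eq_abs]
    fin_cases i
    · exact b0.trans (by linarith)
    · exact b1.trans (by linarith)
    · exact b2.trans (by linarith)
    · show |p 3| ≤ _
      rw [abs_of_nonneg h3]; linarith
    · exact b4

lemma Ps_U4 {κ δ s : ℝ} (hκ : 0 < κ) (hδ : 0 < δ) {p : Fin 5 → ℝ} (hp : p ∈ Ps κ δ s) : prj p ∈ U4 := by
  refine ⟨hκ.trans_le hp.1, ?_⟩
  have := D_par (p 0) (p 1) (p 2) (p 3) (p 4)
  have h2 := hp.2.1
  simp only [prj]; simp only [Matrix.cons_val]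
  linarith

lemma P0_sub {κ δ : ℝ} (hκ : 0 < κ) (hδ : 0 < δ) : prj '' Ps κ δ 0 ⊆ Phi '' OO (· ≤ ·) := by
  rintro _ ⟨p, ⟨h1, h2, h3, h4, h5, h6, h7, h8⟩, rfl⟩
  have hA : 0 < p 0 := hκ.trans_le h1
  have hy : 0 < p 4 := by
    rcases h8.lt_or_eq with h | h
    · exact h
    · rw [← h] at h2; norm_num at h2; linarith
  have hD : 0 < 8 * p 0 * p 2 - 3 * p 1 ^ 2 := by
    have := hδ.trans_le h2
    exact pos_of_mul_pos_right this (by positivity)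
  have hC : 0 < p 2 := by
    have : 0 < (8 * p 0) * p 2 := by nlinarith [sq_nonneg (p 1)]
    exact pos_of_mul_pos_right this (by positivity)
  have hJ : 12 * p 0 * p 2 - 2 * p 2 ^ 2 - 9 * p 1 ^ 2 = 0 := by
    have := abs_nonpos_iff.1 h4
    rcases mul_eq_zero.1 this with h | h
    · exact absurd h (by positivity)
    · rcases mul_eq_zero.1 h with h | h
      · exact absurd h (by positivity)
      · exact h
  set s := p 0 + p 2 / 6 with hs
  have hs0 : 0 < s := by positivity
  obtain ⟨ψ, q1, q2, q3, q4⟩ := exists_angle (u := (p 0 - p 2 / 2) / s) (v := -(p 1 / s))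
    (by field_simp; rw [hs]; linear_combination (-4 / 9) * hJ)
    (by rw [div_lt_one hs0, hs]; linarith)
  set t : Fin 4 → ℝ := ![p 3, p 4, s, ψ] with ht
  have eA : pA t = p 0 := by
    show s * (3 + Real.cos ψ) / 4 = p 0
    rw [q3]; field_simp; rw [hs]; ring
  have eB : pB t = p 1 := by
    show -(s * Real.sin ψ) = p 1
    rw [q4]; field_simp
  have eC : pC t = p 2 := by
    show 3 / 2 * s * (1 - Real.cos ψ) = p 2
    rw [q3]; field_simp; rw [hs]; ring
  refine ⟨t, ⟨⟨h5, h6⟩, ⟨hy, h7⟩, ⟨hs0, ?_⟩, q1, q2⟩, ?_⟩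
  · rw [← (pABC t).2.2.1, eA, eB, eC]; exact h3
  · unfold Phi; rw [eA, eB, eC]; rfl


open MeasureTheory in
lemma exists_thick {C ε : ℝ} (hC : 0 < C) (hε : 0 < ε) {K : Set (Fin 4 → ℝ)} (hK : IsCompact K) (hU : K ⊆ U4)
    (hO : K ⊆ Phi '' OO (· ≤ ·)) : ∃ r, 0 < r ∧ Metric.cthickening r K ⊆ U4 ∧
    ∫⁻ m in Metric.cthickening r K, ENNReal.ofReal (rho C m) ≤
      ENNReal.ofReal (C * Real.pi ^ 2 / 162 + ε) := by
  obtain ⟨R, hR, hRU⟩ := hK.exists_cthickening_subset_open isOpen_U4 hU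
  set μ : Measure (Fin 4 → ℝ) := volume.withDensity fun m => ENNReal.ofReal (rho C m) with hμ
  have hμa : ∀ s, MeasurableSet s → μ s = ∫⁻ m in s, ENNReal.ofReal (rho C m) :=
    fun s hs => withDensity_apply _ hs
  have hm : ∀ r, MeasurableSet (Metric.cthickening r K) := fun r => Metric.isClosed_cthickening.measurableSet
  have hlim := tendsto_measure_cthickening_of_isClosed (μ := μ) (s := K) ⟨R, hR, by
    rw [hμa _ (hm R), ← rho_lint hC (hm R) hK.cthickening subset_rfl hRU]
    exact ENNReal.ofReal_ne_top⟩ hK.isClosed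
  have hlt : μ K < ENNReal.ofReal (C * Real.pi ^ 2 / 162 + ε) := by
    rw [hμa _ hK.measurableSet]
    refine (lintegral_mono_set hO).trans_lt ?_
    rw [vol_le hC]
    exact (ENNReal.ofReal_lt_ofReal_iff (by positivity)).2 (by linarith)
  have h1 := hlim.eventually_lt_const hlt
  obtain ⟨r, h2, h3, h4⟩ := (((h1.filter_mono nhdsWithin_le_nhds).and
    (Ioo_mem_nhdsGT hR)).exists : ∃ r, _ ∧ r ∈ Set.Ioo 0 R)
  refine ⟨r, h3, (Metric.cthickening_mono h4.le K).trans hRU, ?_⟩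
  rw [← hμa _ (hm r)]; exact h2.le

lemma exists_s {κ δ : ℝ} (hκ : 0 < κ) {W : Set (Fin 4 → ℝ)} (hW : IsOpen W) (hP : prj '' Ps κ δ 0 ⊆ W) :
    ∃ s, 0 < s ∧ prj '' Ps κ δ s ⊆ W := by
  have hc : IsCompact (Ps κ δ 1 \ prj ⁻¹' W) := (Ps_compact hκ).diff (hW.preimage prj_cont)
  set F : (Fin 5 → ℝ) → ℝ := fun p => |p 4 ^ 6 * ((6 * p 0 + p 2) * (12 * p 0 * p 2 - 2 * p 2 ^ 2 - 9 * p 1 ^ 2))|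
    with hF
  have hFc : Continuous F := by fun_prop
  rcases (Ps κ δ 1 \ prj ⁻¹' W).eq_empty_or_nonempty with h | h
  · refine ⟨1, one_pos, ?_⟩
    rw [Set.image_subset_iff]; exact Set.sdiff_eq_empty.1 h
  · obtain ⟨p, hp, hmin⟩ := hc.exists_isMinOn h hFc.continuousOn
    have hpos : 0 < F p := by
      refine (abs_nonneg _ : 0 ≤ F p).lt_of_ne fun h0 => hp.2 (hP ⟨p, ?_, rfl⟩)
      obtain ⟨h1, h2, h3, h4, h5⟩ := hp.1
      exact ⟨h1, h2, h3, h0.symm.le, h5⟩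
    refine ⟨min 1 (F p / 2), by positivity, ?_⟩
    rintro _ ⟨q, ⟨h1, h2, h3, h4, h5⟩, rfl⟩
    by_contra hq
    have := hmin (show q ∈ Ps κ δ 1 \ prj ⁻¹' W from ⟨⟨h1, h2, h3, h4.trans (min_le_left _ _), h5⟩, hq⟩)
    have h6 : F q ≤ F p / 2 := h4.trans (min_le_right _ _)
    have h7 : F p ≤ F q := this
    linarith

lemma main_count {C κ δ ε : ℝ} (hC : 0 < C) (hκ : 0 < κ) (hδ : 0 < δ) (hε : 0 < ε) :
    ∀ᶠ T : ℝ in atTop, ∃ S : Finset BQF,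
    (∀ g : BQF, (g.I : ℝ) < T ^ 2 → |(g.J : ℝ)| < C * T ^ 2 →
      (∃ B C x y, RedPar g.a g.b g.c g.d g.e g.a B C x y ∧ 0 ≤ x ∧ x ≤ 1 / 2 ∧ 1 ≤ x ^ 2 + y ^ 2) →
      κ * T ≤ g.a → δ * T ^ 2 ≤ 8 * (g.a : ℝ) * g.c - 3 * (g.b : ℝ) ^ 2 → g ∈ S) ∧
    (S.card : ℝ) ≤ (C * Real.pi ^ 2 / 162 + ε) * T ^ 4 := by
  set K0 := prj '' Ps κ δ 0 with hK0
  have hK0c : IsCompact K0 := (Ps_compact hκ).image prj_cont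
  have hK0U : K0 ⊆ U4 := by rintro _ ⟨p, hp, rfl⟩; exact Ps_U4 hκ hδ hp
  obtain ⟨r, hr, hrU, hrv⟩ := exists_thick hC (half_pos hε) hK0c hK0U (P0_sub hκ hδ)
  obtain ⟨s, hs, hsW⟩ := exists_s hκ (Metric.isOpen_thickening (δ := r / 2) (E := K0))
    (Metric.self_subset_thickening (half_pos hr) _)
  obtain ⟨Q, K1, hQm, hKQ, hQK1, hK1c, hK1W, hev⟩ := count_compact C hC (Metric.cthickening (r / 2) K0)
    (Metric.thickening r K0) hK0c.cthickening Metric.isOpen_thickening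
    (Metric.cthickening_subset_thickening' hr (half_lt_self hr) _)
    ((Metric.thickening_subset_cthickening _ _).trans hrU) (ε / 2) (half_pos hε)
  have hK1r := hK1W.trans (Metric.thickening_subset_cthickening r K0)
  have hint : ∫ m in Q, rho C m ≤ C * Real.pi ^ 2 / 162 + ε / 2 := by
    rw [← ENNReal.ofReal_le_ofReal_iff (by positivity), rho_lint hC hQm hK1c hQK1 (hK1r.trans hrU)]
    exact (MeasureTheory.lintegral_mono_set (hQK1.trans hK1r)).trans hrv
  filter_upwards [hev, eventually_ge_atTop (C / s), eventually_gt_atTop 0] with T ⟨hfin, hcard⟩ hTs hT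
  refine ⟨hfin.toFinset, ?_, ?_⟩
  · rintro g gI gJ ⟨B, D, x, y, ⟨hy, -, e2, e3, e4, e5⟩, x0, x1, hxy⟩ ga gD
    rw [Set.Finite.mem_toFinset]
    refine ⟨hKQ (Metric.thickening_subset_cthickening _ _ (hsW ?_)), gJ⟩
    rw [BQF.I_cast, e2, e3, e4, e5, I_par] at gI
    rw [BQF.J_cast, e2, e3, e4, e5, J_par] at gJ
    rw [e2, e3, D_par] at gD
    refine ⟨![g.a / T, B / T, D / T, x, y], ⟨?_, ?_, ?_, ?_, x0, x1, hxy, hy.le⟩, ?_⟩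
    · show κ ≤ g.a / T
      rwa [le_div_iff₀ hT]
    · show δ ≤ y ^ 2 * (8 * (g.a / T) * (D / T) - 3 * (B / T) ^ 2)
      have : y ^ 2 * (8 * (g.a / T) * (D / T) - 3 * (B / T) ^ 2) = y ^ 2 * (8 * g.a * D - 3 * B ^ 2) / T ^ 2 := by
        field_simp
      rw [this, le_div_iff₀ (by positivity)]; exact gD
    · show (12 * (g.a / T) ^ 2 + 3 * (B / T) ^ 2 + (D / T) ^ 2) * y ^ 4 ≤ 1
      have : (12 * (g.a / T) ^ 2 + 3 * (B / T) ^ 2 + (D / T) ^ 2) * y ^ 4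
        = (12 * g.a ^ 2 + 3 * B ^ 2 + D ^ 2) * y ^ 4 / T ^ 2 := by field_simp
      rw [this, div_le_one (by positivity)]; exact gI.le
    · show |y ^ 6 * ((6 * (g.a / T) + D / T) * (12 * (g.a / T) * (D / T) - 2 * (D / T) ^ 2 - 9 * (B / T) ^ 2))| ≤ s
      have : y ^ 6 * ((6 * (g.a / T) + D / T) * (12 * (g.a / T) * (D / T) - 2 * (D / T) ^ 2 - 9 * (B / T) ^ 2))
        = y ^ 6 * ((6 * g.a + D) * (12 * g.a * D - 2 * D ^ 2 - 9 * B ^ 2)) / T ^ 3 := by field_simp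
      rw [this, abs_div, abs_of_pos (show 0 < T ^ 3 by positivity), div_le_iff₀ (by positivity)]
      rw [div_le_iff₀ hs] at hTs
      refine gJ.le.trans ?_
      have := mul_le_mul_of_nonneg_right hTs (sq_nonneg T)
      linarith
    · show prj ![g.a / T, B / T, D / T, x, y] = ![g.a / T, g.b / T, g.c / T, g.d / T]
      rw [e2, e3, e4]
      simp only [prj, Matrix.cons_val, pb, pc, pd]
      ext i; fin_cases i
      · rfl
      all_goals simp only [Fin.reduceFinMk, Fin.mk_one, Matrix.cons_val]; ring
  · rw [← Set.ncard_eq_toFinset_card _ hfin]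
    have := (abs_le.1 hcard).2
    have : (∫ m in Q, rho C m) * T ^ 4 ≤ (C * Real.pi ^ 2 / 162 + ε / 2) * T ^ 4 := by gcongr
    linarith

lemma upper_bound {C ε : ℝ} (hC : 0 < C) (hε : 0 < ε) : ∀ᶠ T : ℝ in atTop, ∃ S : Finset BQF,
    (∀ f : BQF, f.PDf → (f.I : ℝ) < T ^ 2 → |(f.J : ℝ)| < C * T ^ 2 → ∃ g ∈ S, BQF.Equivalent f g) ∧
    (S.card : ℝ) ≤ (C * Real.pi ^ 2 / 162 + ε) * T ^ 4 := by
  classical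
  obtain ⟨K, hK, hcov⟩ := cusp_cover hC
  obtain ⟨κ, hκ, hκ1, hκe⟩ : ∃ κ : ℝ, 0 < κ ∧ κ ≤ 1 ∧ 3 * K * √κ ≤ ε / 3 := by
    refine ⟨min 1 ((ε / (9 * K)) ^ 2), by positivity, min_le_left _ _, ?_⟩
    have : √(min 1 ((ε / (9 * K)) ^ 2)) ≤ ε / (9 * K) :=
      (Real.sqrt_le_sqrt (min_le_right _ _)).trans_eq (Real.sqrt_sq (by positivity))
    calc _ ≤ 3 * K * (ε / (9 * K)) := by gcongr
      _ = ε / 3 := by field_simp; norm_num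
  have hδ : 0 < 8 * κ * κ := by positivity
  filter_upwards [main_count (ε := ε / 3) hC hκ hδ (by positivity), cusp_ev one_pos, cusp_ev hκ,
    eventually_ge_atTop 1, eventually_ge_atTop (1 / κ)] with T ⟨S2, h2, c2⟩ hl1 hl2 hT1 hTκ
  have hT : 0 < T := by linarith
  have hκT : 1 ≤ κ * T := by rw [div_le_iff₀ hκ] at hTκ; linarith
  obtain ⟨S1, h1, c1⟩ := hcov T (κ * T) 1 hT1 hκT (by nlinarith) zero_le_one
  obtain ⟨S3, h3, c3⟩ := hcov T T κ hT1 hT1 le_rfl hκ.le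
  have hsT : √T * √T = T := Real.mul_self_sqrt hT.le
  have d1 : (S1.card : ℝ) ≤ ε / 3 * T ^ 4 := by
    refine c1.trans ?_
    calc _ ≤ K * T ^ 3 * √(κ * T) * (3 * √1 * √T) := by gcongr
      _ = 3 * K * √κ * T ^ 3 * (√T * √T) := by rw [Real.sqrt_mul hκ.le, Real.sqrt_one]; ring
      _ = 3 * K * √κ * T ^ 4 := by rw [hsT]; ring
      _ ≤ _ := by gcongr
  have d3 : (S3.card : ℝ) ≤ ε / 3 * T ^ 4 := by
    refine c3.trans ?_
    calc _ ≤ K * T ^ 3 * √T * (3 * √κ * √T) := by gcongr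
      _ = 3 * K * √κ * T ^ 3 * (√T * √T) := by ring
      _ = 3 * K * √κ * T ^ 4 := by rw [hsT]; ring
      _ ≤ _ := by gcongr
  refine ⟨S1 ∪ S2 ∪ S3, fun f fP fI fJ => ?_, ?_⟩
  · obtain ⟨g, fg, hg⟩ := BQF.exists_red f fP
    have gP := BQF.equiv_PD fg fP
    have gI : (g.I : ℝ) < T ^ 2 := by rw [BQF.equiv_I fg]; exact fI
    have gJ : |(g.J : ℝ)| < C * T ^ 2 := by rw [BQF.equiv_J fg]; exact fJ
    obtain ⟨ga, gD, -⟩ := pd_ineq gP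
    rw [← BQF.I_cast] at gD
    have gD' : 8 * (g.a : ℝ) * g.c - 3 * (g.b : ℝ) ^ 2 ≤ 8 * g.a * 1 * T := by
      refine abs_le_of_sq_le_sq' ?_ (by positivity) |>.2
      have : 64 * (g.a : ℝ) ^ 2 * g.I ≤ 64 * (g.a : ℝ) ^ 2 * T ^ 2 := by gcongr
      nlinarith
    have gT : (g.a : ℝ) ≤ T := by
      obtain ⟨B, D, x, y, ⟨hy, -, e2, e3, e4, e5⟩, x0, x1, hxy⟩ := hg
      have := gI
      rw [BQF.I_cast, e2, e3, e4, e5, I_par] at this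
      have hy4 := y_bd x0 x1 hxy
      refine abs_le_of_sq_le_sq' ?_ hT.le |>.2
      have h5 : 0 ≤ (g.a : ℝ) ^ 2 * (y ^ 4 - 1 / 2) := mul_nonneg (sq_nonneg _) (by linarith)
      have h6 : 0 ≤ (3 * B ^ 2 + D ^ 2) * y ^ 4 := by positivity
      nlinarith
    by_cases ca : (g.a : ℝ) ≤ κ * T
    · obtain ⟨k, hk, gk⟩ := h1 g ⟨gP, ca, gI, gJ.le, gD'⟩
      exact ⟨k, by simp [hk], BQF.equiv_trans fg gk⟩
    push Not at ca
    by_cases cD : 8 * κ * κ * T ^ 2 ≤ 8 * (g.a : ℝ) * g.c - 3 * (g.b : ℝ) ^ 2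
    · exact ⟨g, by simp [h2 g gI gJ hg ca.le cD], fg⟩
    push Not at cD
    obtain ⟨k, hk, gk⟩ := h3 g ⟨gP, gT, gI, gJ.le, by
      have : κ * T * (κ * T) ≤ g.a * (κ * T) := by gcongr
      linarith⟩
    exact ⟨k, by simp [hk], BQF.equiv_trans fg gk⟩
  · have : ((S1 ∪ S2 ∪ S3).card : ℝ) ≤ S1.card + S2.card + S3.card := by
      exact_mod_cast (Finset.card_union_le _ _).trans (Nat.add_le_add_right (Finset.card_union_le _ _) _)
    linarith


lemma pred_pos {C X : ℝ} (hC : 0 < C) (f : BQF) : (f.Irred ∧ f.realRoots = ∅ ∧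
    (∀ x y : ℝ, ¬(x = 0 ∧ y = 0) → 0 < f.evalR x y) ∧ max |(f.I : ℝ)| (|(f.J : ℝ)| / C) < X) ↔
    (f.Irred ∧ f.PDf ∧ (f.I : ℝ) < X ∧ |(f.J : ℝ)| < C * X) := by
  rw [max_lt_iff, div_lt_iff₀ hC, mul_comm X C]
  constructor
  · rintro ⟨h1, -, h2, h3, h4⟩
    exact ⟨h1, h2, (le_abs_self _).trans_lt h3, h4⟩
  · rintro ⟨h1, h2, h3, h4⟩
    refine ⟨h1, ?_, h2, ?_, h4⟩
    · rw [Set.eq_empty_iff_forall_notMem]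
      intro z hz
      exact (h2 z 1 (by norm_num)).ne' hz
    · obtain ⟨a, b, -⟩ := pd_ineq h2
      rw [← BQF.I_cast] at b
      have : 0 < (f.I : ℝ) := pos_of_mul_pos_right ((sq_nonneg _).trans_lt b) (by positivity)
      rwa [abs_of_pos this]

lemma classCount_le {P : BQF → Prop} (S : Finset BQF) (h : ∀ f, P f → ∃ g ∈ S, BQF.Equivalent f g) :
    Finite (Quot fun f g : {h : BQF // P h} => BQF.Equivalent f.1 g.1) ∧ classCount P ≤ S.card := by
  have hs : ∀ z : Quot fun f g : {h : BQF // P h} => BQF.Equivalent f.1 g.1, ∃ g : S, BQF.Equivalent z.out.1 g.1 :=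
    fun z => by obtain ⟨g, hg, e⟩ := h _ z.out.2; exact ⟨⟨g, hg⟩, e⟩
  choose F hF using hs
  have hinj : Function.Injective F := by
    intro z w hzw
    have := BQF.equiv_trans (hF z) (BQF.equiv_symm (hzw ▸ hF w))
    rw [← z.out_eq, ← w.out_eq]
    exact Quot.sound this
  refine ⟨Finite.of_injective F hinj, ?_⟩
  have := Nat.card_le_card_of_injective F hinj
  simpa [classCount] using this

lemma le_classCount {P : BQF → Prop} (S : Finset BQF) (h : ∀ f ∈ S, P f)
    (hfin : Finite (Quot fun f g : {h : BQF // P h} => BQF.Equivalent f.1 g.1))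
    (hS : ∀ f ∈ S, ∀ g ∈ S, BQF.Equivalent f g → f = g) : S.card ≤ classCount P := by
  have hinj : Function.Injective (fun f : S => (Quot.mk _ ⟨f.1, h f.1 f.2⟩ :
      Quot fun f g : {h : BQF // P h} => BQF.Equivalent f.1 g.1)) := by
    intro f g hfg
    have he : Equivalence fun f g : {h : BQF // P h} => BQF.Equivalent f.1 g.1 :=
      ⟨fun f => BQF.equiv_refl f.1, BQF.equiv_symm, BQF.equiv_trans⟩
    have := (Equivalence.eqvGen_iff he).1 (Quot.eqvGen_exact hfg)
    exact Subtype.ext (hS _ f.2 _ g.2 this)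
  have := Nat.card_le_card_of_injective _ hinj
  simpa [classCount] using this

lemma count_pos {C : ℝ} (hC : 0 < C) : Tendsto (fun X : ℝ =>
        ((classCount fun f => f.Irred ∧ f.realRoots = ∅ ∧
            (∀ x y : ℝ, ¬(x = 0 ∧ y = 0) → 0 < f.evalR x y) ∧
            max |(f.I : ℝ)| (|(f.J : ℝ)| / C) < X) : ℝ) / X ^ 2)
      atTop (nhds (C * (Real.pi ^ 2 / 6) / 27)) := by
  simp only [pred_pos hC]
  rw [show C * (Real.pi ^ 2 / 6) / 27 = C * Real.pi ^ 2 / 162 by ring]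
  rw [Metric.tendsto_nhds]
  intro ε hε
  filter_upwards [Real.tendsto_sqrt_atTop.eventually (lower_bound hC (half_pos hε)),
    Real.tendsto_sqrt_atTop.eventually (upper_bound hC (half_pos hε)), eventually_gt_atTop 0]
    with X ⟨S, hS, cS⟩ ⟨R, hR, cR⟩ hX
  have e4 : √X ^ 4 = X ^ 2 := by rw [show √X ^ 4 = (√X ^ 2) ^ 2 by ring, Real.sq_sqrt hX.le]
  rw [Real.sq_sqrt hX.le] at hS hR
  rw [e4] at cS cR
  obtain ⟨hfin, hle⟩ := classCount_le (P := fun f => f.Irred ∧ f.PDf ∧ (f.I : ℝ) < X ∧ |(f.J : ℝ)| < C * X)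
    R fun f ⟨_, h1, h2, h3⟩ => hR f h1 h2 h3
  have hge := le_classCount S (fun f hf => by
    obtain ⟨h1, h2, h3, h4⟩ := hS f hf; exact ⟨h2, h1.pd, h3, h4⟩) hfin
    fun f hf g hg e => BQF.SR.unique (hS f hf).1 (hS g hg).1 e
  have hge' := cS.trans (Nat.cast_le.2 hge)
  have hle' := (Nat.cast_le (α := ℝ).2 hle).trans cR
  have hX2 : 0 < X ^ 2 := by positivity
  rw [← le_div_iff₀ hX2] at hge'
  rw [← div_le_iff₀ hX2] at hle'
  rw [Real.dist_eq, abs_lt]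
  constructor <;> linarith

/-- negation -/
def BQF.neg (f : BQF) : BQF := ⟨-f.a, -f.b, -f.c, -f.d, -f.e⟩

lemma BQF.neg_neg (f : BQF) : f.neg.neg = f := by simp [BQF.neg]

lemma BQF.neg_evalR (f : BQF) (x y : ℝ) : f.neg.evalR x y = -f.evalR x y := by
  simp only [BQF.neg, BQF.evalR]; push_cast; ring

lemma BQF.neg_equiv {f g : BQF} (h : BQF.Equivalent f g) : BQF.Equivalent f.neg g.neg := by
  obtain ⟨γ, h1, h2⟩ := h
  have hn : ∀ (f : BQF) (x y : ℤ), f.neg.evalZ x y = -f.evalZ x y := fun f x y => by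
    simp only [BQF.neg, BQF.evalZ]; ring
  exact ⟨γ, h1, fun x y => by rw [hn, hn, h2]⟩

lemma BQF.neg_irred {f : BQF} (h : f.Irred) : f.neg.Irred := by
  refine ⟨neg_ne_zero.2 h.1, ?_⟩
  have := (Associated.neg_right (Associated.refl _)).irreducible h.2
  convert! this using 1
  simp only [BQF.neg]; push_cast; simp only [Polynomial.C_neg]; ring

lemma count_neg (C X : ℝ) : (classCount fun f => f.Irred ∧ f.realRoots = ∅ ∧
            (∀ x y : ℝ, ¬(x = 0 ∧ y = 0) → f.evalR x y < 0) ∧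
            max |(f.I : ℝ)| (|(f.J : ℝ)| / C) < X) = classCount fun f => f.Irred ∧ f.realRoots = ∅ ∧
            (∀ x y : ℝ, ¬(x = 0 ∧ y = 0) → 0 < f.evalR x y) ∧
            max |(f.I : ℝ)| (|(f.J : ℝ)| / C) < X := by
  have hI : ∀ f : BQF, f.neg.I = f.I := fun f => by simp only [BQF.neg, BQF.I]; ring
  have hJ : ∀ f : BQF, |(f.neg.J : ℝ)| = |(f.J : ℝ)| := fun f => by
    rw [← abs_neg]; congr 1; simp only [BQF.neg, BQF.J]; push_cast; ring
  have hr : ∀ f : BQF, f.neg.realRoots = f.realRoots := fun f => by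
    ext z; simp [BQF.realRoots, BQF.neg_evalR]
  refine Nat.card_congr (Quot.congr ⟨fun f => ⟨f.1.neg, BQF.neg_irred f.2.1, ?_, ?_, ?_⟩,
    fun f => ⟨f.1.neg, BQF.neg_irred f.2.1, ?_, ?_, ?_⟩, fun f => Subtype.ext (BQF.neg_neg _),
    fun f => Subtype.ext (BQF.neg_neg _)⟩ fun f g => ⟨BQF.neg_equiv, fun h => ?_⟩)
  · rw [hr]; exact f.2.2.1
  · intro x y h; rw [BQF.neg_evalR]; linarith [f.2.2.2.1 x y h]
  · rw [hI, hJ]; exact f.2.2.2.2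
  · rw [hr]; exact f.2.2.1
  · intro x y h; rw [BQF.neg_evalR]; linarith [f.2.2.2.1 x y h]
  · rw [hI, hJ]; exact f.2.2.2.2
  · have := BQF.neg_equiv h
    simpa [BQF.neg_neg] using this


/-- Counting `GL₂(ℤ)`-classes of irreducible integral binary quartic forms with no real
roots that are positive definite (resp. negative definite), of height
`h_C = max(|I|, |J|/C) < X`: each count is `(C ζ(2)/27) X² + o(X²)`, where `ζ(2) = π²/6`. -/
theorem count_classes_definite (C : ℝ) (hC : 0 < C) :
    Tendsto (fun X : ℝ =>
        ((classCount fun f => f.Irred ∧ f.realRoots = ∅ ∧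
            (∀ x y : ℝ, ¬(x = 0 ∧ y = 0) → 0 < f.evalR x y) ∧
            max |(f.I : ℝ)| (|(f.J : ℝ)| / C) < X) : ℝ) / X ^ 2)
      atTop (nhds (C * (Real.pi ^ 2 / 6) / 27)) ∧
    Tendsto (fun X : ℝ =>
        ((classCount fun f => f.Irred ∧ f.realRoots = ∅ ∧
            (∀ x y : ℝ, ¬(x = 0 ∧ y = 0) → f.evalR x y < 0) ∧
            max |(f.I : ℝ)| (|(f.J : ℝ)| / C) < X) : ℝ) / X ^ 2)
      atTop (nhds (C * (Real.pi ^ 2 / 6) / 27)) := by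
  refine ⟨count_pos hC, ?_⟩
  simp only [count_neg]
  exact count_pos hC
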